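/- Fix 1 ≤ r < ∞. (i) For any constants C₁, C₂ > 0 and any α with min{1/(2r), (r−1)/(2r)} ≤ α < 1/2, there exist a positive integer N and a set of α-perturbed nodes x̃_{−N},…,x̃_N such that the inequalities C₁ ∫_{−π}^{π} |q(x)|^r dx ≤ (1/(2N+1)) Σ_{j=−N}^{N} |q(x̃_j)|^r ≤ C₂ ∫_{−π}^{π} |q(x)|^r dx fail for some q ∈ T_N. (ii) Conversely, if 0 ≤ α < min{1/(2r), (r−1)/(2r)}, then there exist constants C₁, C₂ > 0 (depending only on r and α) such that these inequalities hold for every positive integer N, every set of α-perturbed nodes, and every q ∈ T_N. -/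

import Mathlib

open Real Finset

/-- `q` is a trigonometric polynomial of degree ≤ N. -/
def IsTrigPoly (N : ℕ) (q : ℝ → ℂ) : Prop :=
  ∃ c : ℤ → ℂ, ∀ x : ℝ,
    q x = ∑ k ∈ Finset.Icc (-(N:ℤ)) (N:ℤ), c k * Complex.exp (Complex.I * (k : ℂ) * (x : ℂ))

/-- `x` is a set of α-perturbed nodes of size 2N+1. -/
def PerturbedNodes (N : ℕ) (α : ℝ) (x : ℤ → ℝ) : Prop :=
  ∀ j ∈ Finset.Icc (-(N:ℤ)) (N:ℤ),
    |x j - (j : ℝ) * (2*π/(2*N+1))| ≤ α * (2*π/(2*N+1))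

/-- The L^r Marcinkiewicz–Zygmund inequalities with constants C₁, C₂ for the polynomial `q`
at the nodes `x`. -/
def MZIneq (r : ℝ) (C₁ C₂ : ℝ) (N : ℕ) (x : ℤ → ℝ) (q : ℝ → ℂ) : Prop :=
  C₁ * (∫ t in (-π)..π, ‖q t‖ ^ r) ≤
      (1/(2*(N:ℝ)+1)) * ∑ j ∈ Finset.Icc (-(N:ℤ)) (N:ℤ), ‖q (x j)‖ ^ r ∧
  (1/(2*(N:ℝ)+1)) * ∑ j ∈ Finset.Icc (-(N:ℤ)) (N:ℤ), ‖q (x j)‖ ^ r ≤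
      C₂ * (∫ t in (-π)..π, ‖q t‖ ^ r)

namespace MZ

/-! ### Grid, chords and decay sums -/

/-- The grid step `2π / (2N+1)`. -/
noncomputable def step (N : ℕ) : ℝ := 2*π/(2*N+1)

/-- The index set of the nodes. -/
noncomputable abbrev idx (N : ℕ) : Finset ℤ := Finset.Icc (-(N:ℤ)) (N:ℤ)

/-- The point of the unit circle at angle `t`. -/
noncomputable def pt (t : ℝ) : ℂ := Complex.exp (t * Complex.I)

/-- Chordal distance between the points at angles `s` and `t`. -/
noncomputable def chord (s t : ℝ) : ℝ := ‖pt s - pt t‖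

/-- One plus the chordal distance measured in grid steps. -/
noncomputable def cell (N : ℕ) (s t : ℝ) : ℝ := 1 + chord s t / step N

lemma step_pos (N : ℕ) : 0 < step N := by unfold step; positivity

lemma step_mul (N : ℕ) : (2*N+1) * step N = 2*π := by
  unfold step; field_simp

lemma step_le (N : ℕ) : step N ≤ 2*π := by
  have := step_mul N
  have := step_pos N
  nlinarith [(Nat.cast_nonneg N : (0:ℝ) ≤ N)]

@[simp] lemma norm_pt (t : ℝ) : ‖pt t‖ = 1 := by
  simp [pt, Complex.norm_exp_ofReal_mul_I]

lemma pt_ne_zero (t : ℝ) : pt t ≠ 0 := Complex.exp_ne_zero _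

lemma pt_add (s t : ℝ) : pt (s + t) = pt s * pt t := by
  simp [pt, add_mul, Complex.exp_add]

lemma pt_zero : pt 0 = 1 := by simp [pt]

lemma pt_periodic : Function.Periodic pt (2*π) := by
  intro t
  rw [pt_add]; simp [pt, Complex.exp_two_pi_mul_I]

lemma continuous_pt : Continuous pt := by unfold pt; fun_prop

lemma continuous_chord (s : ℝ) : Continuous (fun t => chord t s) := by
  unfold chord
  exact (continuous_pt.sub continuous_const).norm

lemma chord_nonneg (s t : ℝ) : 0 ≤ chord s t := norm_nonneg _

lemma chord_comm (s t : ℝ) : chord s t = chord t s := norm_sub_rev _ _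

lemma chord_triangle (s u t : ℝ) : chord s t ≤ chord s u + chord u t :=
  norm_sub_le_norm_sub_add_norm_sub _ _ _

lemma chord_eq (s t : ℝ) : chord s t = 2 * |sin ((s - t)/2)| := by
  have h : pt s - pt t = pt t * (Complex.exp (Complex.I * ((s - t : ℝ) : ℂ)) - 1) := by
    rw [mul_sub, mul_one, mul_comm Complex.I, ← pt, ← pt_add]; congr 2; ring
  rw [chord, h, norm_mul, norm_pt, one_mul, Complex.norm_exp_I_mul_ofReal_sub_one]
  simp

lemma chord_le_abs (s t : ℝ) : chord s t ≤ |s - t| := by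
  rw [chord_eq]
  have := abs_sin_le_abs (x := (s-t)/2)
  rw [abs_div, abs_two] at this
  linarith

lemma one_le_cell (N : ℕ) (s t : ℝ) : 1 ≤ cell N s t := by
  have := div_nonneg (chord_nonneg s t) (step_pos N).le
  unfold cell; linarith

lemma cell_pos (N : ℕ) (s t : ℝ) : 0 < cell N s t := zero_lt_one.trans_le (one_le_cell N s t)

lemma cell_comm (N : ℕ) (s t : ℝ) : cell N s t = cell N t s := by
  unfold cell; rw [chord_comm]

lemma continuous_cell (N : ℕ) (s : ℝ) : Continuous (fun t => cell N t s) := by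
  unfold cell
  exact continuous_const.add ((continuous_chord s).div_const _)

lemma cell_le_two_mul (N : ℕ) {s u t : ℝ} (h : |u - t| ≤ step N) :
    cell N s t ≤ 2 * cell N s u := by
  have h1 := chord_triangle s u t
  have h2 := (chord_le_abs u t).trans h
  have h3 := step_pos N
  have h4 := chord_nonneg s u
  unfold cell
  have : chord s t / step N ≤ chord s u / step N + 1 := by
    rw [div_add_one h3.ne', div_le_div_iff_of_pos_right h3]; linarith
  have := div_nonneg h4 h3.le
  linarith

lemma exists_chord_ge (s t : ℝ) : ∃ l : ℤ, 2/π * |s - t - 2*π*l| ≤ chord s t := by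
  refine ⟨round ((s-t)/(2*π)), ?_⟩
  set l : ℤ := round ((s-t)/(2*π)) with hl
  have h1 : |(s-t)/(2*π) - l| ≤ 1/2 := abs_sub_round _
  have hpi := pi_pos
  have h2 : s - t - 2*π*l = 2*π*((s-t)/(2*π) - l) := by field_simp
  have h3 : |s - t - 2*π*l| ≤ π := by
    rw [h2, abs_mul, abs_of_pos (by positivity)]
    nlinarith
  have h4 : chord s t = chord (s - 2*π*l) t := by
    unfold chord
    have := pt_periodic.int_mul l (s - 2*π*l)
    rw [← this]; congr 3; ring
  rw [h4, chord_eq]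
  have h5 : |(s - 2*π*l - t)/2| ≤ π/2 := by
    rw [abs_div, abs_two]
    have : s - 2*π*l - t = s - t - 2*π*l := by ring
    rw [this]; linarith
  have h6 := mul_abs_le_abs_sin h5
  rw [abs_div, abs_two] at h6
  have h7 : s - 2*π*l - t = s - t - 2*π*l := by ring
  rw [h7] at h6 ⊢
  calc _ = 2 * (2/π * (|s - t - 2*π*l|/2)) := by ring
    _ ≤ _ := by linarith

lemma summable_one_add_abs_int {p : ℝ} (hp : 1 < p) :
    Summable (fun i : ℤ => (1 + |(i:ℝ)|) ^ (-p)) := by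
  refine Summable.of_norm_bounded_eventually (Real.summable_abs_int_rpow hp) ?_
  have : ∀ᶠ i : ℤ in Filter.cofinite, i ≠ 0 :=
    (Set.finite_singleton (0:ℤ)).subset (by intro i; simp)
  filter_upwards [this] with i hi
  have h0 : (0:ℝ) < |(i:ℝ)| := abs_pos.mpr (by exact_mod_cast hi)
  rw [Real.norm_of_nonneg (by positivity)]
  exact rpow_le_rpow_of_nonpos h0 (by linarith) (by linarith)

/-- Sums of a decaying function of the distance over nodes close to the grid are bounded. -/
lemma exists_sum_cell_le {p : ℝ} (hp : 1 < p) :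
    ∃ C : ℝ, 0 < C ∧ ∀ (N : ℕ) (x : ℤ → ℝ), (∀ j ∈ idx N, |x j - j * step N| ≤ step N) →
      ∀ t, ∑ j ∈ idx N, cell N t (x j) ^ (-p) ≤ C := by
  set g : ℤ → ℝ := fun i : ℤ => (1 + |(i:ℝ)|) ^ (-p) with hg
  have hgs : Summable g := summable_one_add_abs_int hp
  have hg0 : ∀ i, 0 ≤ g i := fun i => by positivity
  have hK : 0 < ∑' i, g i := hgs.tsum_pos hg0 0 (by simp [hg])
  refine ⟨(2*π)^p * ∑' i, g i, by positivity, fun N x hx t => ?_⟩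
  have hh := step_pos N
  have hpi := pi_pos
  choose l hl using fun j : ℤ => exists_chord_ge t (j * step N)
  set a : ℤ := ⌊t / step N⌋ with ha
  have key : ∀ j ∈ idx N, cell N t (x j) ^ (-p) ≤ (2*π)^p * g (a - (j + l j * (2*N+1))) := by
    intro j hj
    have h1 : cell N t (j * step N) ≤ 2 * cell N t (x j) := cell_le_two_mul N (hx j hj)
    set i : ℤ := j + l j * (2*N+1) with hi
    have h2 : 1 + |((a - i : ℤ) : ℝ)| ≤ π * cell N t (j * step N) := by
      have e1 : t - j * step N - 2*π*l j = step N * (t / step N - i) := by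
        rw [← step_mul N, hi]; push_cast; field_simp; ring
      have h3 := hl j
      rw [e1, abs_mul, abs_of_pos hh] at h3
      have h4 : 2 / π * |t/step N - i| ≤ chord t (j * step N) / step N := by
        rw [le_div_iff₀ hh]; linarith
      have h5 : |((a - i : ℤ) : ℝ)| ≤ 1 + |t/step N - i| := by
        have f1 := Int.floor_le (t / step N)
        have f2 := Int.lt_floor_add_one (t / step N)
        push_cast
        have : ((a:ℝ) - i) = (a - t/step N) + (t/step N - i) := by ring
        rw [this]
        refine (abs_add_le _ _).trans ?_
        gcongr
        rw [abs_le]; constructor <;> linarith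
      unfold cell
      have h6 : 2 * |t/step N - i| ≤ π * (chord t (j * step N) / step N) := by
        calc _ = π * (2 / π * |t/step N - i|) := by field_simp
          _ ≤ _ := by gcongr
      have := abs_nonneg (t/step N - i)
      nlinarith [pi_gt_three]
    have h3 : 1 + |((a - i : ℤ) : ℝ)| ≤ 2 * π * cell N t (x j) := by nlinarith
    have h4 : (2*π*cell N t (x j)) ^ (-p) ≤ g (a - i) :=
      rpow_le_rpow_of_nonpos (by positivity) h3 (by linarith)
    rw [mul_rpow (by positivity) (cell_pos _ _ _).le] at h4
    calc cell N t (x j) ^ (-p) = (2*π)^p * ((2*π)^(-p) * cell N t (x j) ^ (-p)) := by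
          rw [← mul_assoc, ← rpow_add (by positivity)]; simp
      _ ≤ _ := by gcongr
  refine (sum_le_sum key).trans ?_
  rw [← mul_sum]
  gcongr
  have hinj : Set.InjOn (fun j : ℤ => a - (j + l j * (2*N+1))) (idx N : Set ℤ) := by
    intro j hj k hk hjk
    simp only [coe_Icc, Set.mem_Icc] at hj hk
    have h1 : j - k = (l k - l j) * (2*N+1) := by simp only at hjk; linarith
    rcases lt_trichotomy (l k - l j) 0 with h | h | h
    · exfalso; nlinarith
    · rw [h] at h1; linarith
    · exfalso; nlinarith
  calc ∑ j ∈ idx N, g (a - (j + l j * (2*N+1)))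
      = ∑ i ∈ (idx N).image (fun j : ℤ => a - (j + l j * (2*N+1))), g i := by
        rw [sum_image hinj]
    _ ≤ _ := hgs.sum_le_tsum _ (fun i _ => hg0 i)

/-- Distinct nodes are separated. -/
lemma chord_node_ge {N : ℕ} {α : ℝ} {x : ℤ → ℝ}
    (hx : ∀ j ∈ idx N, |x j - j * step N| ≤ α * step N) {j m : ℤ} (hj : j ∈ idx N)
    (hm : m ∈ idx N) (hne : j ≠ m) : 2/π * ((1 - 2*α) * step N) ≤ chord (x j) (x m) := by
  obtain ⟨l, hl⟩ := exists_chord_ge (x j) (x m)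
  refine le_trans ?_ hl
  have hpi := pi_pos
  gcongr
  have hh := step_pos N
  simp only [mem_Icc] at hj hm
  have h0 : j - m - l * (2*N+1) ≠ 0 := by
    intro h
    have h1 : j - m = l * (2*N+1) := by linarith
    rcases lt_trichotomy l 0 with h | h | h
    · nlinarith
    · rw [h] at h1; exact hne (by linarith)
    · nlinarith
  have h1 : (1:ℝ) ≤ |((j - m - l * (2*N+1) : ℤ) : ℝ)| := by exact_mod_cast Int.one_le_abs h0
  have e : ((j - m - l * (2*N+1) : ℤ) : ℝ) * step N =
      (x j - x m - 2*π*l) - (x j - j * step N) + (x m - m * step N) := by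
    rw [← step_mul N]; push_cast; ring
  have h2 : step N ≤ |((j - m - l * (2*N+1) : ℤ) : ℝ) * step N| := by
    rw [abs_mul, abs_of_pos hh]; nlinarith
  rw [e] at h2
  have h3 := abs_add_le ((x j - x m - 2*π*l) - (x j - j * step N)) (x m - m * step N)
  have h4 := abs_sub (x j - x m - 2*π*l) (x j - j * step N)
  have h5 := hx j (by simpa using hj)
  have h6 := hx m (by simpa using hm)
  linarith

lemma sum_idx (N : ℕ) {β : Type*} [AddCommMonoid β] (f : ℤ → β) :
    ∑ j ∈ idx N, f j = ∑ k ∈ range (2*N+1), f ((k:ℤ) - N) := by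
  symm
  refine sum_nbij' (fun k : ℕ => (k:ℤ) - N) (fun j => (j + N).toNat) ?_ ?_ ?_ ?_ ?_
  · intro k hk; simp only [mem_range] at hk; simp only [mem_Icc]; omega
  · intro j hj; simp only [mem_Icc] at hj; simp only [mem_range]; omega
  · intro k hk; simp
  · intro j hj; simp only [mem_Icc] at hj; omega
  · intro k hk; rfl

lemma sum_integral_step {F : ℝ → ℝ} (hF : Continuous F) (hp : Function.Periodic F (2*π))
    (N : ℕ) (a : ℝ) :
    ∑ j ∈ idx N, ∫ t in (0:ℝ)..step N, F (a + j * step N + t) = ∫ t in (-π)..π, F t := by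
  rw [sum_idx]
  have h1 : ∀ k ∈ range (2*N+1), (∫ t in (0:ℝ)..step N, F (a + (((k:ℤ) - N : ℤ) : ℝ) * step N + t))
      = ∫ t in (a - N * step N + (k:ℕ) * step N)..(a - N * step N + ((k+1:ℕ):ℝ) * step N), F t := by
    intro k _
    rw [intervalIntegral.integral_comp_add_left]
    congr 1 <;> push_cast <;> ring
  rw [sum_congr rfl h1, intervalIntegral.sum_integral_adjacent_intervals
    (a := fun k : ℕ => a - N * step N + (k:ℝ) * step N)
    (fun k _ => hF.intervalIntegrable _ _)]
  have h2 : a - N * step N + ((2*N+1 : ℕ):ℝ) * step N = (a - N * step N + ((0:ℕ):ℝ) * step N) + 2*π := by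
    rw [← step_mul N]; push_cast; ring
  rw [h2, hp.intervalIntegral_add_eq _ (-π)]
  congr 1; ring

lemma cell_add_periodic (N : ℕ) (s : ℝ) : Function.Periodic (fun t => cell N t s) (2*π) := by
  intro t
  simp only [cell, chord]
  rw [pt_periodic t]

/-- Integrals of a decaying function of the distance. -/
lemma exists_integral_cell_le {p : ℝ} (hp : 1 < p) :
    ∃ C : ℝ, 0 < C ∧ ∀ (N : ℕ) (s : ℝ),
      ∫ t in (-π)..π, cell N t s ^ (-p) ≤ C * step N := by
  obtain ⟨C, hC, hsum⟩ := exists_sum_cell_le hp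
  refine ⟨C, hC, fun N s => ?_⟩
  have hh := step_pos N
  have hcont : Continuous (fun t => cell N t s ^ (-p)) :=
    (continuous_cell N s).rpow_const (fun t => Or.inl (cell_pos N t s).ne')
  have hcj : ∀ j : ℤ, Continuous (fun t => cell N (0 + j * step N + t) s ^ (-p)) :=
    fun j => hcont.comp (continuous_const_add _)
  rw [← sum_integral_step hcont (fun t => by simp only [cell_add_periodic N s t]) N 0,
    ← intervalIntegral.integral_finsetSum fun j _ => (hcj j).intervalIntegrable _ _]
  have : ∫ t in (0:ℝ)..step N, ∑ j ∈ idx N, cell N (0 + j * step N + t) s ^ (-p)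
      ≤ ∫ t in (0:ℝ)..step N, C := by
    refine intervalIntegral.integral_mono_on hh.le ?_ (by simp) ?_
    · exact (continuous_finsetSum _ fun j _ => hcj j).intervalIntegrable _ _
    · intro t ht
      have h1 := hsum N (fun j => j * step N) (fun j _ => by simpa using hh.le) (s - t)
      refine le_of_eq_of_le (sum_congr rfl fun j _ => ?_) h1
      congr 1
      rw [cell_comm]
      unfold cell; rw [chord_eq, chord_eq]; congr 5; ring
  refine this.trans ?_
  simp [mul_comm]

/-! ### Weighted power-mean inequalities -/

lemma sum_mul_rpow_le {ι : Type*} (s : Finset ι) {r A : ℝ} (hr : 1 ≤ r) (K f : ι → ℝ)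
    (hK : ∀ i, 0 ≤ K i) (hf : ∀ i, 0 ≤ f i) (hA : ∑ i ∈ s, K i ≤ A) :
    (∑ i ∈ s, K i * f i) ^ r ≤ A ^ (r - 1) * ∑ i ∈ s, K i * f i ^ r := by
  have hr0 : 0 < r := by linarith
  have h0 : 0 ≤ ∑ i ∈ s, K i := sum_nonneg fun i _ => hK i
  have h1 : 0 ≤ ∑ i ∈ s, K i * f i ^ r :=
    sum_nonneg fun i _ => mul_nonneg (hK i) (rpow_nonneg (hf i) _)
  have h2 : 0 ≤ ∑ i ∈ s, K i * f i := sum_nonneg fun i _ => mul_nonneg (hK i) (hf i)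
  calc (∑ i ∈ s, K i * f i) ^ r
      ≤ ((∑ i ∈ s, K i) ^ (1 - r⁻¹) * (∑ i ∈ s, K i * f i ^ r) ^ r⁻¹) ^ r :=
        rpow_le_rpow h2 (Real.inner_le_weight_mul_Lp_of_nonneg s hr K f hK hf) hr0.le
    _ = (∑ i ∈ s, K i) ^ (r - 1) * ∑ i ∈ s, K i * f i ^ r := by
        rw [mul_rpow (by positivity) (by positivity), ← rpow_mul h0, ← rpow_mul h1,
          inv_mul_cancel₀ hr0.ne', rpow_one, sub_mul, inv_mul_cancel₀ hr0.ne', one_mul]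
    _ ≤ _ := by
        gcongr

lemma tangent_le_rpow {r m F : ℝ} (hr : 1 ≤ r) (hm : 0 < m) (hF : 0 ≤ F) :
    m ^ r + r * m ^ (r - 1) * (F - m) ≤ F ^ r := by
  have h1 := one_add_mul_self_le_rpow_one_add (s := F / m - 1) (by
    have := div_nonneg hF hm.le; linarith) hr
  have h2 : (1 + (F / m - 1)) ^ r = F ^ r / m ^ r := by
    rw [add_sub_cancel, div_rpow hF hm.le]
  rw [h2, le_div_iff₀ (by positivity)] at h1
  refine le_of_eq_of_le ?_ h1
  rw [rpow_sub_one hm.ne']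
  field_simp

lemma integral_mul_rpow_le {r A a b : ℝ} (hr : 1 ≤ r) (hab : a < b) {K F : ℝ → ℝ}
    (hK : Continuous K) (hF : Continuous F) (hK0 : ∀ t, 0 < K t) (hF0 : ∀ t, 0 ≤ F t)
    (hA : ∫ t in a..b, K t ≤ A) :
    (∫ t in a..b, K t * F t) ^ r ≤ A ^ (r - 1) * ∫ t in a..b, K t * F t ^ r := by
  have hr0 : 0 < r := by linarith
  have hFr : Continuous (fun t => F t ^ r) := hF.rpow_const fun t => Or.inr hr0.le
  have hKpos : 0 < ∫ t in a..b, K t :=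
    intervalIntegral.intervalIntegral_pos_of_pos (hK.intervalIntegrable _ _) hK0 hab
  have hI : 0 ≤ ∫ t in a..b, K t * F t :=
    intervalIntegral.integral_nonneg hab.le fun t _ => mul_nonneg (hK0 t).le (hF0 t)
  have hIr : 0 ≤ ∫ t in a..b, K t * F t ^ r :=
    intervalIntegral.integral_nonneg hab.le fun t _ =>
      mul_nonneg (hK0 t).le (rpow_nonneg (hF0 t) _)
  have hApos : 0 < A := hKpos.trans_le hA
  rcases hI.eq_or_lt with h | hpos
  · rw [← h, zero_rpow hr0.ne']; positivity
  set k := ∫ t in a..b, K t with hk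
  set m := (∫ t in a..b, K t * F t) / k with hm
  have hm0 : 0 < m := by positivity
  have hmk : ∫ t in a..b, K t * F t = m * k := by rw [hm]; field_simp
  have key : m ^ r * k ≤ ∫ t in a..b, K t * F t ^ r := by
    have h1 : ∫ t in a..b, ((m ^ r - r * m ^ (r-1) * m) * K t + r * m ^ (r-1) * (K t * F t))
        ≤ ∫ t in a..b, K t * F t ^ r := by
      refine intervalIntegral.integral_mono_on hab.le ?_ ?_ ?_
      · exact Continuous.intervalIntegrable (by fun_prop) _ _
      · exact (hK.mul hFr).intervalIntegrable _ _
      · intro t _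
        have := mul_le_mul_of_nonneg_left (tangent_le_rpow hr hm0 (hF0 t)) (hK0 t).le
        linarith
    refine le_of_eq_of_le ?_ h1
    rw [intervalIntegral.integral_add (Continuous.intervalIntegrable (by fun_prop) _ _)
      (Continuous.intervalIntegrable (by fun_prop) _ _), intervalIntegral.integral_const_mul,
      intervalIntegral.integral_const_mul, hmk, ← hk]
    ring
  calc (∫ t in a..b, K t * F t) ^ r = k ^ (r-1) * (m ^ r * k) := by
        rw [hmk, mul_rpow hm0.le hKpos.le, rpow_sub_one hKpos.ne']; field_simp
    _ ≤ A ^ (r-1) * ∫ t in a..b, K t * F t ^ r := by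
        gcongr

/-! ### Trigonometric polynomials and the reproducing kernel -/

/-- The trigonometric polynomial with coefficients `c`, as an entire function. -/
noncomputable def trig (N : ℕ) (c : ℤ → ℂ) (w : ℂ) : ℂ :=
  ∑ k ∈ idx N, c k * Complex.exp (Complex.I * k * w)

/-- The Dirichlet kernel. -/
noncomputable def dir (N : ℕ) (w : ℂ) : ℂ := ∑ k ∈ idx N, Complex.exp (Complex.I * k * w)

/-- A de la Vallée-Poussin type kernel, reproducing trigonometric polynomials of degree `N`. -/
noncomputable def vp (N : ℕ) (w : ℂ) : ℂ := dir (2*N) w * dir N w / (2*N+1)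

lemma continuous_trig (N : ℕ) (c : ℤ → ℂ) : Continuous (trig N c) := by
  unfold trig; fun_prop

lemma continuous_vp (N : ℕ) : Continuous (vp N) := by
  unfold vp dir; fun_prop

lemma card_idx (N : ℕ) : (idx N).card = 2*N+1 := by
  simp only [Int.card_Icc]; omega

lemma trig_mul_vp (N : ℕ) (c : ℤ → ℂ) (x t : ℂ) :
    trig N c t * vp N (x - t) = (∑ k ∈ idx N, ∑ b ∈ idx N, ∑ a ∈ idx (2*N),
      c k * Complex.exp (Complex.I * ((a + b : ℤ) : ℂ) * x) *
        Complex.exp (Complex.I * ((k - a - b : ℤ) : ℂ) * t)) / (2*N+1) := by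
  unfold trig vp dir
  rw [← mul_div_assoc, mul_comm (∑ k ∈ idx (2*N), _), sum_mul_sum, sum_mul]
  congr 1
  refine sum_congr rfl fun k _ => ?_
  rw [mul_sum]
  refine sum_congr rfl fun b _ => ?_
  rw [mul_sum]
  refine sum_congr rfl fun a _ => ?_
  rw [mul_assoc (c k), mul_assoc (c k), ← Complex.exp_add, ← Complex.exp_add, ← Complex.exp_add]
  congr 2
  push_cast; ring

lemma sum_mean_kernel (N : ℕ) (c : ℤ → ℂ) (x : ℂ) (M : ℤ → ℂ) (h0 : M 0 = 1)
    (hM : ∀ m : ℤ, m ≠ 0 → |m| ≤ 4*N → M m = 0) :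
    (∑ k ∈ idx N, ∑ b ∈ idx N, ∑ a ∈ idx (2*N),
      c k * Complex.exp (Complex.I * ((a + b : ℤ) : ℂ) * x) * M (k - a - b)) / (2*N+1)
      = trig N c x := by
  have h1 : ∀ k ∈ idx N, ∀ b ∈ idx N, ∑ a ∈ idx (2*N),
      c k * Complex.exp (Complex.I * ((a + b : ℤ) : ℂ) * x) * M (k - a - b)
      = c k * Complex.exp (Complex.I * k * x) := by
    intro k hk b hb
    simp only [mem_Icc] at hk hb
    rw [sum_eq_single (k - b)]
    · simp [h0]
    · intro a ha hne
      simp only [mem_Icc] at ha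
      rw [hM _ (by omega) (by rw [abs_le]; constructor <;> push_cast at * <;> omega), mul_zero]
    · intro h; exfalso; apply h; simp only [mem_Icc]; push_cast; omega
  have h2 : ∀ k ∈ idx N, ∑ b ∈ idx N, ∑ a ∈ idx (2*N),
      c k * Complex.exp (Complex.I * ((a + b : ℤ) : ℂ) * x) * M (k - a - b)
      = (2*N+1) * (c k * Complex.exp (Complex.I * k * x)) := by
    intro k hk
    rw [sum_congr rfl (h1 k hk), sum_const, card_idx]
    simp
  rw [sum_congr rfl h2, ← mul_sum, trig, mul_div_cancel_left₀]
  exact_mod_cast Nat.succ_ne_zero (2*N)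

lemma integral_exp_int {m : ℤ} (hm : m ≠ 0) :
    ∫ t in (-π)..π, Complex.exp (Complex.I * m * (t:ℂ)) = 0 := by
  rw [integral_exp_mul_complex (by simp [hm]), div_eq_zero_iff]
  left
  rw [sub_eq_zero, Complex.exp_eq_exp_iff_exists_int]
  exact ⟨m, by push_cast; ring⟩

lemma trig_eq_integral (N : ℕ) (c : ℤ → ℂ) (x : ℝ) :
    trig N c x = (1/(2*π)) * ∫ t in (-π)..π, trig N c t * vp N (x - t) := by
  simp_rw [trig_mul_vp]
  rw [intervalIntegral.integral_div, intervalIntegral.integral_finsetSum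
    (fun k _ => Continuous.intervalIntegrable (by fun_prop) _ _)]
  rw [← sum_mean_kernel N c x
    (fun m => (1/(2*π)) * ∫ t in (-π)..π, Complex.exp (Complex.I * m * (t:ℂ)))]
  · rw [← mul_div_assoc, mul_sum]
    congr 1
    refine sum_congr rfl fun k _ => ?_
    rw [intervalIntegral.integral_finsetSum
      (fun k _ => Continuous.intervalIntegrable (by fun_prop) _ _), mul_sum]
    refine sum_congr rfl fun b _ => ?_
    rw [intervalIntegral.integral_finsetSum
      (fun k _ => Continuous.intervalIntegrable (by fun_prop) _ _), mul_sum]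
    refine sum_congr rfl fun a _ => ?_
    rw [intervalIntegral.integral_const_mul]
    ring
  · have : (π:ℂ) ≠ 0 := by exact_mod_cast pi_ne_zero
    simp
    field_simp
    norm_num
  · intro m hm _
    simp only [integral_exp_int hm, mul_zero]

lemma sum_exp_grid (N : ℕ) {m : ℤ} (hm : m ≠ 0) (hmN : |m| ≤ 2*N) (y : ℝ) :
    ∑ j ∈ idx N, Complex.exp (Complex.I * m * (((j * step N : ℝ) : ℂ) + y * Complex.I)) = 0 := by
  rw [sum_idx]
  set ω := Complex.exp (Complex.I * m * (step N : ℝ)) with hω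
  have h1 : ∀ k ∈ range (2*N+1), Complex.exp (Complex.I * m *
      ((((((k:ℤ) - N : ℤ) : ℝ) * step N : ℝ) : ℂ) + y * Complex.I)) =
      Complex.exp (Complex.I * m * (-(N * step N : ℝ) + y * Complex.I)) * ω ^ k := by
    intro k _
    rw [hω, ← Complex.exp_nat_mul, ← Complex.exp_add]
    congr 1; push_cast; ring
  rw [sum_congr rfl h1, ← mul_sum]
  have hne : ω ≠ 1 := by
    rw [hω, Ne, Complex.exp_eq_one_iff]
    rintro ⟨l, hl⟩
    have h2 : ((m * step N : ℝ) : ℂ) = ((l * (2*π) : ℝ) : ℂ) := by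
      have := congrArg (fun z => z * (-Complex.I)) hl
      push_cast
      ring_nf at this
      simp only [Complex.I_sq] at this
      linear_combination this
    have h3 : m * step N = l * (2*π) := by exact_mod_cast h2
    rw [← step_mul N] at h3
    have h4 : (m:ℝ) = l * (2*N+1) := by
      have := step_pos N
      apply mul_right_cancel₀ this.ne'; linarith
    have h5 : m = l * (2*N+1) := by exact_mod_cast h4
    rw [abs_le] at hmN
    rcases lt_trichotomy l 0 with h | h | h
    · nlinarith
    · rw [h] at h5; exact hm (by linarith)
    · nlinarith
  have hpow : ω ^ (2*N+1) = 1 := by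
    rw [hω, ← Complex.exp_nat_mul, Complex.exp_eq_one_iff]
    refine ⟨m, ?_⟩
    have : ((2*N+1 : ℝ) : ℂ) * (step N : ℝ) = ((2*π : ℝ):ℂ) := by
      rw [← step_mul N]; push_cast; ring
    push_cast at this ⊢
    linear_combination (Complex.I * m) * this
  rw [geom_sum_eq hne, hpow, sub_self, zero_div, mul_zero]

lemma trig_eq_sum (N : ℕ) (c : ℤ → ℂ) (x y : ℝ) :
    trig N c x = (1/(4*N+1)) * ∑ j ∈ idx (2*N),
      trig N c ((j * step (2*N) : ℝ) + y * Complex.I) *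
        vp N (x - ((j * step (2*N) : ℝ) + y * Complex.I)) := by
  simp_rw [trig_mul_vp]
  rw [← sum_mean_kernel N c x (fun m => (1/(4*N+1)) * ∑ j ∈ idx (2*N),
    Complex.exp (Complex.I * m * (((j * step (2*N) : ℝ) : ℂ) + y * Complex.I)))]
  · rw [← sum_div, ← mul_div_assoc, mul_sum]
    congr 1
    simp_rw [mul_sum]
    symm
    refine sum_comm.trans (sum_congr rfl fun k _ => ?_)
    refine sum_comm.trans (sum_congr rfl fun b _ => ?_)
    refine sum_comm.trans (sum_congr rfl fun a _ => ?_)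
    refine sum_congr rfl fun j _ => ?_
    ring
  · have : (4*N+1 : ℂ) ≠ 0 := by exact_mod_cast Nat.succ_ne_zero (4*N)
    simp only [Int.cast_zero, mul_zero, zero_mul, Complex.exp_zero, sum_const, card_idx]
    simp only [nsmul_eq_mul, mul_one]
    push_cast
    rw [show (2*(2*(N:ℂ))+1) = 4*N+1 by ring, one_div, inv_mul_cancel₀ this]
  · intro m hm hmN
    rw [sum_exp_grid (2*N) hm (by push_cast; linarith), mul_zero]

lemma norm_exp_int (k : ℤ) (u y : ℝ) :
    ‖Complex.exp (Complex.I * k * (u + y * Complex.I))‖ = Real.exp (-(k * y)) := by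
  rw [Complex.norm_exp]; congr 1
  simp

lemma dir_mul (N : ℕ) (w : ℂ) :
    dir N w * (Complex.exp (Complex.I * w) - 1) =
      Complex.exp (Complex.I * ((N + 1 : ℤ) : ℂ) * w) - Complex.exp (Complex.I * ((-N : ℤ) : ℂ) * w) := by
  unfold dir
  rw [sum_idx]
  have h1 : ∀ k ∈ range (2*N+1), Complex.exp (Complex.I * (((k:ℤ) - N : ℤ) : ℂ) * w) =
      Complex.exp (Complex.I * ((-N : ℤ) : ℂ) * w) * Complex.exp (Complex.I * w) ^ k := by
    intro k _
    rw [← Complex.exp_nat_mul, ← Complex.exp_add]; congr 1; push_cast; ring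
  rw [sum_congr rfl h1, ← mul_sum, mul_assoc, geom_sum_mul, mul_sub, mul_one,
    ← Complex.exp_nat_mul, ← Complex.exp_add]
  congr 2; push_cast; ring

lemma norm_dir_le {B : ℝ} (N : ℕ) {u y : ℝ} (hy : |y| ≤ B * step N) :
    ‖dir N (u + y * Complex.I)‖ * cell N u 0 ≤ (2*N+1) * (2 * Real.exp (2*π*B)) := by
  have hh := step_pos N
  have hpi := pi_gt_three
  have hbd : ∀ k : ℤ, |k| ≤ N + 1 → ‖Complex.exp (Complex.I * k * (u + y * Complex.I))‖
      ≤ Real.exp (2*π*B) := by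
    intro k hk
    rw [norm_exp_int, Real.exp_le_exp]
    have h1 : |(k:ℝ)| ≤ N + 1 := by exact_mod_cast hk
    have h2 : -((k:ℝ) * y) ≤ |(k:ℝ)| * |y| := by rw [← abs_mul]; exact neg_le_abs _
    have h3 : |(k:ℝ)| * |y| ≤ (2*N+1) * (B * step N) := by
      gcongr
      linarith [(Nat.cast_nonneg N : (0:ℝ) ≤ N)]
    have := step_mul N
    have h4 : (2*N+1) * (B * step N) = 2*π*B := by rw [← this]; ring
    linarith
  have h1 : ‖dir N (u + y * Complex.I)‖ ≤ (2*N+1) * Real.exp (2*π*B) := by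
    unfold dir
    refine (norm_sum_le _ _).trans ((sum_le_sum (g := fun _ => Real.exp (2*π*B)) ?_).trans ?_)
    · intro k hk
      simp only [mem_Icc] at hk
      exact hbd k (by rw [abs_le]; omega)
    · rw [sum_const, card_idx]; simp
  have h2 : ‖dir N (u + y * Complex.I)‖ * ‖Complex.exp (Complex.I * (u + y * Complex.I)) - 1‖
      ≤ 2 * Real.exp (2*π*B) := by
    rw [← norm_mul, dir_mul]
    refine (norm_sub_le _ _).trans ?_
    have := hbd (N+1) (by rw [abs_le]; omega)
    have := hbd (-N) (by rw [abs_le]; omega)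
    linarith
  have h3 : chord u 0 ≤ 2 * ‖Complex.exp (Complex.I * (u + y * Complex.I)) - 1‖ := by
    have e : Complex.exp (Complex.I * (u + y * Complex.I)) = (Real.exp (-y) : ℝ) * pt u := by
      rw [pt, Complex.ofReal_exp, ← Complex.exp_add]; congr 1
      push_cast; linear_combination (y:ℂ) * Complex.I_sq
    rw [e, chord, pt_zero]
    have f1 : ‖pt u - (Real.exp (-y) : ℝ) * pt u‖ ≤ ‖(Real.exp (-y) : ℝ) * pt u - 1‖ := by
      have : pt u - (Real.exp (-y) : ℝ) * pt u = ((1 - Real.exp (-y) : ℝ) : ℂ) * pt u := by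
        push_cast; ring
      rw [this, norm_mul, norm_pt, mul_one, Complex.norm_real, Real.norm_eq_abs, abs_sub_comm]
      have := abs_norm_sub_norm_le ((Real.exp (-y) : ℝ) * pt u) 1
      rw [norm_mul, norm_pt, mul_one, Complex.norm_real, norm_one,
        Real.norm_of_nonneg (Real.exp_pos _).le] at this
      exact this
    have f2 : pt u - 1 = (pt u - (Real.exp (-y) : ℝ) * pt u) + ((Real.exp (-y) : ℝ) * pt u - 1) := by
      ring
    rw [f2]
    refine (norm_add_le _ _).trans ?_
    linarith
  have h4 : ‖dir N (u + y * Complex.I)‖ * (chord u 0 / step N) ≤ (2*N+1) * Real.exp (2*π*B) := by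
    have hd := norm_nonneg (dir N (u + y * Complex.I))
    have h5 : ‖dir N (u + y * Complex.I)‖ * chord u 0 ≤ 4 * Real.exp (2*π*B) := by
      have := mul_le_mul_of_nonneg_left h3 hd
      linarith
    rw [← mul_div_assoc, div_le_iff₀ hh]
    have := step_mul N
    have h6 : (2*N+1) * Real.exp (2*π*B) * step N = 2*π * Real.exp (2*π*B) := by
      rw [← this]; ring
    rw [h6]
    have := Real.exp_pos (2*π*B)
    nlinarith
  unfold cell
  linarith

lemma step_le_two_mul (N : ℕ) : step N ≤ 2 * step (2*N) := by
  unfold step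
  have hpi := pi_pos
  rw [← mul_div_assoc, div_le_div_iff₀ (by positivity) (by positivity)]
  push_cast
  nlinarith

lemma step_two_mul_le (N : ℕ) : step (2*N) ≤ step N := by
  unfold step
  have hpi := pi_pos
  gcongr
  linarith [(Nat.cast_nonneg N : (0:ℝ) ≤ N)]

lemma cell_le_cell_two_mul (N : ℕ) (s t : ℝ) : cell N s t ≤ cell (2*N) s t := by
  unfold cell
  have := step_pos (2*N)
  have := chord_nonneg s t
  have := step_two_mul_le N
  gcongr

lemma cell_two_mul_le (N : ℕ) (s t : ℝ) : cell (2*N) s t ≤ 2 * cell N s t := by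
  unfold cell
  have h1 := step_pos (2*N)
  have h0 := step_pos N
  have h2 := chord_nonneg s t
  have h3 := step_le_two_mul N
  have : chord s t / step (2*N) ≤ 2 * (chord s t / step N) := by
    rw [← mul_div_assoc, div_le_div_iff₀ h1 h0]; nlinarith
  linarith

lemma norm_vp_le {B : ℝ} (N : ℕ) {u y : ℝ} (hy : |y| ≤ B * step N) :
    ‖vp N (u + y * Complex.I)‖ ≤
      (8 * Real.exp (2*π*(2*B)) * Real.exp (2*π*B)) * (2*N+1) * cell N u 0 ^ (-2:ℝ) := by
  have hB : 0 ≤ B := nonneg_of_mul_nonneg_left ((abs_nonneg y).trans hy) (step_pos N)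
  have h1 := norm_dir_le N (u := u) hy
  have h2 := norm_dir_le (B := 2*B) (2*N) (u := u) (y := y)
    (hy.trans (by nlinarith [step_le_two_mul N]))
  have hc := cell_pos N u 0
  have hc2 := cell_le_cell_two_mul N u 0
  have hn : (0:ℝ) < 2*N+1 := by positivity
  rw [rpow_neg hc.le, rpow_two, ← div_eq_mul_inv, le_div_iff₀ (by positivity), vp, norm_div, norm_mul]
  have e : ‖(2*N+1 : ℂ)‖ = 2*N+1 := by
    have : ((2*N+1 : ℝ) : ℂ) = 2*N+1 := by push_cast; ring
    rw [← this, Complex.norm_real, Real.norm_of_nonneg hn.le]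
  rw [e, div_mul_eq_mul_div, div_le_iff₀ hn]
  set d1 := ‖dir N (u + y * Complex.I)‖
  set d2 := ‖dir (2*N) (u + y * Complex.I)‖
  have hd1 : 0 ≤ d1 := norm_nonneg _
  have hd2 : 0 ≤ d2 := norm_nonneg _
  have h3 : d2 * cell N u 0 ≤ 2*(2*N+1) * (2 * Real.exp (2*π*(2*B))) := by
    refine (mul_le_mul_of_nonneg_left hc2 hd2).trans (h2.trans ?_)
    gcongr
    push_cast; linarith
  calc d2 * d1 * cell N u 0 ^ 2 = (d2 * cell N u 0) * (d1 * cell N u 0) := by ring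
    _ ≤ (2*(2*N+1) * (2 * Real.exp (2*π*(2*B)))) * ((2*N+1) * (2 * Real.exp (2*π*B))) := by gcongr
    _ = _ := by ring

lemma cell_sub (N : ℕ) (s t : ℝ) : cell N (s - t) 0 = cell N s t := by
  unfold cell; rw [chord_eq, chord_eq, sub_zero]

/-- Values of a trigonometric polynomial on a well-spread family of points are controlled
by its `L^r` norm. -/
lemma exists_sum_trig_le {r : ℝ} (hr : 1 ≤ r) (A : ℝ) :
    ∃ C : ℝ, 0 < C ∧ ∀ (N : ℕ) (s : Finset ℤ) (τ : ℤ → ℝ),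
      (∀ t, ∑ j ∈ s, cell N t (τ j) ^ (-2:ℝ) ≤ A) → ∀ c : ℤ → ℂ,
      step N * ∑ j ∈ s, ‖trig N c (τ j)‖ ^ r ≤ C * ∫ t in (-π)..π, ‖trig N c t‖ ^ r := by
  obtain ⟨C₁, hC₁, hInt⟩ := exists_integral_cell_le (p := 2) (by norm_num)
  set C₀ : ℝ := 8 * Real.exp (2*π*(2*0)) * Real.exp (2*π*0) with hC₀
  have hC₀pos : 0 < C₀ := by positivity
  have hr0 : 0 < r := by linarith
  refine ⟨C₀ ^ r * C₁ ^ (r-1) * (|A| + 1), by positivity, fun N s τ hs c => ?_⟩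
  have hh := step_pos N
  have hpi := pi_pos
  have hK : ∀ x : ℝ, Continuous (fun t => cell N t x ^ (-2:ℝ)) := fun x =>
    (continuous_cell N x).rpow_const (fun t => Or.inl (cell_pos N t x).ne')
  have hq : Continuous (fun t : ℝ => ‖trig N c t‖) :=
    ((continuous_trig N c).comp Complex.continuous_ofReal).norm
  have hqr : Continuous (fun t : ℝ => ‖trig N c t‖ ^ r) := hq.rpow_const fun t => Or.inr hr0.le
  have hKq : ∀ x : ℝ, Continuous (fun t : ℝ => cell N t x ^ (-2:ℝ) * ‖trig N c t‖ ^ r) :=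
    fun x => (hK x).mul hqr
  have point : ∀ x : ℝ, step N * ‖trig N c x‖ ^ r ≤
      C₀ ^ r * C₁ ^ (r-1) * ∫ t in (-π)..π, cell N t x ^ (-2:ℝ) * ‖trig N c t‖ ^ r := by
    intro x
    have h1 : ‖trig N c x‖ ≤
        C₀ / step N * ∫ t in (-π)..π, cell N t x ^ (-2:ℝ) * ‖trig N c t‖ := by
      rw [trig_eq_integral, norm_mul]
      have e1 : ‖(1/(2*π) : ℂ)‖ = 1/(2*π) := by
        rw [norm_div, norm_mul, Complex.norm_real, Real.norm_of_nonneg hpi.le]; simp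
      rw [e1]
      have h2 : ‖∫ t in (-π)..π, trig N c t * vp N (x - t)‖ ≤
          ∫ t in (-π)..π, C₀ * (2*N+1) * (cell N t x ^ (-2:ℝ) * ‖trig N c t‖) := by
        refine (intervalIntegral.norm_integral_le_integral_norm (by linarith)).trans ?_
        refine intervalIntegral.integral_mono_on (by linarith) ?_ ?_ ?_
        · have := continuous_trig N c
          have := continuous_vp N
          exact Continuous.intervalIntegrable (by fun_prop) _ _
        · exact (continuous_const.mul ((hK x).mul hq)).intervalIntegrable _ _
        · intro t _
          have h3 := norm_vp_le (B := 0) N (u := x - t) (y := 0) (by simp)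
          rw [cell_sub, cell_comm] at h3
          push_cast at h3
          rw [zero_mul, add_zero] at h3
          rw [norm_mul]
          calc _ ≤ ‖trig N c t‖ * (C₀ * (2*N+1) * cell N t x ^ (-2:ℝ)) := by gcongr
            _ = _ := by ring
      rw [intervalIntegral.integral_const_mul] at h2
      have e2 : C₀ / step N = 1/(2*π) * (C₀ * (2*N+1)) := by
        rw [← step_mul N]; field_simp
      rw [e2, mul_assoc]
      gcongr
    have h2 := integral_mul_rpow_le hr (by linarith : -π < π) (hK x) hq
      (fun t => rpow_pos_of_pos (cell_pos _ _ _) _) (fun t => norm_nonneg _) (hInt N x)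
    have hnn : 0 ≤ ∫ t in (-π)..π, cell N t x ^ (-2:ℝ) * ‖trig N c t‖ :=
      intervalIntegral.integral_nonneg (by linarith) fun t _ =>
        mul_nonneg (rpow_nonneg (cell_pos _ _ _).le _) (norm_nonneg _)
    calc step N * ‖trig N c x‖ ^ r
        ≤ step N * ((C₀ / step N) ^ r * ((C₁ * step N) ^ (r-1) *
            ∫ t in (-π)..π, cell N t x ^ (-2:ℝ) * ‖trig N c t‖ ^ r)) := by
          gcongr
          refine (rpow_le_rpow (norm_nonneg _) h1 hr0.le).trans ?_
          rw [mul_rpow (by positivity) hnn]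
          gcongr
      _ = _ := by
          rw [div_rpow hC₀pos.le hh.le, mul_rpow hC₁.le hh.le, rpow_sub_one hh.ne']
          field_simp
  rw [mul_sum]
  refine (sum_le_sum fun j _ => point (τ j)).trans ?_
  rw [← mul_sum, mul_assoc _ (|A|+1),
    ← intervalIntegral.integral_finsetSum fun j _ => (hKq (τ j)).intervalIntegrable _ _,
    ← intervalIntegral.integral_const_mul (|A| + 1)]
  refine mul_le_mul_of_nonneg_left ?_ (by positivity)
  refine intervalIntegral.integral_mono_on (by linarith) ?_ ?_ ?_
  · exact (continuous_finsetSum _ fun j _ => hKq (τ j)).intervalIntegrable _ _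
  · exact (continuous_const.mul hqr).intervalIntegrable _ _
  · intro t _
    rw [← sum_mul]
    gcongr
    exact (hs t).trans ((le_abs_self A).trans (by linarith))

/-- The `L^r` norm is controlled by samples on a shifted oversampled grid. -/
lemma exists_integral_trig_le {r B : ℝ} (hr : 1 ≤ r) :
    ∃ C : ℝ, 0 < C ∧ ∀ (N : ℕ) (c : ℤ → ℂ) (y : ℝ), |y| ≤ B * step N →
      ∫ t in (-π)..π, ‖trig N c t‖ ^ r ≤
        C * (step N * ∑ j ∈ idx (2*N), ‖trig N c ((j * step (2*N) : ℝ) + y * Complex.I)‖ ^ r) := by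
  obtain ⟨C₁, hC₁, hInt⟩ := exists_integral_cell_le (p := 2) (by norm_num)
  obtain ⟨C₂, hC₂, hsum⟩ := exists_sum_cell_le (p := 2) (by norm_num)
  set C₀ : ℝ := 8 * Real.exp (2*π*(2*B)) * Real.exp (2*π*B) with hC₀
  have hC₀pos : 0 < C₀ := by positivity
  have hr0 : 0 < r := by linarith
  refine ⟨C₀ ^ r * (4 * C₂) ^ (r-1) * C₁, by positivity, fun N c y hy => ?_⟩
  have hh := step_pos N
  have hpi := pi_pos
  set τ : ℤ → ℝ := fun j => j * step (2*N) with hτ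
  set Q : ℤ → ℝ := fun j => ‖trig N c ((j * step (2*N) : ℝ) + y * Complex.I)‖ with hQ
  have hK : ∀ x : ℝ, Continuous (fun t => cell N t x ^ (-2:ℝ)) := fun x =>
    (continuous_cell N x).rpow_const (fun t => Or.inl (cell_pos N t x).ne')
  have hK0 : ∀ t x : ℝ, 0 ≤ cell N t x ^ (-2:ℝ) := fun t x => rpow_nonneg (cell_pos _ _ _).le _
  have hq : Continuous (fun t : ℝ => ‖trig N c t‖) :=
    ((continuous_trig N c).comp Complex.continuous_ofReal).norm
  have hqr : Continuous (fun t : ℝ => ‖trig N c t‖ ^ r) := hq.rpow_const fun t => Or.inr hr0.le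
  have hsum' : ∀ t, ∑ j ∈ idx (2*N), cell N t (τ j) ^ (-2:ℝ) ≤ 4 * C₂ := by
    intro t
    refine le_trans ?_ (mul_le_mul_of_nonneg_left
      (hsum (2*N) τ (fun j _ => by simpa [hτ] using (step_pos (2*N)).le) t) (by norm_num))
    rw [mul_sum]
    refine sum_le_sum fun j _ => ?_
    have h1 := cell_two_mul_le N t (τ j)
    have h2 := cell_pos N t (τ j)
    have h3 := cell_pos (2*N) t (τ j)
    have h4 : (2 * cell N t (τ j)) ^ (-2:ℝ) ≤ cell (2*N) t (τ j) ^ (-2:ℝ) :=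
      rpow_le_rpow_of_nonpos h3 h1 (by norm_num)
    rw [mul_rpow (by norm_num) h2.le] at h4
    have : (2:ℝ) ^ (-2:ℝ) = 1/4 := by
      rw [rpow_neg (by norm_num), rpow_two]; norm_num
    rw [this] at h4
    linarith
  have point : ∀ x : ℝ, ‖trig N c x‖ ^ r ≤
      C₀ ^ r * ((4*C₂) ^ (r-1) * ∑ j ∈ idx (2*N), cell N x (τ j) ^ (-2:ℝ) * Q j ^ r) := by
    intro x
    have h1 : ‖trig N c x‖ ≤ C₀ * ∑ j ∈ idx (2*N), cell N x (τ j) ^ (-2:ℝ) * Q j := by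
      rw [trig_eq_sum N c x y, norm_mul]
      have e1 : ‖(1/(4*N+1) : ℂ)‖ = 1/(4*N+1) := by
        have : ((1/(4*N+1) : ℝ) : ℂ) = 1/(4*N+1) := by push_cast; ring
        rw [← this, Complex.norm_real, Real.norm_of_nonneg (by positivity)]
      rw [e1]
      have h2 : ‖∑ j ∈ idx (2*N), trig N c ((j * step (2*N) : ℝ) + y * Complex.I) *
          vp N (x - ((j * step (2*N) : ℝ) + y * Complex.I))‖ ≤
          C₀ * (2*N+1) * ∑ j ∈ idx (2*N), cell N x (τ j) ^ (-2:ℝ) * Q j := by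
        rw [mul_sum]
        refine (norm_sum_le _ _).trans (sum_le_sum fun j _ => ?_)
        have h3 := norm_vp_le N (u := x - τ j) (y := -y) (by simpa using hy)
        rw [cell_sub] at h3
        have e3 : ((x - τ j : ℝ) : ℂ) + ((-y : ℝ) : ℂ) * Complex.I =
            x - ((j * step (2*N) : ℝ) + y * Complex.I) := by
          simp only [hτ]; push_cast; ring
        rw [e3] at h3
        rw [norm_mul]
        calc _ ≤ Q j * (C₀ * (2*N+1) * cell N x (τ j) ^ (-2:ℝ)) := by
              gcongr
          _ = _ := by ring
      have hS : 0 ≤ ∑ j ∈ idx (2*N), cell N x (τ j) ^ (-2:ℝ) * Q j :=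
        sum_nonneg fun j _ => mul_nonneg (hK0 _ _) (norm_nonneg _)
      calc _ ≤ 1/(4*N+1) * (C₀ * (2*N+1) * ∑ j ∈ idx (2*N), cell N x (τ j) ^ (-2:ℝ) * Q j) := by
            gcongr
        _ = ((2*N+1)/(4*N+1)) * (C₀ * ∑ j ∈ idx (2*N), cell N x (τ j) ^ (-2:ℝ) * Q j) := by ring
        _ ≤ 1 * (C₀ * ∑ j ∈ idx (2*N), cell N x (τ j) ^ (-2:ℝ) * Q j) := by
            gcongr
            rw [div_le_one (by positivity)]
            linarith [(Nat.cast_nonneg N : (0:ℝ) ≤ N)]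
        _ = _ := one_mul _
    have h2 := sum_mul_rpow_le (idx (2*N)) hr (fun j => cell N x (τ j) ^ (-2:ℝ)) Q
      (fun j => hK0 _ _) (fun j => norm_nonneg _) (hsum' x)
    refine (rpow_le_rpow (norm_nonneg _) h1 hr0.le).trans ?_
    rw [mul_rpow hC₀pos.le (sum_nonneg fun j _ => mul_nonneg (hK0 _ _) (norm_nonneg _))]
    gcongr
  have h1 : ∫ t in (-π)..π, ‖trig N c t‖ ^ r ≤ ∫ t in (-π)..π,
      C₀ ^ r * ((4*C₂) ^ (r-1) * ∑ j ∈ idx (2*N), cell N t (τ j) ^ (-2:ℝ) * Q j ^ r) := by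
    refine intervalIntegral.integral_mono_on (by linarith) (hqr.intervalIntegrable _ _) ?_
      (fun t _ => point t)
    refine Continuous.intervalIntegrable ?_ _ _
    exact continuous_const.mul (continuous_const.mul
      (continuous_finsetSum _ fun j _ => (hK (τ j)).mul continuous_const))
  refine h1.trans ?_
  have hKQ : ∀ j, Continuous (fun t => cell N t (τ j) ^ (-2:ℝ) * Q j ^ r) :=
    fun j => (hK (τ j)).mul continuous_const
  rw [intervalIntegral.integral_const_mul, intervalIntegral.integral_const_mul,
    intervalIntegral.integral_finsetSum fun j _ => (hKQ j).intervalIntegrable _ _]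
  have h2 : ∑ j ∈ idx (2*N), ∫ t in (-π)..π, cell N t (τ j) ^ (-2:ℝ) * Q j ^ r ≤
      C₁ * step N * ∑ j ∈ idx (2*N), Q j ^ r := by
    rw [mul_sum]
    refine sum_le_sum fun j _ => ?_
    rw [intervalIntegral.integral_mul_const]
    gcongr
    exact hInt N (τ j)
  calc _ ≤ C₀ ^ r * ((4 * C₂) ^ (r-1) * (C₁ * step N * ∑ j ∈ idx (2*N), Q j ^ r)) := by gcongr
    _ = _ := by ring

/-! ### Holomorphic functions on the disc: growth and conjugate-function estimates -/

lemma norm_one_sub_conj_mul_sq (a b : ℂ) :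
    ‖1 - (starRingEnd ℂ) a * b‖^2 - ‖b - a‖^2 = (1 - ‖b‖^2) * (1 - ‖a‖^2) := by
  simp only [← Complex.normSq_eq_norm_sq, Complex.normSq_apply]
  simp
  ring

lemma one_sub_conj_mul_ne_zero {a b : ℂ} (ha : ‖a‖ < 1) (hb : ‖b‖ < 1) :
    1 - (starRingEnd ℂ) a * b ≠ 0 := by
  intro h0
  have h1 : ‖(starRingEnd ℂ) a * b‖ = 1 := by
    rw [show (starRingEnd ℂ) a * b = 1 by linear_combination -h0]; simp
  rw [norm_mul, RCLike.norm_conj] at h1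
  nlinarith [norm_nonneg a, norm_nonneg b]

lemma norm_mobius_lt_one {a b : ℂ} (ha : ‖a‖ < 1) (hb : ‖b‖ < 1) :
    ‖(b - a) / (1 - (starRingEnd ℂ) a * b)‖ < 1 := by
  have hD := norm_pos_iff.mpr (one_sub_conj_mul_ne_zero ha hb)
  rw [norm_div, div_lt_one hD]
  refine lt_of_pow_lt_pow_left₀ 2 hD.le ?_
  have h := norm_one_sub_conj_mul_sq a b
  have h1 : ‖a‖^2 < 1 := by nlinarith [norm_nonneg a]
  have h2 : ‖b‖^2 < 1 := by nlinarith [norm_nonneg b]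
  have : 0 < (1 - ‖b‖^2) * (1 - ‖a‖^2) := mul_pos (by linarith) (by linarith)
  linarith

/-- Harnack-type inequality for holomorphic functions with positive real part. -/
lemma norm_mul_le_of_re_pos {H : ℂ → ℂ} (hHd : DifferentiableOn ℂ H (Metric.ball 0 1))
    (hHre : ∀ z ∈ Metric.ball (0:ℂ) 1, 0 < (H z).re) {a b : ℂ} (ha : ‖a‖ < 1) (hb : ‖b‖ < 1) :
    ‖H b‖ * (1 - ‖(b - a) / (1 - (starRingEnd ℂ) a * b)‖) ≤
      ‖H a‖ * (1 + ‖(b - a) / (1 - (starRingEnd ℂ) a * b)‖) := by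
  set m : ℂ → ℂ := fun u => (u - (-a)) / (1 - (starRingEnd ℂ) (-a) * u) with hm
  have ha' : ‖-a‖ < 1 := by rwa [norm_neg]
  have hmaps : ∀ u ∈ Metric.ball (0:ℂ) 1, m u ∈ Metric.ball (0:ℂ) 1 := by
    intro u hu
    rw [mem_ball_zero_iff] at hu ⊢
    exact norm_mobius_lt_one ha' hu
  set K : ℂ → ℂ := fun u => (H (m u) - H a) / (H (m u) + (starRingEnd ℂ) (H a)) with hK
  have hm0 : m 0 = a := by simp [hm]
  have hHa := hHre a (by simpa using ha)
  have hKden : ∀ z ∈ Metric.ball (0:ℂ) 1, H z + (starRingEnd ℂ) (H a) ≠ 0 := by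
    intro z hz h0
    have := congrArg Complex.re h0
    simp at this
    linarith [hHre z hz]
  have hmd : DifferentiableOn ℂ m (Metric.ball 0 1) := by
    intro u hu
    refine DifferentiableAt.differentiableWithinAt ?_
    exact DifferentiableAt.div (by fun_prop) (by fun_prop)
      (one_sub_conj_mul_ne_zero ha' (by simpa using hu))
  have hKd : DifferentiableOn ℂ K (Metric.ball 0 1) := by
    have := hHd.comp hmd hmaps
    exact DifferentiableOn.div (this.sub_const _) (this.add_const _)
      (fun u hu => hKden _ (hmaps u hu))
  have hKmaps : Set.MapsTo K (Metric.ball 0 1) (Metric.closedBall 0 1) := by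
    intro u hu
    have h1 := norm_pos_iff.mpr (hKden _ (hmaps u hu))
    simp only [mem_closedBall_zero_iff]
    rw [hK, norm_div, div_le_one h1]
    refine le_of_pow_le_pow_left₀ two_ne_zero h1.le ?_
    have h2 := hHre _ (hmaps u hu)
    simp only [← Complex.normSq_eq_norm_sq, Complex.normSq_apply]
    simp
    nlinarith
  have hun := norm_mobius_lt_one ha hb
  set u : ℂ := (b - a) / (1 - (starRingEnd ℂ) a * b) with hu
  have hden2 := one_sub_conj_mul_ne_zero ha hb
  have hmu : m u = b := by
    have h2 := one_sub_conj_mul_ne_zero ha' hun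
    have h3 : u * (1 - (starRingEnd ℂ) a * b) = b - a := by rw [hu, div_mul_cancel₀ _ hden2]
    simp only [hm]
    rw [div_eq_iff h2, map_neg]
    linear_combination h3
  have hSch := Complex.norm_le_norm_of_mapsTo_ball hKd hKmaps (by simp [hK, hm0]) hun
  have h1 := norm_pos_iff.mpr (hKden b (by simpa using hb))
  simp only [hK, hmu] at hSch
  rw [norm_div, div_le_iff₀ h1] at hSch
  have e1 := norm_sub_norm_le (H b) (H a)
  have e2 := norm_add_le (H b) ((starRingEnd ℂ) (H a))
  rw [RCLike.norm_conj] at e2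
  have := mul_le_mul_of_nonneg_left e2 (norm_nonneg u)
  linarith

lemma one_le_one_sub_mobius {ρ : ℝ} (hρ0 : 0 < ρ) (hρ1 : ρ < 1) (s t : ℝ) :
    1 ≤ (1 - ‖((ρ * pt t : ℂ) - ρ * pt s) / (1 - (starRingEnd ℂ) (ρ * pt s) * (ρ * pt t))‖) *
      (2 * (1 + chord t s / (1 - ρ^2))^2) := by
  have hn : ∀ t, ‖(ρ * pt t : ℂ)‖ = ρ := fun t => by simp [abs_of_pos hρ0]
  have hid := norm_one_sub_conj_mul_sq (ρ * pt s : ℂ) (ρ * pt t)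
  have hd1 := norm_mobius_lt_one (a := (ρ * pt s : ℂ)) (b := ρ * pt t) (by rwa [hn]) (by rwa [hn])
  have hD := norm_pos_iff.mpr
    (one_sub_conj_mul_ne_zero (a := (ρ * pt s : ℂ)) (b := ρ * pt t) (by rwa [hn]) (by rwa [hn]))
  rw [hn, hn] at hid
  have hρ2 : 0 < 1 - ρ^2 := by nlinarith
  have hch : ‖1 - (starRingEnd ℂ) (ρ * pt s) * (ρ * pt t)‖ ≤ (1 - ρ^2) + chord t s := by
    have e1 : 1 - (starRingEnd ℂ) (ρ * pt s) * (ρ * pt t) =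
        (1 - ρ^2 : ℝ) - ρ * (starRingEnd ℂ) (pt s) * ρ * (pt t - pt s) := by
      have : (starRingEnd ℂ) (pt s) * pt s = 1 := by
        rw [← Complex.normSq_eq_conj_mul_self, Complex.normSq_eq_norm_sq]; simp
      simp only [map_mul, Complex.conj_ofReal]
      push_cast
      linear_combination (-(ρ:ℂ)^2) * this
    rw [e1]
    refine (norm_sub_le _ _).trans ?_
    rw [Complex.norm_real, Real.norm_of_nonneg hρ2.le, norm_mul, norm_mul, norm_mul,
      RCLike.norm_conj, norm_pt, Complex.norm_real, Real.norm_of_nonneg hρ0.le, ← chord]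
    have := chord_nonneg t s
    nlinarith
  rw [norm_div] at hd1 ⊢
  set D := ‖1 - (starRingEnd ℂ) (ρ * pt s) * (ρ * pt t)‖
  set F := ‖(ρ * pt t : ℂ) - ρ * pt s‖
  set d := F / D with hd
  have hd0 : 0 ≤ d := div_nonneg (norm_nonneg _) hD.le
  set X := 1 + chord t s / (1 - ρ^2) with hX
  have hXD : D ≤ (1 - ρ^2) * X := by
    have : (1 - ρ^2) * X = (1 - ρ^2) + chord t s := by rw [hX]; field_simp
    rw [this]; exact hch
  have e1 : d * D = F := by rw [hd]; field_simp
  have e2 : (1 - d^2) * D^2 = (1 - ρ^2) * (1 - ρ^2) := by rw [← hid, ← e1]; ring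
  have e4 : 0 ≤ 1 - d^2 := by nlinarith
  have e3 : (1 - d^2) * D^2 ≤ (1 - d^2) * ((1 - ρ^2) * X)^2 := by gcongr
  have e5 : (1 - ρ^2)^2 * 1 ≤ (1 - ρ^2)^2 * ((1 - d^2) * X^2) := by
    rw [e2] at e3; linarith
  have e6 := le_of_mul_le_mul_left e5 (by positivity)
  have e7 : 0 ≤ (1 - d)^2 * X^2 := by positivity
  linarith

/-- Growth of the exponential of a function with bounded imaginary part. -/
lemma exp_re_le_of_abs_im_lt {L : ℂ → ℂ} {φ : ℝ}
    (hL : DifferentiableOn ℂ L (Metric.ball 0 1)) (hφ : ∀ z ∈ Metric.ball (0:ℂ) 1, |(L z).im| < φ)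
    {ρ : ℝ} (hρ0 : 0 < ρ) (hρ1 : ρ < 1) (s t : ℝ) :
    Real.exp (L (ρ * pt t)).re ≤
      (2 * (1 + chord t s / (1 - ρ^2))) ^ (4*φ/π) * Real.exp (L (ρ * pt s)).re := by
  have hpi := pi_pos
  have hφ0 : 0 < φ := (abs_nonneg _).trans_lt (hφ 0 (by simp))
  have hn : ∀ t, ‖(ρ * pt t : ℂ)‖ < 1 := fun t => by simpa [abs_of_pos hρ0]
  set k : ℝ := π / (2*φ) with hk
  have hk0 : 0 < k := by positivity
  set H : ℂ → ℂ := fun z => Complex.exp (k * L z) with hH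
  have hHd : DifferentiableOn ℂ H (Metric.ball 0 1) := (hL.const_mul _).cexp
  have hHre : ∀ z ∈ Metric.ball (0:ℂ) 1, 0 < (H z).re := by
    intro z hz
    simp only [hH, Complex.exp_re]
    refine mul_pos (Real.exp_pos _) (cos_pos_of_mem_Ioo ?_)
    have h1 := abs_lt.mp (hφ z hz)
    have e : k * φ = π/2 := by rw [hk]; field_simp
    simp only [Complex.im_ofReal_mul]
    constructor <;> nlinarith
  have hHn : ∀ z, ‖H z‖ = Real.exp (k * (L z).re) := fun z => by
    simp [hH, Complex.norm_exp]
  have h2 := norm_mul_le_of_re_pos hHd hHre (hn s) (hn t)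
  have h3 := one_le_one_sub_mobius hρ0 hρ1 s t
  have hd1 := norm_mobius_lt_one (hn s) (hn t)
  rw [hHn, hHn] at h2
  clear_value H
  set d := ‖((ρ * pt t : ℂ) - ρ * pt s) / (1 - (starRingEnd ℂ) (ρ * pt s) * (ρ * pt t))‖
  have hX0 : 0 ≤ 1 + chord t s / (1 - ρ^2) :=
    add_nonneg zero_le_one (div_nonneg (chord_nonneg _ _) (by nlinarith))
  set X := 1 + chord t s / (1 - ρ^2)
  have h5 : ∀ v : ℝ, Real.exp v = Real.exp (k * v) ^ (2*φ/π) := by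
    intro v
    rw [← Real.exp_mul]; congr 1; rw [hk]; field_simp
  rw [h5 (L (ρ * pt t)).re, h5 (L (ρ * pt s)).re]
  set p := Real.exp (k * (L (ρ * pt t)).re)
  set q := Real.exp (k * (L (ρ * pt s)).re)
  have hp : 0 < p := Real.exp_pos _
  have hq : 0 < q := Real.exp_pos _
  have h4 : p ≤ (2*X)^2 * q := by
    have e1 : p * (1 - d) ≤ q * 2 := h2.trans (by gcongr; linarith)
    calc p = p * 1 := by ring
      _ ≤ p * ((1 - d) * (2 * X^2)) := by gcongr
      _ = p * (1 - d) * (2 * X^2) := by ring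
      _ ≤ q * 2 * (2 * X^2) := by gcongr
      _ = _ := by ring
  have h6 : (2*X) ^ (4*φ/π) = ((2*X)^2) ^ (2*φ/π) := by
    rw [← rpow_natCast, ← rpow_mul (by positivity)]; congr 1; push_cast; ring
  rw [h6, ← mul_rpow (by positivity) hq.le]
  exact rpow_le_rpow hp.le h4 (by positivity)

lemma cos_le_neg_sin {x e : ℝ} (he : 0 ≤ e) (h1 : π/2 + e ≤ x) (h2 : x ≤ 3*π/2 - e) :
    cos x ≤ -sin e := by
  have e1 : cos x = - cos |x - π| := by rw [cos_abs, cos_sub_pi, neg_neg]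
  have e2 : |x - π| ≤ π/2 - e := abs_le.mpr ⟨by linarith, by linarith⟩
  rw [e1, ← cos_pi_div_two_sub]
  have := cos_le_cos_of_nonneg_of_le_pi (abs_nonneg (x - π)) (by linarith) e2
  linarith

/-- The pointwise inequality behind the weighted theorem of M. Riesz. -/
lemma exists_riesz_pointwise {s θ : ℝ} (hs : 1 < s) (hs2 : s ≤ 2) (hθ0 : 0 ≤ θ)
    (hθ : θ < (s-1)*π/2) :
    ∃ A B : ℝ, 0 < A ∧ 0 < B ∧ ∀ z w : ℂ, 0 < z.re → |s * w.im| ≤ θ →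
      ‖z‖ ^ s * Real.exp (s * w.re) ≤
        A * (z.re ^ s * Real.exp (s * w.re)) - B * (z ^ (s:ℂ) * Complex.exp (s * w)).re := by
  have hpi := pi_pos
  set ε : ℝ := (s-1)*π/2 - θ with hε
  have hε0 : 0 < ε := by linarith
  have hεle : ε ≤ π/2 := by nlinarith
  set φ : ℝ := π/2 - ε/(2*s) with hφ
  have hs0 : 0 < s := by linarith
  have hsπ : s * π ≤ 2 * π := by gcongr
  have hφs : s * φ = s*π/2 - ε/2 := by rw [hφ]; field_simp
  have hφlt : φ < π/2 := by have : 0 < ε/(2*s) := by positivity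
                            linarith
  have hφ0 : 0 ≤ φ := by
    have : 0 ≤ s * φ := by rw [hφs]; nlinarith
    exact nonneg_of_mul_nonneg_right this hs0
  have hsin : 0 < sin (ε/2) := sin_pos_of_pos_of_lt_pi (by linarith) (by linarith)
  have hcos : 0 < cos φ := cos_pos_of_mem_Ioo ⟨by linarith, hφlt⟩
  set B : ℝ := 1 / sin (ε/2) with hB
  have hB0 : 0 < B := by positivity
  refine ⟨(1+B) / cos φ ^ s, B, by positivity, hB0, fun z w hz hw => ?_⟩
  have hz0 : z ≠ 0 := by rintro rfl; simp at hz
  have hn : 0 < ‖z‖ := norm_pos_iff.mpr hz0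
  have hre : (z ^ (s:ℂ) * Complex.exp (s * w)).re =
      ‖z‖ ^ s * Real.exp (s * w.re) * cos (s * z.arg + s * w.im) := by
    rw [Complex.cpow_def_of_ne_zero hz0, ← Complex.exp_add, Complex.exp_re]
    have e1 : (Complex.log z * s + s * w).re = Real.log ‖z‖ * s + s * w.re := by
      simp [Complex.log_re]
    have e2 : (Complex.log z * s + s * w).im = s * z.arg + s * w.im := by
      simp [Complex.log_im]; ring
    rw [e1, e2, Real.exp_add, ← Real.rpow_def_of_pos hn]
  rw [hre]
  clear hre
  set E := Real.exp (s * w.re)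
  have hE : 0 < E := Real.exp_pos _
  have harg : |z.arg| < π/2 := Complex.abs_arg_lt_pi_div_two_iff.mpr (Or.inl hz)
  have hrez : z.re = ‖z‖ * cos |z.arg| := by rw [cos_abs, Complex.norm_mul_cos_arg]
  have hw' := abs_le.mp hw
  set c := cos (s * z.arg + s * w.im) with hc
  have hc1 : c ≤ 1 := cos_le_one _
  rcases le_total φ |z.arg| with h | h
  · have hc : c ≤ - sin (ε/2) := by
      have h1 : s * φ ≤ s * |z.arg| := by gcongr
      have h2 : s * |z.arg| ≤ s * (π/2) := by gcongr
      rw [hφs] at h1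
      rcases abs_cases z.arg with ⟨e, _⟩ | ⟨e, _⟩
      · rw [e] at h1 h2
        apply cos_le_neg_sin (by linarith) <;> linarith
      · rw [e] at h1 h2
        rw [hc, ← cos_neg]
        apply cos_le_neg_sin (by linarith) <;> linarith
    have h1 : 1 ≤ -(B * c) := by
      have : B * sin (ε/2) = 1 := by rw [hB]; field_simp
      nlinarith
    have h2 : 0 ≤ (1+B) / cos φ ^ s * (z.re ^ s * E) := by positivity
    have h3 : ‖z‖^s * E * 1 ≤ ‖z‖^s * E * (-(B*c)) := by gcongr
    linarith
  · have h1 : ‖z‖ * cos φ ≤ z.re := by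
      rw [hrez]
      gcongr
      exact cos_le_cos_of_nonneg_of_le_pi (abs_nonneg _) (by linarith) h
    have h2 : (‖z‖ * cos φ)^s ≤ z.re ^ s := rpow_le_rpow (by positivity) h1 hs0.le
    rw [mul_rpow hn.le hcos.le] at h2
    have h3 : (1+B) * ‖z‖^s ≤ (1+B) / cos φ ^ s * z.re^s := by
      rw [div_mul_eq_mul_div, le_div_iff₀ (by positivity), mul_assoc]
      gcongr
    have h4 := mul_le_mul_of_nonneg_right h3 hE.le
    have hnE : 0 ≤ B * (‖z‖^s * E) := by positivity
    have h5 := mul_le_mul_of_nonneg_left hc1 hnE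
    linarith

lemma integral_disc_eq {g : ℂ → ℂ} {σ : ℝ} (hσ0 : 0 < σ) (hσ : σ < 1)
    (hg : DifferentiableOn ℂ g (Metric.ball 0 1)) :
    ∫ t in (-π)..π, g (σ * pt t) = 2*π * g 0 := by
  have hpi : (π:ℂ) ≠ 0 := by exact_mod_cast pi_ne_zero
  have h1 : DiffContOnCl ℂ g (Metric.ball 0 |σ|) := by
    refine DifferentiableOn.diffContOnCl (hg.mono ?_)
    rw [closure_ball _ (by simpa using hσ0.ne'), abs_of_pos hσ0]
    exact Metric.closedBall_subset_ball hσ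
  have h2 := h1.circleAverage
  rw [Real.circleAverage_def] at h2
  have h3 : Function.Periodic (fun t => g (σ * pt t)) (2*π) := fun t => by
    simp only; rw [pt_periodic t]
  have h4 := h3.intervalIntegral_add_eq (-π) 0
  rw [show -π + 2*π = π by ring, zero_add] at h4
  have h5 : ∀ t : ℝ, circleMap 0 σ t = σ * pt t := fun t => by rw [circleMap, zero_add, ← pt]
  rw [h4, ← h2]
  simp only [h5, Complex.real_smul]
  push_cast
  field_simp

lemma continuous_disc {g : ℂ → ℂ} {σ : ℝ} (hσ0 : 0 < σ) (hσ : σ < 1)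
    (hg : DifferentiableOn ℂ g (Metric.ball 0 1)) : Continuous (fun t : ℝ => g (σ * pt t)) := by
  refine hg.continuousOn.comp_continuous (continuous_const.mul continuous_pt) fun t => ?_
  simp [abs_of_pos hσ0, hσ]

/-- Weighted conjugate-function inequality on a circle. -/
lemma exists_riesz {s θ : ℝ} (hs : 1 < s) (hs2 : s ≤ 2) (hθ0 : 0 ≤ θ) (hθ : θ < (s-1)*π/2) :
    ∃ C : ℝ, 0 < C ∧ ∀ (σ : ℝ) (f L : ℂ → ℂ), 0 < σ → σ < 1 →
      DifferentiableOn ℂ f (Metric.ball 0 1) → DifferentiableOn ℂ L (Metric.ball 0 1) →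
      (∀ z ∈ Metric.ball (0:ℂ) 1, 0 < (f z).re) → (f 0).im = 0 →
      (∀ t : ℝ, |s * (L (σ * pt t)).im| ≤ θ) → |s * (L 0).im| ≤ θ →
      (∫ t in (-π)..π, ‖f (σ * pt t)‖ ^ s * Real.exp (s * (L (σ * pt t)).re) ≤
        C * ∫ t in (-π)..π, (f (σ * pt t)).re ^ s * Real.exp (s * (L (σ * pt t)).re)) ∧
      (∫ t in (-π)..π, (f 0).re ^ s * Real.exp (s * (L (σ * pt t)).re) ≤
        C * ∫ t in (-π)..π, (f (σ * pt t)).re ^ s * Real.exp (s * (L (σ * pt t)).re)) := by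
  obtain ⟨A, B, hA, hB, hAB⟩ := exists_riesz_pointwise hs hs2 hθ0 hθ
  have hpi := pi_pos
  have hθ2 : θ < π/2 := by nlinarith
  have hcos : 0 < cos θ := cos_pos_of_mem_Ioo ⟨by linarith, hθ2⟩
  refine ⟨A + A / (B * cos θ), by positivity, fun σ f L hσ0 hσ hf hL hre him hLt hL0 => ?_⟩
  have hs0 : 0 < s := by linarith
  have hmem : ∀ t : ℝ, (σ * pt t : ℂ) ∈ Metric.ball (0:ℂ) 1 := fun t => by
    simp [abs_of_pos hσ0, hσ]
  have cf := continuous_disc hσ0 hσ hf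
  have cL := continuous_disc hσ0 hσ hL
  have cE : Continuous (fun t : ℝ => Real.exp (s * (L (σ * pt t)).re)) :=
    (continuous_const.mul (Complex.continuous_re.comp cL)).rexp
  have cre : Continuous (fun t : ℝ => (f (σ * pt t)).re ^ s * Real.exp (s * (L (σ * pt t)).re)) :=
    ((Complex.continuous_re.comp cf).rpow_const fun t => Or.inr hs0.le).mul cE
  have cn : Continuous (fun t : ℝ => ‖f (σ * pt t)‖ ^ s * Real.exp (s * (L (σ * pt t)).re)) :=
    (cf.norm.rpow_const fun t => Or.inr hs0.le).mul cE
  set g : ℂ → ℂ := fun z => f z ^ (s:ℂ) * Complex.exp (s * L z) with hg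
  have dE : DifferentiableOn ℂ (fun z => Complex.exp (s * L z)) (Metric.ball 0 1) :=
    (hL.const_mul _).cexp
  have dg : DifferentiableOn ℂ g (Metric.ball 0 1) :=
    (hf.cpow (differentiableOn_const _) fun z hz => Or.inl (hre z hz)).mul dE
  have cg := continuous_disc hσ0 hσ dg
  have intre : ∀ {G : ℂ → ℂ}, DifferentiableOn ℂ G (Metric.ball 0 1) →
      ∫ t in (-π)..π, (G (σ * pt t)).re = 2*π * (G 0).re := by
    intro G hG
    have h1 := integral_disc_eq hσ0 hσ hG
    have h3 : ∫ t in (-π)..π, (G (σ * pt t)).re = (∫ t in (-π)..π, G (σ * pt t)).re := by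
      have := Complex.reCLM.intervalIntegral_comp_comm
        ((continuous_disc hσ0 hσ hG).intervalIntegrable (μ := MeasureTheory.volume) (-π) π)
      simpa using this
    rw [h3, h1]
    simp
  set I := ∫ t in (-π)..π, (f (σ * pt t)).re ^ s * Real.exp (s * (L (σ * pt t)).re) with hI
  have hI0 : 0 ≤ I := intervalIntegral.integral_nonneg (by linarith) fun t _ =>
    mul_nonneg (rpow_nonneg (hre _ (hmem t)).le _) (Real.exp_pos _).le
  have main : ∫ t in (-π)..π, ‖f (σ * pt t)‖ ^ s * Real.exp (s * (L (σ * pt t)).re) ≤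
      A * I - B * (2*π * (g 0).re) := by
    rw [hI, ← intre dg, ← intervalIntegral.integral_const_mul, ← intervalIntegral.integral_const_mul,
      ← intervalIntegral.integral_sub]
    · refine intervalIntegral.integral_mono_on (by linarith) (cn.intervalIntegrable _ _) ?_ ?_
      · exact ((continuous_const.mul cre).sub (continuous_const.mul
          (Complex.continuous_re.comp cg))).intervalIntegrable _ _
      · intro t _
        exact hAB _ _ (hre _ (hmem t)) (hLt t)
    · exact (continuous_const.mul cre).intervalIntegrable _ _
    · exact (continuous_const.mul (Complex.continuous_re.comp cg)).intervalIntegrable _ _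
  have hn0 : 0 ≤ ∫ t in (-π)..π, ‖f (σ * pt t)‖ ^ s * Real.exp (s * (L (σ * pt t)).re) :=
    intervalIntegral.integral_nonneg (by linarith) fun t _ =>
      mul_nonneg (rpow_nonneg (norm_nonneg _) _) (Real.exp_pos _).le
  have hf0 : 0 < (f 0).re := hre 0 (by simp)
  have cosle : ∀ v : ℝ, |v| ≤ θ → cos θ ≤ cos v := fun v hv => by
    rw [← cos_abs v]; exact cos_le_cos_of_nonneg_of_le_pi (abs_nonneg _) (by linarith) hv
  have reE : ∀ z, (Complex.exp (s * L z)).re = Real.exp (s * (L z).re) * cos (s * (L z).im) := by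
    intro z
    rw [Complex.exp_re, Complex.re_ofReal_mul, Complex.im_ofReal_mul]
  have g0 : (g 0).re = (f 0).re ^ s * (Complex.exp (s * L 0)).re := by
    have e : f 0 = ((f 0).re : ℂ) := Complex.ext (by simp) (by simp [him])
    simp only [hg]
    conv_lhs => rw [e]
    rw [← Complex.ofReal_cpow hf0.le, Complex.re_ofReal_mul]
  have g0' : 0 ≤ (g 0).re := by
    rw [g0, reE]
    have := cosle _ hL0
    have : 0 < cos (s * (L 0).im) := by linarith
    positivity
  have hC2 : 0 ≤ A / (B * cos θ) * I := by positivity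
  constructor
  · have : 0 ≤ B * (2*π * (g 0).re) := by positivity
    rw [add_mul]; linarith
  · have h1 : cos θ * ∫ t in (-π)..π, (f 0).re ^ s * Real.exp (s * (L (σ * pt t)).re) ≤
        2*π * (g 0).re := by
      rw [g0, mul_left_comm (2*π), ← intre dE, ← intervalIntegral.integral_const_mul,
        ← intervalIntegral.integral_const_mul]
      refine intervalIntegral.integral_mono_on (by linarith) ?_ ?_ ?_
      · exact (continuous_const.mul (continuous_const.mul cE)).intervalIntegrable _ _
      · exact (continuous_const.mul (Complex.continuous_re.comp
          (continuous_disc hσ0 hσ dE))).intervalIntegrable _ _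
      · intro t _
        rw [reE]
        have := cosle _ (hLt t)
        calc _ = (f 0).re ^ s * (Real.exp (s * (L (σ * pt t)).re) * cos θ) := by ring
          _ ≤ _ := by gcongr
    have h2 : B * (2*π * (g 0).re) ≤ A * I := by linarith
    have h3 : B * cos θ * ∫ t in (-π)..π, (f 0).re ^ s * Real.exp (s * (L (σ * pt t)).re) ≤ A * I := by
      have := mul_le_mul_of_nonneg_left h1 hB.le
      linarith
    have h4 : ∫ t in (-π)..π, (f 0).re ^ s * Real.exp (s * (L (σ * pt t)).re) ≤
        A / (B * cos θ) * I := by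
      rw [div_mul_eq_mul_div, le_div_iff₀ (by positivity)]; linarith
    rw [add_mul]
    have : 0 ≤ A * I := by positivity
    linarith

lemma step_le_one_sub_exp {N : ℕ} {Y : ℝ} (hY : 1 ≤ Y) :
    step N / 8 ≤ 1 - Real.exp (-(2 * Y * step N)) := by
  have hh := step_pos N
  have e1 : Real.exp (-(2 * Y * step N)) ≤ 1 / (1 + 2 * step N) := by
    rw [Real.exp_neg, ← one_div]
    apply one_div_le_one_div_of_le (by positivity)
    have := Real.add_one_le_exp (2 * Y * step N)
    nlinarith
  have e2 : 1 / (1 + 2 * step N) ≤ 1 - step N / 8 := by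
    rw [div_le_iff₀ (by positivity)]
    have := step_le N
    have := pi_lt_d2
    nlinarith
  linarith

/-- The weight at nearby points of a circle. -/
lemma exp_re_le_cell {N : ℕ} {L : ℂ → ℂ} {φ Y : ℝ} (hY : 1 ≤ Y)
    (hL : DifferentiableOn ℂ L (Metric.ball 0 1)) (hφ1 : φ ≤ π/4)
    (hφ : ∀ z ∈ Metric.ball (0:ℂ) (Real.exp (-(Y * step N))), |(L z).im| < φ) (s t : ℝ) :
    Real.exp (L (Real.exp (-(2 * Y * step N)) * pt t)).re ≤
      16 * cell N t s ^ (4*φ/π) * Real.exp (L (Real.exp (-(2 * Y * step N)) * pt s)).re := by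
  have hh := step_pos N
  have hpi := pi_pos
  set ρ := Real.exp (-(Y * step N)) with hρ
  have hρ0 : 0 < ρ := Real.exp_pos _
  have hρ1 : ρ < 1 := by rw [hρ, Real.exp_lt_one_iff]; nlinarith
  have hσ : Real.exp (-(2 * Y * step N)) = ρ * ρ := by rw [hρ, ← Real.exp_add]; congr 1; ring
  have hmaps : ∀ u ∈ Metric.ball (0:ℂ) 1, (ρ * u : ℂ) ∈ Metric.ball (0:ℂ) ρ := by
    intro u hu
    simp only [mem_ball_zero_iff, norm_mul, Complex.norm_real, Real.norm_of_nonneg hρ0.le] at *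
    nlinarith
  have hφ0 : 0 < φ := (abs_nonneg _).trans_lt (hφ 0 (by simpa using hρ0))
  have hL' : DifferentiableOn ℂ (fun u => L (ρ * u)) (Metric.ball 0 1) := by
    refine hL.comp (by fun_prop) fun u hu => ?_
    exact Metric.ball_subset_ball hρ1.le (hmaps u hu)
  have h1 := exp_re_le_of_abs_im_lt hL' (fun u hu => hφ _ (hmaps u hu)) hρ0 hρ1 s t
  simp only [← mul_assoc, ← Complex.ofReal_mul, ← hσ] at h1
  refine h1.trans ?_
  gcongr
  have h2 : step N / 8 ≤ 1 - ρ^2 := by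
    rw [sq, ← hσ]; exact step_le_one_sub_exp hY
  have hX : 2 * (1 + chord t s / (1 - ρ^2)) ≤ 16 * cell N t s := by
    have := chord_nonneg t s
    have e : chord t s / (1 - ρ^2) ≤ chord t s / (step N / 8) := by gcongr
    have e2 : chord t s / (step N / 8) = 8 * (chord t s / step N) := by field_simp
    unfold cell
    linarith
  have hq : 0 ≤ 4*φ/π := by positivity
  have hq1 : 4*φ/π ≤ 1 := by rw [div_le_one hpi]; linarith
  have hX0 : 0 ≤ 2 * (1 + chord t s / (1 - ρ^2)) := by
    have := div_nonneg (chord_nonneg t s) (by nlinarith : 0 ≤ 1 - ρ^2)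
    positivity
  calc _ ≤ (16 * cell N t s) ^ (4*φ/π) := rpow_le_rpow hX0 hX hq
    _ = 16 ^ (4*φ/π) * cell N t s ^ (4*φ/π) := mul_rpow (by norm_num) (cell_pos _ _ _).le
    _ ≤ _ := by
      have := cell_pos N t s
      gcongr
      calc (16:ℝ) ^ (4*φ/π) ≤ 16 ^ (1:ℝ) := rpow_le_rpow_of_exponent_le (by norm_num) hq1
        _ = 16 := rpow_one _

lemma step_mul_cell_le {N : ℕ} {σ R : ℝ} (hσ0 : 0 ≤ σ) (hσ : σ ≤ 1 - step N / 8) (hR : 1 ≤ R)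
    (t y : ℝ) : step N * cell N t y ≤ 10 * ‖(R * pt y : ℂ) - σ * pt t‖ := by
  have hh := step_pos N
  have h1 : R - σ ≤ ‖(R * pt y : ℂ) - σ * pt t‖ := by
    have := norm_sub_norm_le (R * pt y : ℂ) (σ * pt t)
    simpa [abs_of_nonneg hσ0, abs_of_nonneg (zero_le_one.trans hR)] using this
  have h2 : chord t y ≤ (1 - σ) + ‖(R * pt y : ℂ) - σ * pt t‖ + (R - 1) := by
    have e : pt t - pt y = ((1 - σ : ℝ) : ℂ) * pt t - ((R * pt y : ℂ) - σ * pt t)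
        + ((R - 1 : ℝ) : ℂ) * pt y := by push_cast; ring
    rw [chord, e]
    refine (norm_add_le _ _).trans (add_le_add ((norm_sub_le _ _).trans ?_) ?_)
    · rw [norm_mul, norm_pt, Complex.norm_real, Real.norm_of_nonneg (by linarith), mul_one]
    · rw [norm_mul, norm_pt, Complex.norm_real, Real.norm_of_nonneg (by linarith), mul_one]
  have e : step N * cell N t y = step N + chord t y := by unfold cell; field_simp
  rw [e]; linarith

/-- Weighted bound for the real part of a Cauchy-type sum. -/
lemma exists_integral_poisson_le {s φ Y A : ℝ} (hs : 1 < s) (hφ1 : φ < π/4) (hY : 1 ≤ Y) :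
    ∃ C : ℝ, 0 < C ∧ ∀ (N : ℕ) (L : ℂ → ℂ), DifferentiableOn ℂ L (Metric.ball 0 1) →
      (∀ z ∈ Metric.ball (0:ℂ) (Real.exp (-(Y * step N))), |(L z).im| < φ) →
      ∀ (S : Finset ℤ) (y : ℤ → ℝ),
      (∀ t, ∑ m ∈ S, cell N t (y m) ^ (-(2 - 4*φ/π)) ≤ A) → ∀ β : ℤ → ℝ, (∀ m, 0 ≤ β m) →
      ∫ t in (-π)..π, ((step N)⁻¹ * ∑ m ∈ S, cell N t (y m) ^ (-2:ℝ) * β m) ^ s *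
          Real.exp (s * (L (Real.exp (-(2 * Y * step N)) * pt t)).re) ≤
        C * (step N ^ (1 - s) * ∑ m ∈ S, β m ^ s *
          Real.exp (s * (L (Real.exp (-(2 * Y * step N)) * pt (y m))).re)) := by
  have hpi := pi_pos
  have hp : 1 < 2 - 4*φ/π := by
    have : 4*φ/π < 1 := by rw [div_lt_one hpi]; linarith
    linarith
  obtain ⟨C₁, hC₁, hInt⟩ := exists_integral_cell_le hp
  have hs0 : 0 < s := by linarith
  refine ⟨16 ^ s * (|A| + 1) ^ (s-1) * C₁, by positivity, fun N L hL hφ S y hS β hβ => ?_⟩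
  have hh := step_pos N
  set σ := Real.exp (-(2 * Y * step N)) with hσ
  have hσ0 : 0 < σ := Real.exp_pos _
  have hσ1 : σ < 1 := by rw [hσ, Real.exp_lt_one_iff]; nlinarith
  set W : ℝ → ℝ := fun t => Real.exp (L (σ * pt t)).re with hW
  have hWs : ∀ t, Real.exp (s * (L (σ * pt t)).re) = W t ^ s := fun t => by
    rw [hW, ← Real.exp_mul]; congr 1; ring
  have hW0 : ∀ t, 0 < W t := fun t => Real.exp_pos _
  simp only [hWs]
  have cW : Continuous W := (Complex.continuous_re.comp (continuous_disc hσ0 hσ1 hL)).rexp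
  have cK : ∀ (q x : ℝ), Continuous (fun t => cell N t x ^ q) := fun q x =>
    (continuous_cell N x).rpow_const (fun t => Or.inl (cell_pos N t x).ne')
  have K0 : ∀ (q t x : ℝ), 0 ≤ cell N t x ^ q := fun q t x => rpow_nonneg (cell_pos _ _ _).le _
  set p := 2 - 4*φ/π with hpdef
  have point : ∀ t, ((step N)⁻¹ * ∑ m ∈ S, cell N t (y m) ^ (-2:ℝ) * β m) ^ s * W t ^ s ≤
      (16 * (step N)⁻¹) ^ s * ((|A|+1) ^ (s-1) *
        ∑ m ∈ S, cell N t (y m) ^ (-p) * (β m ^ s * W (y m) ^ s)) := by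
    intro t
    have nn : 0 ≤ ∑ m ∈ S, cell N t (y m) ^ (-2:ℝ) * β m :=
      sum_nonneg fun m _ => mul_nonneg (K0 _ _ _) (hβ m)
    have nn2 : 0 ≤ ∑ m ∈ S, cell N t (y m) ^ (-p) * (β m * W (y m)) :=
      sum_nonneg fun m _ => mul_nonneg (K0 _ _ _) (mul_nonneg (hβ m) (hW0 _).le)
    have h1 : (∑ m ∈ S, cell N t (y m) ^ (-2:ℝ) * β m) * W t ≤
        16 * ∑ m ∈ S, cell N t (y m) ^ (-p) * (β m * W (y m)) := by
      rw [sum_mul, mul_sum]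
      refine sum_le_sum fun m _ => ?_
      have h2 : W t ≤ 16 * cell N t (y m) ^ (4*φ/π) * W (y m) :=
        exp_re_le_cell hY hL hφ1.le hφ (y m) t
      calc _ ≤ cell N t (y m) ^ (-2:ℝ) * β m * (16 * cell N t (y m) ^ (4*φ/π) * W (y m)) :=
            mul_le_mul_of_nonneg_left h2 (mul_nonneg (K0 _ _ _) (hβ m))
        _ = 16 * ((cell N t (y m) ^ (-2:ℝ) * cell N t (y m) ^ (4*φ/π)) * (β m * W (y m))) := by ring
        _ = _ := by rw [← rpow_add (cell_pos _ _ _), hpdef]; congr 4; ring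
    have h2 := sum_mul_rpow_le S hs.le (fun m => cell N t (y m) ^ (-p)) (fun m => β m * W (y m))
      (fun m => K0 _ _ _) (fun m => mul_nonneg (hβ m) (hW0 _).le)
      ((hS t).trans ((le_abs_self A).trans (by linarith : |A| ≤ |A| + 1)))
    simp only [mul_rpow (hβ _) (hW0 _).le] at h2
    calc _ = ((step N)⁻¹ * ((∑ m ∈ S, cell N t (y m) ^ (-2:ℝ) * β m) * W t)) ^ s := by
          rw [← mul_rpow (by positivity) (hW0 t).le, mul_assoc]
      _ ≤ ((step N)⁻¹ * (16 * ∑ m ∈ S, cell N t (y m) ^ (-p) * (β m * W (y m)))) ^ s := by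
          have := (hW0 t).le
          gcongr
      _ = (16 * (step N)⁻¹) ^ s * (∑ m ∈ S, cell N t (y m) ^ (-p) * (β m * W (y m))) ^ s := by
          rw [← mul_rpow (by positivity) nn2]; congr 1; ring
      _ ≤ _ := by gcongr
  have cm : ∀ m, Continuous (fun t => cell N t (y m) ^ (-p) * (β m ^ s * W (y m) ^ s)) :=
    fun m => (cK _ _).mul continuous_const
  have h1 : ∫ t in (-π)..π, ((step N)⁻¹ * ∑ m ∈ S, cell N t (y m) ^ (-2:ℝ) * β m) ^ s * W t ^ s ≤
      ∫ t in (-π)..π, (16 * (step N)⁻¹) ^ s * ((|A|+1) ^ (s-1) *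
        ∑ m ∈ S, cell N t (y m) ^ (-p) * (β m ^ s * W (y m) ^ s)) := by
    refine intervalIntegral.integral_mono_on (by linarith) ?_ ?_ (fun t _ => point t)
    · refine Continuous.intervalIntegrable (Continuous.mul ?_ ?_) _ _
      · exact (continuous_const.mul (continuous_finsetSum _ fun m _ =>
          (cK _ _).mul continuous_const)).rpow_const fun t => Or.inr hs0.le
      · exact cW.rpow_const fun t => Or.inr hs0.le
    · exact (continuous_const.mul (continuous_const.mul
        (continuous_finsetSum _ fun m _ => cm m))).intervalIntegrable _ _
  refine h1.trans ?_
  rw [intervalIntegral.integral_const_mul, intervalIntegral.integral_const_mul,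
    intervalIntegral.integral_finsetSum fun m _ => (cm m).intervalIntegrable _ _]
  have h2 : ∑ m ∈ S, ∫ t in (-π)..π, cell N t (y m) ^ (-p) * (β m ^ s * W (y m) ^ s) ≤
      C₁ * step N * ∑ m ∈ S, β m ^ s * W (y m) ^ s := by
    rw [mul_sum]
    refine sum_le_sum fun m _ => ?_
    rw [intervalIntegral.integral_mul_const]
    have := mul_nonneg (rpow_nonneg (hβ m) s) (rpow_nonneg (hW0 (y m)).le s)
    gcongr
    exact hInt N (y m)
  calc _ ≤ (16 * (step N)⁻¹) ^ s * ((|A|+1) ^ (s-1) *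
        (C₁ * step N * ∑ m ∈ S, β m ^ s * W (y m) ^ s)) := by gcongr
    _ = _ := by
      rw [mul_rpow (by norm_num) (by positivity), inv_rpow hh.le, rpow_sub hh, rpow_one]
      field_simp

/-- Weighted bound for Cauchy-type sums with nonnegative coefficients. -/
lemma exists_integral_cauchy_nonneg_le {s φ Y A : ℝ} (hs : 1 < s) (hs2 : s ≤ 2)
    (hφ0 : 0 ≤ φ) (hφ : s * φ < (s-1)*π/2) (hY : 1 ≤ Y) :
    ∃ C : ℝ, 0 < C ∧ ∀ (N : ℕ) (L : ℂ → ℂ), DifferentiableOn ℂ L (Metric.ball 0 1) →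
      (∀ z ∈ Metric.ball (0:ℂ) (Real.exp (-(Y * step N))), |(L z).im| < φ) →
      ∀ (R : ℝ) (S : Finset ℤ) (y : ℤ → ℝ), 1 ≤ R → R ≤ Real.exp (2 * Y * step N) →
      (∀ t, ∑ m ∈ S, cell N t (y m) ^ (-(2 - 4*φ/π)) ≤ A) → ∀ β : ℤ → ℝ, (∀ m, 0 ≤ β m) →
      ∫ t in (-π)..π, ‖∑ m ∈ S, β m * (R * pt (y m)) / (R * pt (y m) -
          Real.exp (-(2 * Y * step N)) * pt t)‖ ^ s *
          Real.exp (s * (L (Real.exp (-(2 * Y * step N)) * pt t)).re) ≤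
        C * (step N ^ (1 - s) * ∑ m ∈ S, β m ^ s *
          Real.exp (s * (L (Real.exp (-(2 * Y * step N)) * pt (y m))).re)) := by
  have hpi := pi_pos
  have hs0 : 0 < s := by linarith
  have hφ1 : φ < π/4 := by
    have : s * φ < s * (π/4) := by nlinarith
    exact lt_of_mul_lt_mul_left this hs0.le
  obtain ⟨C₁, hC₁, hpois⟩ := exists_integral_poisson_le (A := A) hs hφ1 hY
  obtain ⟨C₂, hC₂, hriesz⟩ := exists_riesz hs hs2 (mul_nonneg hs0.le hφ0) hφ
  set D : ℝ := 100 * (8 * Y * Real.exp (8*π*Y)) with hD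
  have hD0 : 0 < D := by positivity
  refine ⟨2 * C₂ * (D ^ s * C₁), by positivity, fun N L hL hLφ R S y hR1 hR hS β hβ => ?_⟩
  have hh := step_pos N
  have hσle : Real.exp (-(2 * Y * step N)) ≤ 1 - step N / 8 := by
    have := step_le_one_sub_exp (N := N) hY; linarith
  have hσρ : Real.exp (-(2 * Y * step N)) < Real.exp (-(Y * step N)) := by
    rw [Real.exp_lt_exp]; nlinarith
  have hRσ : R^2 - Real.exp (-(2 * Y * step N))^2 ≤ 8 * Y * Real.exp (8*π*Y) * step N := by
    set x := 4 * Y * step N with hx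
    have hx0 : 0 ≤ x := by positivity
    have e1 : R^2 ≤ Real.exp x := by
      calc R^2 ≤ Real.exp (2 * Y * step N)^2 := by gcongr
        _ = Real.exp x := by rw [← Real.exp_nat_mul]; congr 1; push_cast; ring
    have e2 : Real.exp (-(2 * Y * step N))^2 = Real.exp (-x) := by
      rw [← Real.exp_nat_mul]; congr 1; push_cast; ring
    have e3 : Real.exp x - Real.exp (-x) ≤ 2 * x * Real.exp x := by
      have f1 := Real.add_one_le_exp (-(2*x))
      have f2 : Real.exp (-x) = Real.exp x * Real.exp (-(2*x)) := by
        rw [← Real.exp_add]; congr 1; ring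
      rw [f2]
      nlinarith [Real.exp_pos x]
    have e4 : Real.exp x ≤ Real.exp (8*π*Y) := by
      rw [Real.exp_le_exp, hx]
      have := step_le N
      nlinarith
    calc _ ≤ 2 * x * Real.exp x := by rw [e2]; linarith
      _ ≤ 2 * x * Real.exp (8*π*Y) := by gcongr
      _ = _ := by rw [hx]; ring
  set σ := Real.exp (-(2 * Y * step N)) with hσ
  have hσ0 : 0 < σ := Real.exp_pos _
  have hσ1 : σ < 1 := by linarith
  set η : ℤ → ℂ := fun m => R * pt (y m) with hη
  have hηn : ∀ m, ‖η m‖ = R := fun m => by simp [hη, abs_of_nonneg (zero_le_one.trans hR1)]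
  have hηne : ∀ m, ∀ z ∈ Metric.ball (0:ℂ) 1, η m - z ≠ 0 := by
    intro m z hz h0
    rw [sub_eq_zero] at h0
    rw [mem_ball_zero_iff, ← h0, hηn] at hz
    linarith
  by_cases hall : ∀ m ∈ S, β m = 0
  · have : ∀ t : ℝ, ∑ m ∈ S, (β m : ℂ) * (R * pt (y m)) / (R * pt (y m) - σ * pt t) = 0 :=
      fun t => sum_eq_zero fun m hm => by simp [hall m hm]
    simp only [this, norm_zero, zero_rpow hs0.ne', zero_mul, intervalIntegral.integral_zero]
    exact mul_nonneg (by positivity) (mul_nonneg (rpow_nonneg (step_pos N).le _)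
      (sum_nonneg fun m _ => mul_nonneg (rpow_nonneg (hβ m) s) (Real.exp_pos _).le))
  push Not at hall
  obtain ⟨m₀, hm₀, hne⟩ := hall
  set f : ℂ → ℂ := fun z => ∑ m ∈ S, β m * ((η m + z) / (η m - z)) with hf
  have df : DifferentiableOn ℂ f (Metric.ball 0 1) := by
    refine DifferentiableOn.fun_sum fun m _ => ?_
    refine DifferentiableOn.const_mul ?_ _
    exact DifferentiableOn.div (by fun_prop) (by fun_prop) (hηne m)
  have repart : ∀ m z, ((η m + z) / (η m - z)).re = (R^2 - ‖z‖^2) / ‖η m - z‖^2 := by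
    intro m z
    rw [← hηn m, Complex.div_re, ← add_div, Complex.normSq_eq_norm_sq]
    congr 1
    simp only [← Complex.normSq_eq_norm_sq, Complex.normSq_apply]
    simp
    ring
  have fre : ∀ z, (f z).re = ∑ m ∈ S, β m * ((R^2 - ‖z‖^2) / ‖η m - z‖^2) := by
    intro z
    simp only [hf, Complex.re_sum]
    refine sum_congr rfl fun m _ => ?_
    rw [Complex.re_ofReal_mul, repart]
  have fpos : ∀ z ∈ Metric.ball (0:ℂ) 1, 0 < (f z).re := by
    intro z hz
    have hp : ∀ m, 0 < (R^2 - ‖z‖^2) / ‖η m - z‖^2 := by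
      intro m
      have := norm_pos_iff.mpr (hηne m z hz)
      rw [mem_ball_zero_iff] at hz
      have : ‖z‖^2 < 1 := by nlinarith [norm_nonneg z]
      have : 0 < R^2 - ‖z‖^2 := by nlinarith
      positivity
    rw [fre]
    exact sum_pos' (fun m _ => mul_nonneg (hβ m) (hp m).le)
      ⟨m₀, hm₀, mul_pos (lt_of_le_of_ne (hβ m₀) (Ne.symm hne)) (hp m₀)⟩
  have hη0 : ∀ m, η m ≠ 0 := fun m => by simpa using hηne m 0 (by simp)
  have f0 : f 0 = ((∑ m ∈ S, β m : ℝ) : ℂ) := by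
    simp only [hf]
    push_cast
    refine sum_congr rfl fun m _ => ?_
    rw [add_zero, sub_zero, div_self (hη0 m), mul_one]
  have hσmem : ∀ t : ℝ, (σ * pt t : ℂ) ∈ Metric.ball (0:ℂ) 1 := fun t => by
    simp [abs_of_pos hσ0, hσ1]
  have hsL : ∀ z ∈ Metric.ball (0:ℂ) (Real.exp (-(Y * step N))), |s * (L z).im| ≤ s * φ := by
    intro z hz
    rw [abs_mul, abs_of_pos hs0]
    have := (hLφ z hz).le
    gcongr
  obtain ⟨r1, r2⟩ := hriesz σ f L hσ0 hσ1 df hL fpos (by rw [f0]; simp)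
    (fun t => hsL _ (by simpa [abs_of_pos hσ0] using hσρ))
    (hsL 0 (by simp [Real.exp_pos]))
  set E : ℝ → ℝ := fun t => Real.exp (s * (L (σ * pt t)).re) with hE
  have hE0 : ∀ t, 0 < E t := fun t => Real.exp_pos _
  have cE : Continuous E :=
    (continuous_const.mul (Complex.continuous_re.comp (continuous_disc hσ0 hσ1 hL))).rexp
  have cf := continuous_disc hσ0 hσ1 df
  have cK : ∀ (q x : ℝ), Continuous (fun t => cell N t x ^ q) := fun q x =>
    (continuous_cell N x).rpow_const (fun t => Or.inl (cell_pos N t x).ne')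
  have K0 : ∀ (q t x : ℝ), 0 ≤ cell N t x ^ q := fun q t x => rpow_nonneg (cell_pos _ _ _).le _
  have hreb : ∀ t : ℝ, (f (σ * pt t)).re ≤
      D * ((step N)⁻¹ * ∑ m ∈ S, cell N t (y m) ^ (-2:ℝ) * β m) := by
    intro t
    rw [fre, mul_sum, mul_sum]
    refine sum_le_sum fun m _ => ?_
    have e1 := step_mul_cell_le hσ0.le hσle hR1 t (y m)
    have e2 : ‖(σ * pt t : ℂ)‖ = σ := by simp [abs_of_pos hσ0]
    have hc := cell_pos N t (y m)
    have e3 : (step N * cell N t (y m))^2 ≤ 100 * ‖η m - σ * pt t‖^2 := by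
      calc _ ≤ (10 * ‖η m - σ * pt t‖)^2 := by gcongr
        _ = _ := by ring
    have e4 : 0 < ‖η m - σ * pt t‖ := norm_pos_iff.mpr (hηne m _ (hσmem t))
    have e5 : (R^2 - σ^2) / ‖η m - σ * pt t‖^2 ≤ D * ((step N)⁻¹ * cell N t (y m) ^ (-2:ℝ)) := by
      rw [div_le_iff₀ (by positivity), rpow_neg hc.le, rpow_two]
      calc R^2 - σ^2 ≤ 8 * Y * Real.exp (8*π*Y) * step N := hRσ
        _ = (8 * Y * Real.exp (8*π*Y)) * ((step N)⁻¹ * (cell N t (y m)^2)⁻¹) *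
            (step N * cell N t (y m))^2 := by field_simp
        _ ≤ (8 * Y * Real.exp (8*π*Y)) * ((step N)⁻¹ * (cell N t (y m)^2)⁻¹) *
            (100 * ‖η m - σ * pt t‖^2) := by gcongr
        _ = _ := by rw [hD]; ring
    rw [e2]
    calc _ ≤ β m * (D * ((step N)⁻¹ * cell N t (y m) ^ (-2:ℝ))) :=
          mul_le_mul_of_nonneg_left e5 (hβ m)
      _ = _ := by ring
  have hP0 : ∀ t : ℝ, 0 ≤ (step N)⁻¹ * ∑ m ∈ S, cell N t (y m) ^ (-2:ℝ) * β m := fun t =>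
    mul_nonneg (by positivity) (sum_nonneg fun m _ => mul_nonneg (K0 _ _ _) (hβ m))
  have hI : ∫ t in (-π)..π, (f (σ * pt t)).re ^ s * E t ≤
      D ^ s * (C₁ * (step N ^ (1 - s) * ∑ m ∈ S, β m ^ s * E (y m))) := by
    refine le_trans ?_ (mul_le_mul_of_nonneg_left (hpois N L hL hLφ S y hS β hβ) (by positivity))
    rw [← intervalIntegral.integral_const_mul]
    refine intervalIntegral.integral_mono_on (by linarith) ?_ ?_ ?_
    · exact (((Complex.continuous_re.comp cf).rpow_const fun t => Or.inr hs0.le).mul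
        cE).intervalIntegrable _ _
    · exact (continuous_const.mul (((continuous_const.mul (continuous_finsetSum _ fun m _ =>
        (cK _ _).mul continuous_const)).rpow_const fun t => Or.inr hs0.le).mul
        cE)).intervalIntegrable _ _
    · intro t _
      rw [← mul_assoc, ← mul_rpow hD0.le (hP0 t)]
      have := hE0 t
      have := (fpos _ (hσmem t)).le
      have := hreb t
      gcongr
  have key : ∀ t : ℝ, ‖∑ m ∈ S, β m * (R * pt (y m)) / (R * pt (y m) - σ * pt t)‖ ^ s * E t ≤
      ‖f (σ * pt t)‖ ^ s * E t + (f 0).re ^ s * E t := by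
    intro t
    have e1 : ∑ m ∈ S, β m * (R * pt (y m)) / (R * pt (y m) - σ * pt t) =
        (f (σ * pt t) + f 0) / 2 := by
      rw [f0]
      simp only [hf]
      push_cast
      rw [← sum_add_distrib, sum_div]
      refine sum_congr rfl fun m _ => ?_
      have h3 := hηne m _ (hσmem t)
      simp only [hη] at h3 ⊢
      field_simp
      ring
    have hf0 : 0 ≤ (f 0).re := (fpos 0 (by simp)).le
    have hf0' : ‖f 0‖ = (f 0).re := by
      rw [f0, Complex.norm_real, Real.norm_of_nonneg, Complex.ofReal_re]
      rwa [f0, Complex.ofReal_re] at hf0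
    rw [e1, ← add_mul]
    refine mul_le_mul_of_nonneg_right ?_ (hE0 t).le
    have e2 : ‖(f (σ * pt t) + f 0) / 2‖ ≤ max ‖f (σ * pt t)‖ (f 0).re := by
      rw [norm_div, Complex.norm_ofNat, div_le_iff₀ two_pos]
      refine (norm_add_le _ _).trans ?_
      rw [hf0']
      linarith [le_max_left ‖f (σ * pt t)‖ (f 0).re, le_max_right ‖f (σ * pt t)‖ (f 0).re]
    refine (rpow_le_rpow (norm_nonneg _) e2 hs0.le).trans ?_
    have n1 := rpow_nonneg (norm_nonneg (f (σ * pt t))) s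
    have n2 := rpow_nonneg hf0 s
    rcases max_choice ‖f (σ * pt t)‖ (f 0).re with h | h <;> rw [h] <;> linarith
  have c1 : Continuous fun t : ℝ => ‖f (σ * pt t)‖ ^ s * E t :=
    (cf.norm.rpow_const fun t => Or.inr hs0.le).mul cE
  have c2 : Continuous fun t : ℝ => (f 0).re ^ s * E t := continuous_const.mul cE
  have c3 : Continuous fun t : ℝ =>
      ‖∑ m ∈ S, β m * (R * pt (y m)) / (R * pt (y m) - σ * pt t)‖ ^ s * E t := by
    refine Continuous.mul (Continuous.rpow_const (Continuous.norm ?_) fun t => Or.inr hs0.le) cE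
    refine continuous_finsetSum _ fun m _ => Continuous.div continuous_const ?_
      fun t => hηne m _ (hσmem t)
    exact continuous_const.sub (continuous_const.mul continuous_pt)
  calc _ ≤ ∫ t in (-π)..π, (‖f (σ * pt t)‖ ^ s * E t + (f 0).re ^ s * E t) :=
        intervalIntegral.integral_mono_on (by linarith) (c3.intervalIntegrable _ _)
          ((c1.add c2).intervalIntegrable _ _) fun t _ => key t
    _ = (∫ t in (-π)..π, ‖f (σ * pt t)‖ ^ s * E t) + ∫ t in (-π)..π, (f 0).re ^ s * E t :=
        intervalIntegral.integral_add (c1.intervalIntegrable _ _) (c2.intervalIntegrable _ _)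
    _ ≤ 2 * C₂ * ∫ t in (-π)..π, (f (σ * pt t)).re ^ s * E t := by linarith
    _ ≤ 2 * C₂ * (D ^ s * (C₁ * (step N ^ (1 - s) * ∑ m ∈ S, β m ^ s * E (y m)))) := by gcongr
    _ = _ := by ring

/-- Weighted bound for Cauchy-type sums with complex coefficients. -/
lemma exists_integral_cauchy_le {s φ Y A : ℝ} (hs : 1 < s) (hs2 : s ≤ 2)
    (hφ0 : 0 ≤ φ) (hφ : s * φ < (s-1)*π/2) (hY : 1 ≤ Y) :
    ∃ C : ℝ, 0 < C ∧ ∀ (N : ℕ) (L : ℂ → ℂ), DifferentiableOn ℂ L (Metric.ball 0 1) →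
      (∀ z ∈ Metric.ball (0:ℂ) (Real.exp (-(Y * step N))), |(L z).im| < φ) →
      ∀ (R : ℝ) (S : Finset ℤ) (y : ℤ → ℝ), 1 ≤ R → R ≤ Real.exp (2 * Y * step N) →
      (∀ t, ∑ m ∈ S, cell N t (y m) ^ (-(2 - 4*φ/π)) ≤ A) → ∀ β : ℤ → ℂ,
      ∫ t in (-π)..π, ‖∑ m ∈ S, β m * (R * pt (y m)) / (R * pt (y m) -
          Real.exp (-(2 * Y * step N)) * pt t)‖ ^ s *
          Real.exp (s * (L (Real.exp (-(2 * Y * step N)) * pt t)).re) ≤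
        C * (step N ^ (1 - s) * ∑ m ∈ S, ‖β m‖ ^ s *
          Real.exp (s * (L (Real.exp (-(2 * Y * step N)) * pt (y m))).re)) := by
  obtain ⟨C, hC, hmain⟩ := exists_integral_cauchy_nonneg_le (A := A) hs hs2 hφ0 hφ hY
  have hpi := pi_pos
  have hs0 : 0 < s := by linarith
  refine ⟨4 ^ (s-1) * (4 * C), by positivity, ?_⟩
  intro N L hL him R S y hR hR2 hA β
  have hh := step_pos N
  set σ : ℝ := Real.exp (-(2 * Y * step N)) with hσ
  have hσ0 : 0 < σ := Real.exp_pos _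
  have hσ1 : σ < 1 := by
    rw [hσ, Real.exp_lt_one_iff]; nlinarith
  have cW : Continuous fun t : ℝ => Real.exp (s * (L (σ * pt t)).re) :=
    (continuous_const.mul (Complex.continuous_re.comp (continuous_disc hσ0 hσ1 hL))).rexp
  let u : Fin 4 → ℂ := ![1, -1, Complex.I, -Complex.I]
  let b : Fin 4 → ℤ → ℝ := ![fun m => max (β m).re 0, fun m => max (-(β m).re) 0,
    fun m => max (β m).im 0, fun m => max (-(β m).im) 0]
  have hu : ∀ i, ‖u i‖ = 1 := by intro i; fin_cases i <;> simp [u]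
  have hb0 : ∀ i m, 0 ≤ b i m := by intro i m; fin_cases i <;> simp [b]
  have hb1 : ∀ i m, b i m ≤ ‖β m‖ := by
    intro i m
    have h1 := abs_le.1 (Complex.abs_re_le_norm (β m))
    have h2 := abs_le.1 (Complex.abs_im_le_norm (β m))
    fin_cases i <;> simp [b] <;> linarith
  have hsplit : ∀ m, β m = ∑ i, u i * (b i m : ℂ) := by
    intro m
    have e : ∀ a : ℝ, max a 0 - max (-a) 0 = a := by
      intro a; rcases le_total a 0 with h | h
      · rw [max_eq_right h, max_eq_left (by linarith)]; ring
      · rw [max_eq_left h, max_eq_right (by linarith)]; ring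
    have e1 := e (β m).re
    have e2 := e (β m).im
    apply Complex.ext <;> simp [Fin.sum_univ_four, u, b] <;> linarith
  let F : Fin 4 → ℝ → ℂ := fun i t => ∑ m ∈ S, (b i m : ℂ) * (R * pt (y m)) / (R * pt (y m) -
          σ * pt t)
  have hden : ∀ (m : ℤ) (t : ℝ), (R * pt (y m) - σ * pt t : ℂ) ≠ 0 := by
    intro m t h
    have h2 := congrArg norm (sub_eq_zero.1 h)
    simp only [norm_mul, norm_pt, Complex.norm_real, mul_one, Real.norm_eq_abs] at h2
    rw [abs_of_pos (by linarith), abs_of_pos hσ0] at h2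
    linarith
  have cF : ∀ i, Continuous (F i) := by
    intro i
    refine continuous_finsetSum _ fun m _ => ?_
    exact continuous_const.div (continuous_const.sub (continuous_const.mul continuous_pt))
      (hden m)
  have hF : ∀ t, (∑ m ∈ S, β m * (R * pt (y m)) / (R * pt (y m) - σ * pt t)) =
      ∑ i, u i * F i t := by
    intro t
    simp only [F, mul_sum]
    rw [sum_comm]
    refine sum_congr rfl fun m _ => ?_
    conv_lhs => rw [hsplit m]
    rw [sum_mul, sum_div]
    exact sum_congr rfl fun i _ => by ring
  have hnorm : ∀ t, ‖∑ m ∈ S, β m * (R * pt (y m)) / (R * pt (y m) - σ * pt t)‖ ^ s ≤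
      4 ^ (s-1) * ∑ i, ‖F i t‖ ^ s := by
    intro t
    have h1 := sum_mul_rpow_le (A := 4) (univ : Finset (Fin 4)) hs.le (K := fun _ => 1)
      (f := fun i => ‖F i t‖) (fun _ => zero_le_one) (fun _ => norm_nonneg _) (by simp)
    simp only [one_mul] at h1
    refine le_trans (rpow_le_rpow (norm_nonneg _) ?_ hs0.le) h1
    rw [hF t]
    refine (norm_sum_le _ _).trans (sum_le_sum fun i _ => ?_)
    rw [norm_mul, hu i, one_mul]
  have cFs : ∀ i, Continuous fun t => ‖F i t‖ ^ s * Real.exp (s * (L (σ * pt t)).re) := fun i =>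
    ((cF i).norm.rpow_const fun t => Or.inr hs0.le).mul cW
  have cT : Continuous fun t => ‖∑ m ∈ S, β m * (R * pt (y m)) / (R * pt (y m) - σ * pt t)‖ ^ s *
      Real.exp (s * (L (σ * pt t)).re) := by
    simp only [hF]
    exact ((continuous_finsetSum _ fun i _ => continuous_const.mul (cF i)).norm.rpow_const
      fun t => Or.inr hs0.le).mul cW
  calc _ ≤ ∫ t in (-π)..π, 4 ^ (s-1) * ∑ i, ‖F i t‖ ^ s * Real.exp (s * (L (σ * pt t)).re) := by
        refine intervalIntegral.integral_mono_on (by linarith) (cT.intervalIntegrable _ _)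
          ((continuous_const.mul (continuous_finsetSum _ fun i _ => cFs i)).intervalIntegrable _ _)
          fun t _ => ?_
        rw [← sum_mul, ← mul_assoc]
        exact mul_le_mul_of_nonneg_right (hnorm t) (Real.exp_pos _).le
    _ = 4 ^ (s-1) * ∑ i, ∫ t in (-π)..π, ‖F i t‖ ^ s * Real.exp (s * (L (σ * pt t)).re) := by
        rw [intervalIntegral.integral_const_mul, intervalIntegral.integral_finsetSum]
        exact fun i _ => (cFs i).intervalIntegrable _ _
    _ ≤ 4 ^ (s-1) * ∑ i : Fin 4, C * (step N ^ (1 - s) * ∑ m ∈ S, ‖β m‖ ^ s *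
          Real.exp (s * (L (σ * pt (y m))).re)) := by
        gcongr with i _
        refine (hmain N L hL him R S y hR hR2 hA (b i) (hb0 i)).trans ?_
        gcongr with m _
        · exact hb0 i m
        · exact hb1 i m
    _ = _ := by simp; ring

/-! ### The node polynomial -/

/-- The polynomial of degree `2N+1` with value `1` at the origin vanishing at the points
`pt (x j)`. -/
noncomputable def nodePoly (N : ℕ) (x : ℤ → ℝ) (z : ℂ) : ℂ := ∏ j ∈ idx N, (1 - z * pt (-x j))

lemma pt_neg_mul (s t : ℝ) : pt s * pt (-t) = pt (s - t) := by rw [← pt_add, sub_eq_add_neg]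

lemma norm_one_sub_pt_mul (s t : ℝ) : ‖1 - pt s * pt (-t)‖ = chord s t := by
  have : pt s - pt t = -(pt t * (1 - pt s * pt (-t))) := by
    have h : pt t * pt (-t) = 1 := by rw [pt_neg_mul, sub_self, pt_zero]
    linear_combination -pt s * h
  rw [chord, this, norm_neg, norm_mul, norm_pt, one_mul]

lemma pt_int_mul_step_pow (N : ℕ) (j : ℤ) : pt (-(j * step N)) ^ (2*N+1) = 1 := by
  rw [pt, ← Complex.exp_nat_mul, Complex.exp_eq_one_iff]
  refine ⟨-j, ?_⟩
  have h : ((2*N+1 : ℝ) : ℂ) * (step N : ℂ) = ((2*π : ℝ) : ℂ) := by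
    rw [← Complex.ofReal_mul, step_mul]
  push_cast at h ⊢
  linear_combination (-(j:ℂ) * Complex.I) * h

lemma prod_one_sub_grid (N : ℕ) (z : ℂ) :
    ∏ j ∈ idx N, (1 - z * pt (-(j * step N))) = 1 - z ^ (2*N+1) := by
  have hn : (2*N+1) ≠ 0 := by omega
  have hpr := Complex.isPrimitiveRoot_exp (2*N+1) hn
  have h := IsPrimitiveRoot.pow_sub_pow_eq_prod_sub_mul (1:ℂ) z (Nat.pos_of_ne_zero hn) hpr
  rw [one_pow] at h
  rw [h]
  have hinj : Set.InjOn (fun j : ℤ => pt (-(j * step N))) (idx N) := by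
    intro i hi j hj hij
    by_contra hne
    have hx : ∀ j ∈ idx N, |((j:ℝ) * step N) - j * step N| ≤ 0 * step N := by simp
    have h1 := chord_node_ge (x := fun j => (j:ℝ) * step N) hx hi hj hne
    have hij' : pt (-(i * step N)) = pt (-(j * step N)) := hij
    rw [← norm_one_sub_pt_mul, ← hij', pt_neg_mul, sub_self, pt_zero, sub_self, norm_zero] at h1
    have := step_pos N
    have : 0 < 2/π * ((1 - 2*0) * step N) := by have := pi_pos; positivity
    linarith
  have himg : (idx N).image (fun j : ℤ => pt (-(j * step N))) =
      Polynomial.nthRootsFinset (2*N+1) (1:ℂ) := by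
    refine eq_of_subset_of_card_le (fun w hw => ?_) ?_
    · obtain ⟨j, -, rfl⟩ := mem_image.1 hw
      exact (Polynomial.mem_nthRootsFinset (Nat.pos_of_ne_zero hn) 1).2 (pt_int_mul_step_pow N j)
    · rw [card_image_of_injOn hinj, hpr.card_nthRootsFinset, card_idx]
  rw [← himg, prod_image hinj]
  exact prod_congr rfl fun j _ => by ring

lemma sum_inv_one_sub_grid (N : ℕ) {z : ℂ} (hz : ‖z‖ < 1) :
    ∑ j ∈ idx N, (1 - z * pt (-(j * step N)))⁻¹ = (2*N+1) / (1 - z ^ (2*N+1)) := by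
  have hzn : 1 - z ^ (2*N+1) ≠ 0 := by
    intro h
    have h1 : ‖z ^ (2*N+1)‖ = 1 := by rw [← sub_eq_zero.1 h, norm_one]
    rw [norm_pow] at h1
    exact absurd h1 (pow_lt_one₀ (norm_nonneg _) hz (by omega)).ne
  have h1 : ∀ j ∈ idx N, (1 - z * pt (-(j * step N)))⁻¹ =
      (∑ k ∈ range (2*N+1), (z * pt (-(j * step N))) ^ k) / (1 - z ^ (2*N+1)) := by
    intro j _
    have h2 := mul_neg_geom_sum (z * pt (-(j * step N))) (2*N+1)
    rw [mul_pow, pt_int_mul_step_pow, mul_one] at h2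
    have h3 : 1 - z * pt (-(j * step N)) ≠ 0 := by
      intro h; rw [h, zero_mul] at h2; exact hzn h2.symm
    rw [← h2, inv_eq_one_div, div_eq_div_iff h3 (by rw [h2]; exact hzn)]
    ring
  rw [sum_congr rfl h1, ← sum_div, sum_comm]
  congr 1
  have h4 : ∀ k ∈ range (2*N+1), k ≠ 0 → ∑ j ∈ idx N, (z * pt (-(j * step N))) ^ k = 0 := by
    intro k hk hk0
    have hk' := mem_range.1 hk
    have h5 := sum_exp_grid N (m := -(k:ℤ)) (by omega) (by rw [abs_neg, Nat.abs_cast]; omega) 0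
    simp only [mul_pow]
    rw [← mul_sum]
    refine mul_eq_zero_of_right _ (Eq.trans (sum_congr rfl fun j _ => ?_) h5)
    rw [pt, ← Complex.exp_nat_mul]
    congr 1
    push_cast; ring
  rw [sum_eq_single 0 h4 (by simp)]
  simp only [pow_zero, sum_const, card_idx, nsmul_eq_mul, mul_one]
  push_cast; ring

lemma re_two_mul_inv_sub_one {w : ℂ} (hw : ‖w‖ < 1) :
    (2 * (1 - w)⁻¹ - 1).re = (1 - ‖w‖^2) / ‖1 - w‖^2 := by
  have h : 0 < Complex.normSq (1 - w) := by
    rw [Complex.normSq_pos]; intro h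
    rw [← sub_eq_zero.1 h, norm_one] at hw; exact lt_irrefl _ hw
  have e : (2 * (1 - w)⁻¹ - 1).re = 2 * (1 - w).re / Complex.normSq (1 - w) - 1 := by
    simp [Complex.inv_re, mul_div_assoc]
  rw [e, ← Complex.normSq_eq_norm_sq, ← Complex.normSq_eq_norm_sq, eq_div_iff h.ne', sub_mul,
    div_mul_cancel₀ _ h.ne']
  simp only [Complex.normSq_apply, Complex.sub_re, Complex.sub_im, Complex.one_re, Complex.one_im]
  ring

lemma sum_poisson_grid_le (N : ℕ) {z : ℂ} (hz : ‖z‖ < 1) {ε : ℝ} (hε : ‖z‖ ^ (2*N+1) ≤ ε)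
    (hε1 : ε < 1) :
    ∑ j ∈ idx N, (1 - ‖z‖^2) / ‖1 - z * pt (-(j * step N))‖^2 ≤ (2*N+1) * ((1+ε)/(1-ε)) := by
  have h1 : ∀ j ∈ idx N, (1 - ‖z‖^2) / ‖1 - z * pt (-(j * step N))‖^2 =
      (2 * (1 - z * pt (-(j * step N)))⁻¹ - 1).re := by
    intro j _
    rw [re_two_mul_inv_sub_one] <;> simp [hz]
  have hzn : ‖z ^ (2*N+1)‖ ≤ ε := by rwa [norm_pow]
  rw [sum_congr rfl h1, ← Complex.re_sum, sum_sub_distrib, ← mul_sum, sum_inv_one_sub_grid N hz,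
    sum_const, card_idx]
  have e : (2 * ((2*N+1) / (1 - z ^ (2*N+1))) - (2*N+1) • (1:ℂ)) =
      ((2*N+1 : ℝ) : ℂ) * (2 * (1 - z ^ (2*N+1))⁻¹ - 1) := by
    simp; ring
  rw [e, Complex.re_ofReal_mul, re_two_mul_inv_sub_one (lt_of_le_of_lt hzn hε1)]
  refine mul_le_mul_of_nonneg_left ?_ (by positivity)
  set w := z ^ (2*N+1)
  have h2 : 1 - ‖w‖ ≤ ‖1 - w‖ := by
    have := norm_sub_norm_le (1:ℂ) w; rwa [norm_one] at this
  have h3 : 0 < 1 - ‖w‖ := by linarith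
  calc (1 - ‖w‖^2) / ‖1 - w‖^2 ≤ (1 - ‖w‖^2) / (1 - ‖w‖)^2 := by
        gcongr
        nlinarith [norm_nonneg w]
    _ = (1 + ‖w‖) / (1 - ‖w‖) := by
        rw [div_eq_div_iff (by positivity) (by positivity)]; ring
    _ ≤ (1+ε)/(1-ε) := by
        have := norm_nonneg w
        have : 0 < 1 - ε := by linarith
        have : 0 ≤ ε := by linarith
        gcongr

/-- Moving a node by at most one step changes the argument of the corresponding factor by half
the displacement, up to a Poisson kernel error. -/
lemma abs_im_log_sub_le {z : ℂ} {δ h x a : ℝ} (hz : ‖z‖ < 1) (hδ0 : 0 ≤ δ)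
    (hδ : ‖z‖ * h ≤ δ * (1 - ‖z‖)) (hxa : |x - a| ≤ h) :
    |((Complex.log (1 - z * pt (-x))).im + x/2) - ((Complex.log (1 - z * pt (-a))).im + a/2)| ≤
      (1+δ)^2 * ((1 - ‖z‖^2) / ‖1 - z * pt (-a)‖^2) / 2 * |x - a| := by
  have hw : ∀ t : ℝ, ‖z * pt (-t)‖ < 1 := by simp [hz]
  have hslit : ∀ t : ℝ, 1 - z * pt (-t) ∈ Complex.slitPlane := by
    intro t
    left
    have := (Complex.abs_re_le_norm (z * pt (-t))).trans_lt (hw t)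
    rw [Complex.sub_re, Complex.one_re]
    linarith [(abs_lt.1 this).2]
  have hder : ∀ t : ℝ, HasDerivAt (fun t : ℝ => (Complex.log (1 - z * pt (-t))).im + t/2)
      (((1 - ‖z‖^2) / ‖1 - z * pt (-t)‖^2) / 2) t := by
    intro t
    have h1 : HasDerivAt (fun t : ℝ => pt (-t)) (-Complex.I * pt (-t)) t := by
      have h0 : HasDerivAt (fun t : ℝ => ((-t : ℝ) : ℂ) * Complex.I) (-1 * Complex.I) t := by
        have := ((hasDerivAt_neg t).ofReal_comp).mul_const Complex.I
        simpa using this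
      refine h0.cexp.congr_deriv ?_
      rw [← pt]; ring
    have h2 : HasDerivAt (fun t : ℝ => 1 - z * pt (-t)) (Complex.I * (z * pt (-t))) t := by
      refine ((h1.const_mul z).const_sub 1).congr_deriv ?_
      ring
    have h3 := h2.clog_real (hslit t)
    have h4 := (Complex.imCLM.hasFDerivAt.comp_hasDerivAt t h3).add ((hasDerivAt_id t).div_const 2)
    refine h4.congr_deriv ?_
    have h5 := re_two_mul_inv_sub_one (hw t)
    rw [norm_mul, norm_pt, mul_one] at h5
    have hne : 1 - z * pt (-t) ≠ 0 := Complex.slitPlane_ne_zero (hslit t)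
    have h6 : 2 * (1 - z * pt (-t))⁻¹ - 1 = 1 + 2 * ((z * pt (-t)) / (1 - z * pt (-t))) := by
      field_simp; ring
    rw [← h5, h6, mul_div_assoc]
    simp [Complex.mul_im]
    ring
  have hbound : ∀ t ∈ Set.uIcc a x, ‖((1 - ‖z‖^2) / ‖1 - z * pt (-t)‖^2) / 2‖ ≤
      (1+δ)^2 * ((1 - ‖z‖^2) / ‖1 - z * pt (-a)‖^2) / 2 := by
    intro t ht
    have hta : |t - a| ≤ h := (Set.abs_sub_left_of_mem_uIcc ht).trans hxa
    have hpos : ∀ t : ℝ, 1 - ‖z‖ ≤ ‖1 - z * pt (-t)‖ := by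
      intro t
      have := norm_sub_norm_le (1:ℂ) (z * pt (-t))
      rwa [norm_one, norm_mul, norm_pt, mul_one] at this
    have h0 : 0 < 1 - ‖z‖ := by linarith
    have hz2 : 0 ≤ 1 - ‖z‖^2 := by nlinarith [norm_nonneg z]
    have p1 := h0.trans_le (hpos t)
    have p2 := h0.trans_le (hpos a)
    have hle : ‖1 - z * pt (-a)‖ ≤ (1+δ) * ‖1 - z * pt (-t)‖ := by
      have e : 1 - z * pt (-a) = (1 - z * pt (-t)) + z * (pt (-t) - pt (-a)) := by ring
      have h1 : ‖pt (-t) - pt (-a)‖ ≤ h := by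
        refine (chord_le_abs (-t) (-a)).trans ?_
        rw [← abs_neg]; refine le_of_eq_of_le (congrArg _ ?_) hta; ring
      calc ‖1 - z * pt (-a)‖ ≤ ‖1 - z * pt (-t)‖ + ‖z‖ * h := by
            rw [e]; refine (norm_add_le _ _).trans ?_
            rw [norm_mul z]; gcongr
        _ ≤ ‖1 - z * pt (-t)‖ + δ * ‖1 - z * pt (-t)‖ := by
            have := mul_le_mul_of_nonneg_left (hpos t) hδ0
            linarith
        _ = _ := by ring
    rw [Real.norm_of_nonneg (by positivity)]
    gcongr ?_ / 2
    rw [div_le_iff₀ (by positivity), ← mul_div_assoc, div_mul_eq_mul_div, le_div_iff₀ (by positivity)]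
    have := pow_le_pow_left₀ p2.le hle 2
    nlinarith
  have := (convex_uIcc a x).norm_image_sub_le_of_norm_hasDerivWithin_le
    (fun t _ => (hder t).hasDerivWithinAt) hbound Set.left_mem_uIcc Set.right_mem_uIcc
  simpa only [Real.norm_eq_abs] using this

/-- A logarithm of the node polynomial whose imaginary part stays small inside a slightly smaller
disc. -/
lemma exists_log_nodePoly {α θ : ℝ} (hα0 : 0 ≤ α) (hα1 : α ≤ 1) (hαθ : α < θ) :
    ∃ Y : ℝ, 1 ≤ Y ∧ ∀ (N : ℕ) (x : ℤ → ℝ), (∀ j ∈ idx N, |x j - j * step N| ≤ α * step N) →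
      ∃ L : ℂ → ℂ, DifferentiableOn ℂ L (Metric.ball 0 1) ∧
        (∀ z ∈ Metric.ball (0:ℂ) 1, Real.exp (L z).re = ‖nodePoly N x z‖) ∧
        ∀ z ∈ Metric.ball (0:ℂ) (Real.exp (-(Y * step N))), |(L z).im| < π * θ := by
  have hpi := pi_pos
  obtain ⟨δ, hδ0, hδ2, hδ⟩ : ∃ δ : ℝ, 0 < δ ∧ δ ≤ 1/2 ∧
      2 * δ + π * α * ((1+δ)^2 * ((1+δ)/(1-δ))) < π * θ := by
    have hc : ContinuousAt (fun δ : ℝ => 2 * δ + π * α * ((1+δ)^2 * ((1+δ)/(1-δ)))) 0 := by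
      refine ContinuousAt.add (by fun_prop) (ContinuousAt.mul (by fun_prop)
        (ContinuousAt.mul (by fun_prop) (ContinuousAt.div (by fun_prop) (by fun_prop) (by norm_num))))
    have h0 : (fun δ : ℝ => 2 * δ + π * α * ((1+δ)^2 * ((1+δ)/(1-δ)))) 0 < π * θ := by
      norm_num; nlinarith
    obtain ⟨ε, hε, hball⟩ := Metric.eventually_nhds_iff.1 (hc.eventually (gt_mem_nhds h0))
    refine ⟨min (ε/2) (1/2), by positivity, min_le_right _ _, hball ?_⟩
    rw [Real.dist_eq, sub_zero, abs_of_pos (by positivity)]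
    exact (min_le_left _ _).trans_lt (by linarith)
  have hY1 : 1 ≤ δ⁻¹ := (one_le_inv₀ hδ0).2 (by linarith)
  refine ⟨δ⁻¹, hY1, ?_⟩
  intro N x hx
  have hh := step_pos N
  set h := step N with hhdef
  have hslit : ∀ w : ℂ, ‖w‖ < 1 → 1 - w ∈ Complex.slitPlane := by
    intro w hw
    left
    have := (Complex.abs_re_le_norm w).trans_lt hw
    rw [Complex.sub_re, Complex.one_re]
    linarith [(abs_lt.1 this).2]
  have hpow : ∀ z : ℂ, ‖z‖ < 1 → ‖z ^ (2*N+1)‖ < 1 := fun z hz => by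
    rw [norm_pow]; exact pow_lt_one₀ (norm_nonneg _) hz (by omega)
  have hmul : ∀ (z : ℂ) (t : ℝ), ‖z‖ < 1 → ‖z * pt t‖ < 1 := fun z t hz => by simp [hz]
  set κ : ℝ := (∑ j ∈ idx N, (x j - j * h)) / 2 with hκ
  refine ⟨fun z => κ * Complex.I + Complex.log (1 - z ^ (2*N+1)) + ∑ j ∈ idx N,
    (Complex.log (1 - z * pt (-x j)) - Complex.log (1 - z * pt (-(j * h)))), ?_, ?_, ?_⟩
  · intro z hz
    have hz' : ‖z‖ < 1 := by simpa using hz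
    apply DifferentiableAt.differentiableWithinAt
    refine DifferentiableAt.add (DifferentiableAt.add (by fun_prop) ?_)
      (DifferentiableAt.fun_sum fun j _ => DifferentiableAt.sub ?_ ?_)
    · exact DifferentiableAt.clog (by fun_prop) (hslit _ (hpow z hz'))
    · exact DifferentiableAt.clog (by fun_prop) (hslit _ (hmul z _ hz'))
    · exact DifferentiableAt.clog (by fun_prop) (hslit _ (hmul z _ hz'))
  · intro z hz
    have hz' : ‖z‖ < 1 := by simpa using hz
    have hne : ∀ w : ℂ, ‖w‖ < 1 → 1 - w ≠ 0 := fun w hw => Complex.slitPlane_ne_zero (hslit w hw)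
    rw [← Complex.norm_exp, Complex.exp_add, Complex.exp_add, Complex.exp_log (hne _ (hpow z hz')),
      Complex.exp_sum]
    have e : ∀ j ∈ idx N, Complex.exp (Complex.log (1 - z * pt (-x j)) -
        Complex.log (1 - z * pt (-(j * h)))) = (1 - z * pt (-x j)) / (1 - z * pt (-(j * h))) := by
      intro j _
      rw [Complex.exp_sub, Complex.exp_log (hne _ (hmul z _ hz')),
        Complex.exp_log (hne _ (hmul z _ hz'))]
    rw [prod_congr rfl e, prod_div_distrib, prod_one_sub_grid, norm_mul, norm_mul,
      Complex.norm_exp_ofReal_mul_I, one_mul, norm_div,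
      mul_div_cancel₀ _ (norm_ne_zero_iff.2 (hne _ (hpow z hz')))]
    rfl
  · intro z hz
    have hzY : ‖z‖ < Real.exp (-(δ⁻¹ * h)) := by simpa using hz
    have hz' : ‖z‖ < 1 := hzY.trans (by rw [Real.exp_lt_one_iff]; nlinarith)
    have hz0 := norm_nonneg z
    have hδz : ‖z‖ * h ≤ δ * (1 - ‖z‖) := by
      have h1 : ‖z‖ * (1 + δ⁻¹ * h) ≤ 1 := by
        calc ‖z‖ * (1 + δ⁻¹ * h) ≤ Real.exp (-(δ⁻¹ * h)) * Real.exp (δ⁻¹ * h) := by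
              gcongr
              linarith [Real.add_one_le_exp (δ⁻¹ * h)]
          _ = 1 := by rw [← Real.exp_add]; simp
      have h2 : δ * δ⁻¹ = 1 := mul_inv_cancel₀ hδ0.ne'
      have h3 := mul_le_mul_of_nonneg_left h1 hδ0.le
      have h4 : δ * (‖z‖ * (1 + δ⁻¹ * h)) = δ * ‖z‖ + ‖z‖ * h := by
        linear_combination ‖z‖ * h * h2
      linarith
    have hε : ‖z‖ ^ (2*N+1) ≤ δ := by
      have h1 : ‖z‖ ^ (2*N+1) ≤ Real.exp (-(δ⁻¹ * (2*π))) := by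
        calc ‖z‖ ^ (2*N+1) ≤ Real.exp (-(δ⁻¹ * h)) ^ (2*N+1) := by gcongr
          _ = _ := by
            rw [← Real.exp_nat_mul, ← step_mul N]; congr 1; push_cast; ring
      have h2 : δ⁻¹ ≤ Real.exp (δ⁻¹ * (2*π)) := by
        have := Real.add_one_le_exp (δ⁻¹ * (2*π))
        nlinarith [pi_gt_three]
      refine h1.trans ?_
      rw [Real.exp_neg]
      exact inv_le_of_inv_le₀ hδ0 h2
    set f : ℝ → ℝ := fun t => (Complex.log (1 - z * pt (-t))).im + t/2 with hf
    have him : (κ * Complex.I + Complex.log (1 - z ^ (2*N+1)) + ∑ j ∈ idx N,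
        (Complex.log (1 - z * pt (-x j)) - Complex.log (1 - z * pt (-(j * h))))).im =
        (Complex.log (1 - z ^ (2*N+1))).im + ∑ j ∈ idx N, (f (x j) - f (j * h)) := by
      have : ∑ j ∈ idx N, (f (x j) - f (j * h)) = (∑ j ∈ idx N,
          ((Complex.log (1 - z * pt (-x j))).im - (Complex.log (1 - z * pt (-(j * h)))).im)) + κ := by
        rw [hκ, sum_div, ← sum_add_distrib]
        exact sum_congr rfl fun j _ => by simp only [hf]; ring
      rw [this, Complex.add_im, Complex.add_im, Complex.im_sum]
      simp only [Complex.sub_im, Complex.mul_im, Complex.ofReal_re, Complex.I_im,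
        Complex.ofReal_im, Complex.I_re]
      ring
    rw [him]
    have h1 : |(Complex.log (1 - z ^ (2*N+1))).im| ≤ 3/2 * δ := by
      have hn : ‖-z ^ (2*N+1)‖ ≤ δ := by rw [norm_neg, norm_pow]; exact hε
      have := Complex.norm_log_one_add_half_le_self (hn.trans hδ2)
      rw [← sub_eq_add_neg] at this
      exact (Complex.abs_im_le_norm _).trans (this.trans (by gcongr))
    have h2 : |∑ j ∈ idx N, (f (x j) - f (j * h))| ≤ π * α * ((1+δ)^2 * ((1+δ)/(1-δ))) := by
      calc |∑ j ∈ idx N, (f (x j) - f (j * h))| ≤ ∑ j ∈ idx N, |f (x j) - f (j * h)| :=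
            abs_sum_le_sum_abs _ _
        _ ≤ ∑ j ∈ idx N, (1+δ)^2 * ((1 - ‖z‖^2) / ‖1 - z * pt (-(j * h))‖^2) / 2 * (α * h) := by
            refine sum_le_sum fun j hj => ?_
            refine (abs_im_log_sub_le hz' hδ0.le hδz ((hx j hj).trans ?_)).trans ?_
            · nlinarith
            · refine mul_le_mul_of_nonneg_left (hx j hj) ?_
              have : 0 ≤ 1 - ‖z‖^2 := by nlinarith
              positivity
        _ = (1+δ)^2 * (α * h) / 2 *
              ∑ j ∈ idx N, (1 - ‖z‖^2) / ‖1 - z * pt (-(j * h))‖^2 := by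
            rw [mul_sum]; exact sum_congr rfl fun j _ => by ring
        _ ≤ (1+δ)^2 * (α * h) / 2 * ((2*N+1) * ((1+δ)/(1-δ))) := by
            gcongr
            exact sum_poisson_grid_le N hz' hε (by linarith)
        _ = _ := by
            have := step_mul N
            linear_combination (1+δ)^2 * α / 2 * ((1+δ)/(1-δ)) * this
    calc _ ≤ |(Complex.log (1 - z ^ (2*N+1))).im| + |∑ j ∈ idx N, (f (x j) - f (j * h))| :=
          abs_add_le _ _
      _ < π * θ := by linarith

/-- Near a node, the node polynomial is comparable to its derivative times the step. -/
lemma exists_norm_nodePoly_le {α Y : ℝ} (hα : α < 1/2) (hY : 0 < Y) :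
    ∃ C : ℝ, 0 < C ∧ ∀ (N : ℕ) (x : ℤ → ℝ), (∀ j ∈ idx N, |x j - j * step N| ≤ α * step N) →
      ∀ j ∈ idx N, ‖nodePoly N x (Real.exp (-(2 * Y * step N)) * pt (x j))‖ ≤
        C * (step N * ∏ m ∈ (idx N).erase j, chord (x j) (x m)) := by
  have hpi := pi_pos
  obtain ⟨A, hA, hsum⟩ := exists_sum_cell_le (p := 2) (by norm_num)
  set c : ℝ := 2/π * (1 - 2*α) with hc
  have hc0 : 0 < c := mul_pos (by positivity) (by linarith)
  refine ⟨2 * Y * Real.exp (2 * Y^2 * ((1 + c⁻¹)^2 * A)), by positivity, ?_⟩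
  intro N x hx j hj
  have hh := step_pos N
  set h := step N with hhdef
  set σ : ℝ := Real.exp (-(2 * Y * h)) with hσ
  have hσ0 : 0 < σ := Real.exp_pos _
  have hσ1 : σ ≤ 1 := by rw [hσ, Real.exp_le_one_iff]; nlinarith
  have hσ2 : 1 - σ ≤ 2 * Y * h := by
    have := Real.add_one_le_exp (-(2 * Y * h)); linarith
  have hch : ∀ m ∈ (idx N).erase j, c * h ≤ chord (x j) (x m) := by
    intro m hm
    have := chord_node_ge hx hj (mem_of_mem_erase hm) (ne_of_mem_erase hm).symm
    rw [hc, mul_assoc]; exact this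
  have hfac : ∀ m ∈ (idx N).erase j, ‖1 - σ * pt (x j) * pt (-x m)‖ ≤
      chord (x j) (x m) * Real.exp (2 * Y^2 * ((1 + c⁻¹)^2 * cell N (x j) (x m) ^ (-2:ℝ))) := by
    intro m hm
    have h1 := hch m hm
    set d := chord (x j) (x m) with hd
    have hd0 : 0 < d := lt_of_lt_of_le (by positivity) h1
    have h2 : ‖1 - σ * pt (x j) * pt (-x m)‖ ^ 2 ≤ (1 - σ)^2 + d^2 := by
      rw [hd, ← norm_one_sub_pt_mul, mul_assoc, pt_neg_mul, ← Complex.normSq_eq_norm_sq,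
        ← Complex.normSq_eq_norm_sq]
      have h3 : Complex.normSq (pt (x j - x m)) = 1 := by
        rw [Complex.normSq_eq_norm_sq, norm_pt]; norm_num
      have h4 := (Complex.abs_re_le_norm (pt (x j - x m)))
      rw [norm_pt] at h4
      have h5 := (abs_le.1 h4).2
      simp only [Complex.normSq_apply, Complex.sub_re, Complex.sub_im, Complex.one_re,
        Complex.one_im, Complex.re_ofReal_mul, Complex.im_ofReal_mul] at h3 ⊢
      nlinarith
    have h3 : (1 - σ)^2 ≤ d^2 * (4 * Y^2 * ((1 + c⁻¹)^2 * cell N (x j) (x m) ^ (-2:ℝ))) := by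
      have e : cell N (x j) (x m) ^ (-2:ℝ) = (cell N (x j) (x m) ^ 2)⁻¹ := by
        rw [rpow_neg (cell_pos _ _ _).le]; norm_num
      have hcell : h * cell N (x j) (x m) ≤ (1 + c⁻¹) * d := by
        have : h * cell N (x j) (x m) = h + d := by
          rw [cell, ← hhdef, ← hd]; field_simp
        rw [this]
        have : h ≤ c⁻¹ * d := by rw [inv_mul_eq_div, le_div_iff₀ hc0]; linarith
        linarith
      have hp := cell_pos N (x j) (x m)
      have h4 : h ^ 2 ≤ ((1 + c⁻¹) * d)^2 * cell N (x j) (x m) ^ (-2:ℝ) := by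
        rw [e, ← div_eq_mul_inv, le_div_iff₀ (by positivity), ← mul_pow]
        gcongr
      calc (1 - σ)^2 ≤ (2 * Y * h)^2 := by gcongr
        _ = 4 * Y^2 * h^2 := by ring
        _ ≤ 4 * Y^2 * (((1 + c⁻¹) * d)^2 * cell N (x j) (x m) ^ (-2:ℝ)) := by gcongr
        _ = _ := by ring
    refine le_of_sq_le_sq ?_ (by positivity)
    set B := Y^2 * ((1 + c⁻¹)^2 * cell N (x j) (x m) ^ (-2:ℝ)) with hB
    have e2 : (d * Real.exp (2 * Y^2 * ((1 + c⁻¹)^2 * cell N (x j) (x m) ^ (-2:ℝ))))^2 =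
        d^2 * Real.exp (4 * B) := by
      rw [mul_pow, ← Real.exp_nat_mul, hB]; congr 2; push_cast; ring
    rw [e2]
    have h6 := Real.add_one_le_exp (4 * B)
    have h7 : d^2 * (4 * B + 1) ≤ d^2 * Real.exp (4 * B) := by gcongr
    have h8 : 4 * Y^2 * ((1 + c⁻¹)^2 * cell N (x j) (x m) ^ (-2:ℝ)) = 4 * B := by rw [hB]; ring
    rw [h8] at h3
    linarith
  have hxh : ∀ j ∈ idx N, |x j - j * step N| ≤ step N := fun i hi =>
    (hx i hi).trans (by nlinarith)
  have hprod0 : 0 ≤ ∏ m ∈ (idx N).erase j, chord (x j) (x m) :=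
    prod_nonneg fun m _ => chord_nonneg _ _
  have hself : ‖1 - σ * pt (x j) * pt (-x j)‖ = 1 - σ := by
    rw [mul_assoc, pt_neg_mul, sub_self, pt_zero, mul_one, ← Complex.ofReal_one,
      ← Complex.ofReal_sub, Complex.norm_real, Real.norm_of_nonneg (by linarith)]
  rw [nodePoly, norm_prod, ← mul_prod_erase _ _ hj, hself]
  calc (1 - σ) * ∏ m ∈ (idx N).erase j, ‖1 - σ * pt (x j) * pt (-x m)‖
      ≤ (2 * Y * h) * ∏ m ∈ (idx N).erase j, (chord (x j) (x m) *
        Real.exp (2 * Y^2 * ((1 + c⁻¹)^2 * cell N (x j) (x m) ^ (-2:ℝ)))) := by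
        exact mul_le_mul hσ2 (prod_le_prod (fun m _ => norm_nonneg _) hfac)
          (prod_nonneg fun m _ => norm_nonneg _) (by positivity)
    _ = (2 * Y * h) * ((∏ m ∈ (idx N).erase j, chord (x j) (x m)) *
        Real.exp (2 * Y^2 * ((1 + c⁻¹)^2 * ∑ m ∈ (idx N).erase j,
          cell N (x j) (x m) ^ (-2:ℝ)))) := by
        rw [prod_mul_distrib, ← Real.exp_sum]; simp only [mul_sum]
    _ ≤ (2 * Y * h) * ((∏ m ∈ (idx N).erase j, chord (x j) (x m)) *
        Real.exp (2 * Y^2 * ((1 + c⁻¹)^2 * A))) := by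
        gcongr
        refine (sum_le_sum_of_subset_of_nonneg (erase_subset _ _) fun m _ _ => ?_).trans
          (hsum N x hxh (x j))
        exact rpow_nonneg (cell_pos _ _ _).le _
    _ = _ := by ring

/-! ### Interpolation at the nodes -/

/-- The algebraic polynomial attached to a trigonometric polynomial. -/
noncomputable def trigPoly (N : ℕ) (c : ℤ → ℂ) : Polynomial ℂ :=
  ∑ k ∈ idx N, Polynomial.monomial (k + N).toNat (c k)

lemma eval_trigPoly (N : ℕ) (c : ℤ → ℂ) (w : ℂ) :
    (trigPoly N c).eval (Complex.exp (Complex.I * w)) =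
      trig N c w * Complex.exp (Complex.I * w) ^ N := by
  rw [trigPoly, Polynomial.eval_finsetSum, trig, sum_mul]
  refine sum_congr rfl fun k hk => ?_
  have hk' := mem_Icc.1 hk
  have e : (((k + N).toNat : ℕ) : ℂ) = k + N := by
    have h : (((k + N).toNat : ℕ) : ℤ) = k + N := Int.toNat_of_nonneg (by omega)
    exact_mod_cast congrArg (Int.cast : ℤ → ℂ) h
  rw [Polynomial.eval_monomial, ← Complex.exp_nat_mul, ← Complex.exp_nat_mul, mul_assoc,
    ← Complex.exp_add, e]
  congr 2; ring

lemma degree_trigPoly_lt (N : ℕ) (c : ℤ → ℂ) : (trigPoly N c).degree < (idx N).card := by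
  refine lt_of_le_of_lt (Polynomial.degree_sum_le _ _) ?_
  rw [Finset.sup_lt_iff (WithBot.bot_lt_coe _)]
  intro k hk
  refine (Polynomial.degree_monomial_le _ _).trans_lt ?_
  have hk' := mem_Icc.1 hk
  rw [card_idx]
  exact_mod_cast (by omega : (k + N).toNat < 2*N+1)

lemma exp_I_mul (t : ℝ) : Complex.exp (Complex.I * t) = pt t := by rw [pt, mul_comm]

lemma exp_I_mul_add (t y : ℝ) :
    Complex.exp (Complex.I * (t + y * Complex.I)) = Real.exp (-y) * pt t := by
  rw [pt, Complex.ofReal_exp, ← Complex.exp_add]; congr 1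
  push_cast
  linear_combination (y : ℂ) * Complex.I_mul_I

lemma injOn_pt_nodes {N : ℕ} {α : ℝ} {x : ℤ → ℝ} (hα : α < 1/2)
    (hx : ∀ j ∈ idx N, |x j - j * step N| ≤ α * step N) :
    Set.InjOn (fun j => pt (x j)) (idx N) := by
  intro i hi j hj hij
  by_contra hne
  have h1 := chord_node_ge hx hi hj hne
  have hij' : pt (x i) = pt (x j) := hij
  rw [chord, hij', sub_self, norm_zero] at h1
  have : 0 < 2/π * ((1 - 2*α) * step N) :=
    mul_pos (by have := pi_pos; positivity) (mul_pos (by linarith) (step_pos N))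
  linarith

/-- Lagrange interpolation at the nodes. -/
lemma trig_eq_interpolate {N : ℕ} {α : ℝ} {x : ℤ → ℝ} (hα : α < 1/2)
    (hx : ∀ j ∈ idx N, |x j - j * step N| ≤ α * step N) (c : ℤ → ℂ) (w : ℂ)
    (hw : ∀ j ∈ idx N, Complex.exp (Complex.I * w) ≠ pt (x j)) :
    trig N c w * Complex.exp (Complex.I * w) ^ N =
      (∏ j ∈ idx N, (Complex.exp (Complex.I * w) - pt (x j))) *
        ∑ j ∈ idx N, (∏ m ∈ (idx N).erase j, (pt (x j) - pt (x m)))⁻¹ * trig N c (x j) *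
          pt (x j) ^ N * (Complex.exp (Complex.I * w) - pt (x j))⁻¹ := by
  have h := Lagrange.eq_interpolate (f := trigPoly N c) (injOn_pt_nodes hα hx)
    (degree_trigPoly_lt N c)
  rw [← eval_trigPoly, h, Lagrange.eval_interpolate_not_at_node _ hw, Lagrange.eval_nodal]
  congr 1
  refine sum_congr rfl fun j _ => ?_
  rw [Lagrange.nodalWeight, prod_inv_distrib, ← exp_I_mul (x j), eval_trigPoly]
  ring

lemma norm_prod_sub_pt (N : ℕ) (x : ℤ → ℝ) (z : ℂ) :
    ‖∏ j ∈ idx N, (z - pt (x j))‖ = ‖nodePoly N x z‖ := by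
  rw [nodePoly, norm_prod, norm_prod]
  refine prod_congr rfl fun j _ => ?_
  have : z - pt (x j) = -(pt (x j) * (1 - z * pt (-x j))) := by
    have h : pt (x j) * pt (-x j) = 1 := by rw [pt_neg_mul, sub_self, pt_zero]
    linear_combination -z * h
  rw [this, norm_neg, norm_mul, norm_pt, one_mul]

lemma norm_nodePoly_inv (N : ℕ) (x : ℤ → ℝ) {R : ℝ} (hR : 0 < R) (t : ℝ) :
    ‖nodePoly N x (R * pt t)‖ = R ^ (2*N+1) * ‖nodePoly N x ((R⁻¹ : ℝ) * pt t)‖ := by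
  rw [nodePoly, nodePoly, norm_prod, norm_prod, ← card_idx N, ← prod_const, ← prod_mul_distrib]
  refine prod_congr rfl fun j _ => ?_
  rw [mul_assoc, mul_assoc, pt_neg_mul]
  set u := t - x j
  have h : pt u * (starRingEnd ℂ) (pt u) = 1 := by
    rw [Complex.mul_conj, Complex.normSq_eq_norm_sq, norm_pt]; norm_num
  have e : 1 - R * pt u = -(R * pt u) * (starRingEnd ℂ) (1 - (R⁻¹ : ℝ) * pt u) := by
    have hR' : (R : ℂ) * (R : ℂ)⁻¹ = 1 := mul_inv_cancel₀ (by exact_mod_cast hR.ne')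
    rw [map_sub, map_one, map_mul, Complex.conj_ofReal, Complex.ofReal_inv]
    linear_combination (-(R : ℂ) * (R : ℂ)⁻¹) * h - hR'
  rw [e, norm_mul, RCLike.norm_conj, norm_neg, norm_mul, norm_pt, mul_one, Complex.norm_real,
    Real.norm_of_nonneg hR.le]

lemma exists_sum_cell_two_mul_le {p : ℝ} (hp : 1 < p) :
    ∃ C : ℝ, 0 < C ∧ ∀ (N : ℕ) (t : ℝ),
      ∑ j ∈ idx (2*N), cell N t (j * step (2*N)) ^ (-p) ≤ C := by
  obtain ⟨C, hC, hsum⟩ := exists_sum_cell_le hp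
  refine ⟨2 ^ p * C, by positivity, fun N t => ?_⟩
  refine le_trans ?_ (mul_le_mul_of_nonneg_left (hsum (2*N) (fun j => j * step (2*N))
    (fun j _ => by simp [(step_pos _).le]) t) (by positivity))
  rw [mul_sum]
  refine sum_le_sum fun j _ => ?_
  have h1 := cell_two_mul_le N t (j * step (2*N))
  have h2 := cell_pos N t (j * step (2*N))
  have h3 := cell_pos (2*N) t (j * step (2*N))
  calc cell N t (j * step (2*N)) ^ (-p) = 2 ^ p * (2 * cell N t (j * step (2*N))) ^ (-p) := by
        rw [mul_rpow (by norm_num) h2.le, ← mul_assoc, ← rpow_add (by norm_num), add_neg_cancel,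
          rpow_zero, one_mul]
    _ ≤ _ := by
        refine mul_le_mul_of_nonneg_left ?_ (by positivity)
        exact rpow_le_rpow_of_nonpos h3 h1 (by linarith)

/-- The norm of a trigonometric polynomial on a horizontal line controls its norm on the real
line. -/
lemma exists_integral_trig_le_shift {r B : ℝ} (hr : 1 ≤ r) :
    ∃ C : ℝ, 0 < C ∧ ∀ (N : ℕ) (c : ℤ → ℂ) (y : ℝ), |y| ≤ B * step N →
      ∫ t in (-π)..π, ‖trig N c t‖ ^ r ≤
        C * ∫ t in (-π)..π, ‖trig N c (t + y * Complex.I)‖ ^ r := by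
  obtain ⟨A, hA, hsum⟩ := exists_sum_cell_two_mul_le (p := 2) (by norm_num)
  obtain ⟨C₁, hC₁, h1⟩ := exists_integral_trig_le (B := B) hr
  obtain ⟨C₂, hC₂, h2⟩ := exists_sum_trig_le hr A
  refine ⟨C₁ * C₂, by positivity, fun N c y hy => ?_⟩
  have e : ∀ w : ℂ, trig N c (w + y * Complex.I) =
      trig N (fun k => c k * Complex.exp (Complex.I * k * (y * Complex.I))) w := by
    intro w
    refine sum_congr rfl fun k _ => ?_
    rw [mul_assoc (c k), ← Complex.exp_add]; congr 2; ring
  refine (h1 N c y hy).trans ?_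
  rw [mul_assoc]
  refine mul_le_mul_of_nonneg_left ?_ hC₁.le
  simp only [e]
  exact h2 N (idx (2*N)) (fun j => j * step (2*N)) (hsum N) _

/-! ### The lower inequality -/

lemma prod_chord_pos {N : ℕ} {α : ℝ} {x : ℤ → ℝ} (hα : α < 1/2)
    (hx : ∀ j ∈ idx N, |x j - j * step N| ≤ α * step N) {j : ℤ} (hj : j ∈ idx N) :
    0 < ∏ m ∈ (idx N).erase j, chord (x j) (x m) := by
  refine prod_pos fun m hm => ?_
  refine lt_of_lt_of_le ?_ (chord_node_ge hx hj (mem_of_mem_erase hm) (ne_of_mem_erase hm).symm)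
  exact mul_pos (by have := pi_pos; positivity) (mul_pos (by linarith) (step_pos N))

lemma exists_integral_le_sum_of_le_two {r α : ℝ} (hr : 1 < r) (hr2 : r ≤ 2) (hα0 : 0 ≤ α)
    (hα : α < (r-1)/(2*r)) :
    ∃ C : ℝ, 0 < C ∧ ∀ (N : ℕ) (x : ℤ → ℝ), (∀ j ∈ idx N, |x j - j * step N| ≤ α * step N) →
      ∀ c : ℤ → ℂ, ∫ t in (-π)..π, ‖trig N c t‖ ^ r ≤
        C * (step N * ∑ j ∈ idx N, ‖trig N c (x j)‖ ^ r) := by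
  have hpi := pi_pos
  have hr0 : 0 < r := by linarith
  obtain ⟨θ, hαθ, hθ⟩ := exists_between hα
  have hθr : (r-1)/(2*r) ≤ 1/4 := by rw [div_le_div_iff₀ (by positivity) (by norm_num)]; linarith
  have hα2 : α < 1/2 := by linarith
  obtain ⟨Y, hY, hlog⟩ := exists_log_nodePoly hα0 (by linarith) hαθ
  have hφ0 : 0 ≤ π * θ := by have := hα0.trans hαθ.le; positivity
  have hφ : r * (π * θ) < (r-1)*π/2 := by
    rw [lt_div_iff₀ (by positivity)] at hθ; nlinarith
  have hp : 1 < 2 - 4*(π*θ)/π := by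
    have : 4*(π*θ)/π = 4*θ := by field_simp
    rw [this]; linarith
  obtain ⟨A, hA, hsum⟩ := exists_sum_cell_le hp
  obtain ⟨C₁, hC₁, hshift⟩ := exists_integral_trig_le_shift (r := r) (B := 2*Y) hr.le
  obtain ⟨C₂, hC₂, hcauchy⟩ := exists_integral_cauchy_le (A := A) hr hr2 hφ0 hφ hY
  obtain ⟨C₃, hC₃, hloc⟩ := exists_norm_nodePoly_le (Y := Y) hα2 (by linarith)
  refine ⟨C₁ * (Real.exp (2*π*Y) ^ r * (C₂ * C₃ ^ r)), by positivity, ?_⟩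
  intro N x hx c
  have hh := step_pos N
  obtain ⟨L, hL, hLP, him⟩ := hlog N x hx
  set σ : ℝ := Real.exp (-(2 * Y * step N)) with hσ
  have hσ0 : 0 < σ := Real.exp_pos _
  have hσ1 : σ < 1 := by
    rw [hσ, Real.exp_lt_one_iff]; nlinarith
  refine (hshift N c (2 * Y * step N) (by rw [abs_of_nonneg (by positivity)])).trans ?_
  rw [mul_assoc C₁]
  refine mul_le_mul_of_nonneg_left ?_ hC₁.le
  set D : ℤ → ℝ := fun j => ∏ m ∈ (idx N).erase j, chord (x j) (x m) with hD
  have hD0 : ∀ j ∈ idx N, 0 < D j := fun j hj => prod_chord_pos hα2 hx hj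
  set β : ℤ → ℂ := fun j => (∏ m ∈ (idx N).erase j, (pt (x j) - pt (x m)))⁻¹ * trig N c (x j) *
    pt (x j) ^ N * (pt (x j))⁻¹ with hβ
  have hβn : ∀ j, ‖β j‖ = ‖trig N c (x j)‖ / D j := by
    intro j
    simp only [hβ, hD, norm_mul, norm_inv, norm_prod, norm_pow, norm_pt, chord]
    simp; ring
  have hzball : ∀ t : ℝ, (σ * pt t : ℂ) ∈ Metric.ball (0:ℂ) 1 := by
    intro t; simp [abs_of_pos hσ0, hσ1]
  have hexp : ∀ t : ℝ, Complex.exp (Complex.I * (t + (2 * Y * step N : ℝ) * Complex.I)) =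
      σ * pt t := by
    intro t
    rw [exp_I_mul_add, hσ]
  have hpoint : ∀ t : ℝ, ‖trig N c (t + (2 * Y * step N : ℝ) * Complex.I)‖ ^ r ≤
      Real.exp (2*π*Y) ^ r * (‖∑ m ∈ idx N, β m * ((1:ℝ) * pt (x m)) / ((1:ℝ) * pt (x m) -
          σ * pt t)‖ ^ r * Real.exp (r * (L (σ * pt t)).re)) := by
    intro t
    have hne : ∀ j ∈ idx N, Complex.exp (Complex.I * (t + (2 * Y * step N : ℝ) * Complex.I)) ≠
        pt (x j) := by
      intro j _ h
      rw [hexp] at h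
      have := congrArg norm h
      rw [norm_mul, norm_pt, norm_pt, mul_one, Complex.norm_real, Real.norm_of_nonneg hσ0.le] at this
      linarith
    have h1 := congrArg norm (trig_eq_interpolate hα2 hx c _ hne)
    have hs : ‖∑ j ∈ idx N, (∏ m ∈ (idx N).erase j, (pt (x j) - pt (x m)))⁻¹ * trig N c (x j) *
          pt (x j) ^ N * (σ * pt t - pt (x j))⁻¹‖ = ‖∑ m ∈ idx N, β m * ((1:ℝ) * pt (x m)) /
          ((1:ℝ) * pt (x m) - σ * pt t)‖ := by
      rw [← norm_neg, ← sum_neg_distrib]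
      congr 1
      refine sum_congr rfl fun j _ => ?_
      simp only [hβ, Complex.ofReal_one, one_mul]
      rw [inv_mul_cancel_right₀ (pt_ne_zero _), ← neg_sub (pt (x j)), inv_neg, mul_neg, neg_neg,
        div_eq_mul_inv]
    rw [hexp, norm_mul, norm_mul, norm_prod_sub_pt, ← hLP _ (hzball t), hs, norm_pow, norm_mul,
      norm_pt, mul_one, Complex.norm_real, Real.norm_of_nonneg hσ0.le] at h1
    set T := ‖trig N c (t + (2 * Y * step N : ℝ) * Complex.I)‖ with hT
    have hσN : 1 ≤ Real.exp (2*π*Y) * σ ^ N := by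
      rw [hσ, ← Real.exp_nat_mul, ← Real.exp_add]
      refine Real.one_le_exp ?_
      have := step_mul N
      nlinarith [mul_pos (by linarith : 0 < Y) hh, (Nat.cast_nonneg N : (0:ℝ) ≤ N)]
    have h2 : T ≤ Real.exp (2*π*Y) * (‖∑ m ∈ idx N, β m * ((1:ℝ) * pt (x m)) /
        ((1:ℝ) * pt (x m) - σ * pt t)‖ * Real.exp (L (σ * pt t)).re) := by
      rw [mul_comm ‖_‖, ← h1]
      calc T = T * 1 := (mul_one T).symm
        _ ≤ T * (Real.exp (2*π*Y) * σ ^ N) := by gcongr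
        _ = _ := by ring
    refine (rpow_le_rpow (norm_nonneg _) h2 hr0.le).trans_eq ?_
    rw [mul_rpow (by positivity) (by positivity), mul_rpow (by positivity) (by positivity),
      ← Real.exp_mul (L _).re, mul_comm r]
  have hmain := hcauchy N L hL him 1 (idx N) x le_rfl (Real.one_le_exp (by positivity))
    (hsum N x fun j hj => (hx j hj).trans (by nlinarith)) β
  have cT : Continuous fun t : ℝ => ‖trig N c (t + (2 * Y * step N : ℝ) * Complex.I)‖ ^ r := by
    refine Continuous.rpow_const (Continuous.norm ?_) fun t => Or.inr hr0.le
    unfold trig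
    fun_prop
  have hden : ∀ (m : ℤ) (t : ℝ), ((1:ℝ) * pt (x m) - σ * pt t : ℂ) ≠ 0 := by
    intro m t h
    have h2 := congrArg norm (sub_eq_zero.1 h)
    simp only [norm_mul, norm_pt, Complex.norm_real, mul_one, Real.norm_eq_abs, abs_one] at h2
    rw [abs_of_pos hσ0] at h2
    linarith
  have cR : Continuous fun t : ℝ => ‖∑ m ∈ idx N, β m * ((1:ℝ) * pt (x m)) / ((1:ℝ) * pt (x m) -
          σ * pt t)‖ ^ r * Real.exp (r * (L (σ * pt t)).re) := by
    refine Continuous.mul (Continuous.rpow_const (Continuous.norm ?_) fun t => Or.inr hr0.le)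
      (continuous_const.mul (Complex.continuous_re.comp (continuous_disc hσ0 hσ1 hL))).rexp
    exact continuous_finsetSum _ fun m _ => continuous_const.div
      (continuous_const.sub (continuous_const.mul continuous_pt)) (hden m)
  calc _ ≤ ∫ t in (-π)..π, Real.exp (2*π*Y) ^ r * (‖∑ m ∈ idx N, β m * ((1:ℝ) * pt (x m)) /
          ((1:ℝ) * pt (x m) - σ * pt t)‖ ^ r * Real.exp (r * (L (σ * pt t)).re)) :=
        intervalIntegral.integral_mono_on (by linarith) (cT.intervalIntegrable _ _)
          ((continuous_const.mul cR).intervalIntegrable _ _) fun t _ => hpoint t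
    _ ≤ Real.exp (2*π*Y) ^ r * (C₂ * (step N ^ (1 - r) * ∑ m ∈ idx N, ‖β m‖ ^ r *
          Real.exp (r * (L (σ * pt (x m))).re))) := by
        rw [intervalIntegral.integral_const_mul]
        exact mul_le_mul_of_nonneg_left hmain (by positivity)
    _ ≤ Real.exp (2*π*Y) ^ r * (C₂ * (step N ^ (1 - r) * ∑ m ∈ idx N,
          (C₃ * step N) ^ r * ‖trig N c (x m)‖ ^ r)) := by
        refine mul_le_mul_of_nonneg_left (mul_le_mul_of_nonneg_left (mul_le_mul_of_nonneg_left
          (sum_le_sum fun m hm => ?_) (by positivity)) hC₂.le) (by positivity)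
        have h1 : Real.exp (L (σ * pt (x m))).re ≤ C₃ * (step N * D m) :=
          (hLP _ (hzball _)).trans_le (hloc N x hx m hm)
        have hd := hD0 m hm
        rw [hβn, mul_comm r, Real.exp_mul, ← mul_rpow (by positivity) (by positivity),
          ← mul_rpow (by positivity) (by positivity)]
        refine rpow_le_rpow (by positivity) ?_ hr0.le
        calc ‖trig N c (x m)‖ / D m * Real.exp (L (σ * pt (x m))).re ≤
            ‖trig N c (x m)‖ / D m * (C₃ * (step N * D m)) := by gcongr
          _ = _ := by field_simp
    _ = _ := by
        rw [← mul_sum, mul_rpow hC₃.le hh.le, rpow_sub hh, rpow_one]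
        field_simp

lemma add_rpow_le {a b s : ℝ} (ha : 0 ≤ a) (hb : 0 ≤ b) (hs : 0 ≤ s) :
    (a + b) ^ s ≤ 2 ^ s * (a ^ s + b ^ s) := by
  have h : ∀ {u v : ℝ}, 0 ≤ u → u ≤ v → (u + v) ^ s ≤ 2 ^ s * v ^ s := fun {u v} hu huv => by
    rw [← mul_rpow (by norm_num) (hu.trans huv)]
    exact rpow_le_rpow (by linarith) (by linarith) hs
  have ha' := rpow_nonneg ha s
  have hb' := rpow_nonneg hb s
  have h2 : (0:ℝ) < 2 ^ s := by positivity
  rcases le_total a b with hab | hab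
  · exact (h ha hab).trans (mul_le_mul_of_nonneg_left (by linarith) h2.le)
  · rw [add_comm a b]
    exact (h hb hab).trans (mul_le_mul_of_nonneg_left (by linarith) h2.le)

/-- Discrete version of the weighted bound for Cauchy-type sums. -/
lemma exists_sum_cauchy_le {s φ Y A : ℝ} (hs : 1 < s) (hs2 : s ≤ 2)
    (hφ0 : 0 ≤ φ) (hφ : s * φ < (s-1)*π/2) (hY : 1 ≤ Y) :
    ∃ C : ℝ, 0 < C ∧ ∀ (N : ℕ) (L : ℂ → ℂ), DifferentiableOn ℂ L (Metric.ball 0 1) →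
      (∀ z ∈ Metric.ball (0:ℂ) (Real.exp (-(Y * step N))), |(L z).im| < φ) →
      ∀ (x : ℤ → ℝ), (∀ j ∈ idx N, |x j - j * step N| ≤ step N) →
      ∀ (S : Finset ℤ) (y : ℤ → ℝ),
      (∀ t, ∑ m ∈ S, cell N t (y m) ^ (-(2 - 4*φ/π)) ≤ A) → ∀ β : ℤ → ℂ,
      ∑ j ∈ idx N, ‖∑ m ∈ S, β m * (Real.exp (2 * Y * step N) * pt (y m)) /
          (Real.exp (2 * Y * step N) * pt (y m) - pt (x j))‖ ^ s *
          Real.exp (s * (L (Real.exp (-(2 * Y * step N)) * pt (x j))).re) ≤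
        C * (step N ^ (-s) * ∑ m ∈ S, ‖β m‖ ^ s *
          Real.exp (s * (L (Real.exp (-(2 * Y * step N)) * pt (y m))).re)) := by
  have hpi := pi_pos
  have hs0 : 0 < s := by linarith
  have hφ1 : φ < π/4 := by
    have : s * φ < s * (π/4) := by nlinarith
    exact lt_of_mul_lt_mul_left this hs0.le
  obtain ⟨C₁, hC₁, hcauchy⟩ := exists_integral_cauchy_le (A := A) hs hs2 hφ0 hφ hY
  obtain ⟨C₂, hC₂, hpois⟩ := exists_integral_poisson_le (A := A) hs hφ1 hY
  set K : ℝ := 600 * (1 + Y) with hK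
  have hK0 : 0 < K := by positivity
  refine ⟨48 ^ s * 2 ^ s * (C₁ + K ^ s * C₂), by positivity, ?_⟩
  intro N L hL him x hx S y hA β
  have hh := step_pos N
  set σ : ℝ := Real.exp (-(2 * Y * step N)) with hσ
  set R : ℝ := Real.exp (2 * Y * step N) with hR
  have hR1 : 1 ≤ R := Real.one_le_exp (by positivity)
  have hRσ : R * σ = 1 := by rw [hR, hσ, ← Real.exp_add]; simp
  have hσ0 : 0 < σ := Real.exp_pos _
  have hσ8 : σ ≤ 1 - step N / 8 := by linarith [step_le_one_sub_exp (N := N) hY]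
  have hσ1 : σ < 1 := by linarith
  have hσ2 : 1 - σ ≤ 2 * Y * step N := by
    have := Real.add_one_le_exp (-(2 * Y * step N)); linarith
  set W : ℝ → ℝ := fun t => Real.exp (L (σ * pt t)).re with hW
  have hW0 : ∀ t, 0 < W t := fun t => Real.exp_pos _
  have hWs : ∀ t : ℝ, Real.exp (s * (L (σ * pt t)).re) = W t ^ s := fun t => by
    rw [hW, mul_comm, Real.exp_mul]
  have cW : Continuous W := (Complex.continuous_re.comp (continuous_disc hσ0 hσ1 hL)).rexp
  set f : ℂ → ℂ := fun z => ∑ m ∈ S, β m * (R * pt (y m)) / (R * pt (y m) - z) with hf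
  set G : ℝ → ℝ := fun t => (step N)⁻¹ * ∑ m ∈ S, cell N t (y m) ^ (-2:ℝ) * ‖β m‖ with hG
  have hG0 : ∀ t, 0 ≤ G t := fun t => mul_nonneg (by positivity) (sum_nonneg fun m _ =>
    mul_nonneg (rpow_nonneg (cell_pos _ _ _).le _) (norm_nonneg _))
  have hden : ∀ (m : ℤ) (t : ℝ), (R * pt (y m) - σ * pt t : ℂ) ≠ 0 := by
    intro m t h
    have h2 := congrArg norm (sub_eq_zero.1 h)
    simp only [norm_mul, norm_pt, Complex.norm_real, mul_one, Real.norm_eq_abs] at h2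
    rw [abs_of_pos (by linarith), abs_of_pos hσ0] at h2
    linarith
  have cf : Continuous fun t : ℝ => f (σ * pt t) :=
    continuous_finsetSum _ fun m _ => continuous_const.div
      (continuous_const.sub (continuous_const.mul continuous_pt)) (hden m)
  have cG : Continuous G := continuous_const.mul (continuous_finsetSum _ fun m _ =>
    ((continuous_cell N (y m)).rpow_const fun t => Or.inl (cell_pos N t (y m)).ne').mul
      continuous_const)
  have hnear : ∀ j ∈ idx N, ∀ t : ℝ, |t - x j| ≤ 2 * step N →
      ‖f (pt (x j))‖ ^ s * W (x j) ^ s ≤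
        48 ^ s * (2 ^ s * (‖f (σ * pt t)‖ ^ s * W t ^ s + K ^ s * (G t ^ s * W t ^ s))) := by
    intro j hj t ht
    have hchord : chord t (x j) ≤ 2 * step N := (chord_le_abs _ _).trans ht
    have hcell3 : cell N (x j) t ≤ 3 := by
      rw [cell_comm, cell]
      have : chord t (x j) / step N ≤ 2 := by rw [div_le_iff₀ hh]; exact hchord
      linarith
    have hWle : W (x j) ≤ 48 * W t := by
      refine (exp_re_le_cell hY hL hφ1.le him t (x j)).trans ?_
      have h4 : 4*φ/π ≤ 1 := by rw [div_le_one hpi]; linarith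
      have : cell N (x j) t ^ (4*φ/π) ≤ 3 := by
        refine (rpow_le_rpow_of_exponent_le (one_le_cell _ _ _) h4).trans ?_
        rw [rpow_one]; exact hcell3
      have := (hW0 t).le
      simp only [hW]
      nlinarith
    have hdiff : ‖f (pt (x j)) - f (σ * pt t)‖ ≤ K * G t := by
      rw [hf, ← sum_sub_distrib]
      refine (norm_sum_le _ _).trans ?_
      rw [hG, ← mul_assoc, mul_sum]
      refine sum_le_sum fun m _ => ?_
      have h1 := step_mul_cell_le hσ0.le hσ8 hR1 t (y m)
      have h2 := step_mul_cell_le hσ0.le hσ8 le_rfl (x j) (y m)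
      have hc := cell_pos N t (y m)
      have h3 : cell N t (y m) ≤ 3 * cell N (x j) (y m) := by
        have h5 := chord_triangle t (x j) (y m)
        have h6 := chord_nonneg (x j) (y m)
        unfold cell
        have : chord t (y m) / step N ≤ 2 + chord (x j) (y m) / step N := by
          rw [div_le_iff₀ hh, add_mul, div_mul_cancel₀ _ hh.ne']; linarith
        have : 0 ≤ chord (x j) (y m) / step N := by positivity
        linarith
      have e1 : (R * pt (y m) - pt (x j) : ℂ) = R * ((1:ℝ) * pt (y m) - σ * pt (x j)) := by
        have : (R:ℂ) * σ = 1 := by exact_mod_cast hRσ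
        push_cast
        linear_combination pt (x j) * this
      have hn1 : ‖(R * pt (y m) - pt (x j) : ℂ)‖ =
          R * ‖((1:ℝ) * pt (y m) - σ * pt (x j) : ℂ)‖ := by
        rw [e1, norm_mul, Complex.norm_real, Real.norm_of_nonneg (by linarith)]
      set a := ‖((1:ℝ) * pt (y m) - σ * pt (x j) : ℂ)‖ with ha
      set b := ‖(R * pt (y m) - σ * pt t : ℂ)‖ with hb
      have ha0 : 0 < a := by nlinarith [mul_pos hh (cell_pos N (x j) (y m))]
      have hb0 : 0 < b := by nlinarith [mul_pos hh hc]
      have hne1 : (R * pt (y m) - pt (x j) : ℂ) ≠ 0 := by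
        rw [← norm_pos_iff, hn1]; positivity
      have e2 : β m * (R * pt (y m)) / (R * pt (y m) - pt (x j)) -
          β m * (R * pt (y m)) / (R * pt (y m) - σ * pt t) =
          β m * (R * pt (y m)) * (pt (x j) - σ * pt t) /
            ((R * pt (y m) - pt (x j)) * (R * pt (y m) - σ * pt t)) := by
        have := hden m t
        field_simp
        ring
      have h4 : ‖(pt (x j) - σ * pt t : ℂ)‖ ≤ 2 * (1 + Y) * step N := by
        have e3 : (pt (x j) - σ * pt t : ℂ) = (pt (x j) - pt t) + ((1 - σ : ℝ) : ℂ) * pt t := by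
          push_cast; ring
        rw [e3]
        refine (norm_add_le _ _).trans ?_
        rw [norm_mul, norm_pt, mul_one, Complex.norm_real, Real.norm_of_nonneg (by linarith)]
        have : ‖pt (x j) - pt t‖ ≤ 2 * step N := by
          have := hchord; rw [chord_comm] at this; exact this
        linarith
      have hab : (step N * cell N t (y m)) ^ 2 ≤ 300 * (a * b) := by
        have hx3 : step N * cell N t (y m) ≤ 30 * a := by nlinarith
        have h0 : 0 ≤ step N * cell N t (y m) := by positivity
        calc (step N * cell N t (y m)) ^ 2 = (step N * cell N t (y m)) * (step N * cell N t (y m)) :=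
              sq _
          _ ≤ (30 * a) * (10 * b) := mul_le_mul hx3 h1 h0 (by positivity)
          _ = _ := by ring
      have ecell : cell N t (y m) ^ (-2:ℝ) = (cell N t (y m) ^ 2)⁻¹ := by
        rw [rpow_neg hc.le]; norm_num
      rw [e2, norm_div, norm_mul, norm_mul, norm_mul, norm_mul, norm_pt, mul_one, hn1,
        Complex.norm_real, Real.norm_of_nonneg (by linarith : 0 ≤ R), ecell,
        div_le_iff₀ (by positivity)]
      calc ‖β m‖ * R * ‖(pt (x j) - σ * pt t : ℂ)‖ ≤ ‖β m‖ * R * (2 * (1 + Y) * step N) := by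
            gcongr
        _ ≤ ‖β m‖ * R * (2 * (1 + Y) * step N) * (300 * (a * b) /
              (step N * cell N t (y m)) ^ 2) := by
            refine le_mul_of_one_le_right (by positivity) ?_
            rw [one_le_div (by positivity)]; exact hab
        _ = _ := by rw [hK]; field_simp; ring
    have hfle : ‖f (pt (x j))‖ ≤ ‖f (σ * pt t)‖ + K * G t := by
      have := norm_le_norm_add_norm_sub' (f (pt (x j))) (f (σ * pt t))
      linarith
    calc ‖f (pt (x j))‖ ^ s * W (x j) ^ s
        ≤ (‖f (σ * pt t)‖ + K * G t) ^ s * (48 * W t) ^ s := by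
          exact mul_le_mul (rpow_le_rpow (norm_nonneg _) hfle hs0.le)
            (rpow_le_rpow (hW0 _).le hWle hs0.le) (rpow_nonneg (hW0 _).le _)
            (rpow_nonneg (add_nonneg (norm_nonneg _) (mul_nonneg hK0.le (hG0 t))) _)
      _ ≤ (2 ^ s * (‖f (σ * pt t)‖ ^ s + (K * G t) ^ s)) * (48 * W t) ^ s := by
          have := hW0 t
          gcongr
          exact add_rpow_le (norm_nonneg _) (mul_nonneg hK0.le (hG0 t)) hs0.le
      _ = _ := by
          rw [mul_rpow hK0.le (hG0 t), mul_rpow (by norm_num) (hW0 t).le]; ring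
  set F : ℝ → ℝ := fun t => 48 ^ s * (2 ^ s * (‖f (σ * pt t)‖ ^ s * W t ^ s +
    K ^ s * (G t ^ s * W t ^ s))) with hF
  have cWs : Continuous fun t => W t ^ s := cW.rpow_const fun t => Or.inr hs0.le
  have cF1 : Continuous fun t : ℝ => ‖f (σ * pt t)‖ ^ s * W t ^ s :=
    (cf.norm.rpow_const fun t => Or.inr hs0.le).mul cWs
  have cF2 : Continuous fun t : ℝ => G t ^ s * W t ^ s :=
    (cG.rpow_const fun t => Or.inr hs0.le).mul cWs
  have cF3 : Continuous fun t : ℝ => K ^ s * (G t ^ s * W t ^ s) := continuous_const.mul cF2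
  have cF : Continuous F := by
    rw [hF]
    exact continuous_const.mul (continuous_const.mul (cF1.add cF3))
  have pF : Function.Periodic F (2*π) := by
    intro t
    have e1 : pt (t + 2*π) = pt t := pt_periodic t
    have e2 : ∀ u, cell N (t + 2*π) u = cell N t u := fun u => by simp only [cell, chord, e1]
    simp only [hF, hW, hG, e1, e2]
  have hsum : step N * ∑ j ∈ idx N, ‖f (pt (x j))‖ ^ s * W (x j) ^ s ≤ ∫ t in (-π)..π, F t := by
    rw [← sum_integral_step cF pF N 0, mul_sum]
    refine sum_le_sum fun j hj => ?_
    have e : step N * (‖f (pt (x j))‖ ^ s * W (x j) ^ s) =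
        ∫ t in (0:ℝ)..step N, ‖f (pt (x j))‖ ^ s * W (x j) ^ s := by
      rw [intervalIntegral.integral_const, sub_zero, smul_eq_mul]
    rw [e]
    refine intervalIntegral.integral_mono_on hh.le intervalIntegrable_const
      ((cF.comp (continuous_const.add continuous_id)).intervalIntegrable _ _) fun t ht => ?_
    refine hnear j hj _ ?_
    have h1 := abs_le.1 (hx j hj)
    rw [abs_le]
    constructor <;> linarith [ht.1, ht.2]
  have h1 := hcauchy N L hL him R S y hR1 le_rfl hA β
  have h2 := hpois N L hL him S y hA (fun m => ‖β m‖) (fun m => norm_nonneg _)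
  simp only [← hσ, hWs] at h1 h2 ⊢
  have hInt : ∫ t in (-π)..π, F t ≤ 48 ^ s * 2 ^ s * (C₁ + K ^ s * C₂) *
      (step N ^ (1-s) * ∑ m ∈ S, ‖β m‖ ^ s * W (y m) ^ s) := by
    rw [hF, intervalIntegral.integral_const_mul, intervalIntegral.integral_const_mul,
      intervalIntegral.integral_add (cF1.intervalIntegrable _ _)
        (cF3.intervalIntegrable _ _), intervalIntegral.integral_const_mul]
    calc _ ≤ 48 ^ s * (2 ^ s * (C₁ * (step N ^ (1-s) * ∑ m ∈ S, ‖β m‖ ^ s * W (y m) ^ s) +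
          K ^ s * (C₂ * (step N ^ (1-s) * ∑ m ∈ S, ‖β m‖ ^ s * W (y m) ^ s)))) := by
          gcongr
      _ = _ := by ring
  have h3 := hsum.trans hInt
  rw [rpow_sub hh, rpow_one] at h3
  rw [rpow_neg hh.le]
  refine le_of_mul_le_mul_left (h3.trans_eq ?_) hh
  field_simp

lemma exists_dual {r : ℝ} (hr : 1 < r) (q : ℂ) :
    ∃ g : ℂ, q * g = (‖q‖ ^ r : ℝ) ∧ ‖g‖ = ‖q‖ ^ (r-1) := by
  rcases eq_or_ne q 0 with rfl | hq
  · exact ⟨0, by simp [zero_rpow (by linarith : r ≠ 0)], by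
      simp [zero_rpow (by linarith : r - 1 ≠ 0)]⟩
  · have hq' : 0 < ‖q‖ := norm_pos_iff.2 hq
    refine ⟨(starRingEnd ℂ) q * (‖q‖ ^ (r-2) : ℝ), ?_, ?_⟩
    · rw [← mul_assoc, Complex.mul_conj, Complex.normSq_eq_norm_sq, ← Complex.ofReal_mul,
        ← rpow_two, ← rpow_add hq']
      congr 2; ring
    · rw [norm_mul, RCLike.norm_conj, Complex.norm_real, Real.norm_of_nonneg (by positivity)]
      nth_rewrite 1 [← rpow_one ‖q‖]
      rw [← rpow_add hq']
      congr 1; ring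

lemma le_of_le_rpow_mul_rpow {r s S A K : ℝ} (hrs : r.HolderConjugate s) (hS : 0 ≤ S) (hA : 0 ≤ A)
    (hK : 0 ≤ K) (h : S ≤ A ^ (1/r) * (K * S) ^ (1/s)) : S ≤ K ^ (r-1) * A := by
  have hr := hrs.pos
  rcases hS.eq_or_lt with rfl | hS0
  · positivity
  have h1 := rpow_le_rpow hS h hr.le
  have e : 1/s*r = r-1 := by
    have := hrs.inv_add_inv_eq_one
    have hr1 := hr.ne'
    field_simp at this ⊢
    linarith
  rw [mul_rpow (by positivity) (by positivity), ← rpow_mul hA, ← rpow_mul (by positivity), e,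
    one_div_mul_cancel hr.ne', rpow_one, mul_rpow hK hS] at h1
  have h2 : S ^ r = S ^ (r-1) * S := by
    nth_rewrite 3 [← rpow_one S]
    rw [← rpow_add hS0]; congr 1; ring
  rw [h2] at h1
  have h3 : 0 < S ^ (r-1) := by positivity
  refine le_of_mul_le_mul_left (h1.trans_eq ?_) h3
  ring

lemma exists_integral_le_sum_of_two_lt {r α : ℝ} (hr : 2 < r) (hα0 : 0 ≤ α)
    (hα : α < 1/(2*r)) :
    ∃ C : ℝ, 0 < C ∧ ∀ (N : ℕ) (x : ℤ → ℝ), (∀ j ∈ idx N, |x j - j * step N| ≤ α * step N) →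
      ∀ c : ℤ → ℂ, ∫ t in (-π)..π, ‖trig N c t‖ ^ r ≤
        C * (step N * ∑ j ∈ idx N, ‖trig N c (x j)‖ ^ r) := by
  have hpi := pi_pos
  have hr0 : 0 < r := by linarith
  have hr1 : 0 < r - 1 := by linarith
  have hrs : r.HolderConjugate (r/(r-1)) := Real.HolderConjugate.conjExponent (by linarith)
  set s := r/(r-1) with hsdef
  have hs : 1 < s := hrs.symm.lt
  have hs0 : 0 < s := by linarith
  have hs2 : s ≤ 2 := by rw [hsdef, div_le_iff₀ hr1]; linarith
  obtain ⟨θ, hαθ, hθ⟩ := exists_between hα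
  have hθr : 1/(2*r) ≤ 1/4 := by rw [div_le_div_iff₀ (by positivity) (by norm_num)]; linarith
  have hα2 : α < 1/2 := by linarith
  obtain ⟨Y, hY, hlog⟩ := exists_log_nodePoly hα0 (by linarith) hαθ
  have hφ0 : 0 ≤ π * θ := by have := hα0.trans hαθ.le; positivity
  have hφ : s * (π * θ) < (s-1)*π/2 := by
    rw [lt_div_iff₀ (by positivity)] at hθ
    have e : s - 1 = 1/(r-1) := by rw [hsdef]; field_simp; ring
    have e2 : s * (π*θ) = (r * θ * π) / (r-1) := by rw [hsdef]; ring
    rw [e, e2, div_lt_iff₀ hr1]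
    field_simp
    linarith
  have hp : 1 < 2 - 4*(π*θ)/π := by
    have : 4*(π*θ)/π = 4*θ := by field_simp
    rw [this]; linarith
  obtain ⟨A, hA, hsum⟩ := exists_sum_cell_two_mul_le hp
  obtain ⟨C₁, hC₁, hshift⟩ := exists_integral_trig_le (r := r) (B := 2*Y) (by linarith)
  obtain ⟨C₂, hC₂, hcauchy⟩ := exists_sum_cauchy_le (A := A) hs hs2 hφ0 hφ hY
  obtain ⟨C₃, hC₃, hloc⟩ := exists_norm_nodePoly_le (Y := Y) hα2 (by linarith)
  set E := Real.exp (2*π*Y) with hE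
  refine ⟨C₁ * (C₃ ^ s * C₂ * E ^ s) ^ (r-1), by positivity, ?_⟩
  intro N x hx c
  have hh := step_pos N
  obtain ⟨L, hL, hLP, him⟩ := hlog N x hx
  set σ : ℝ := Real.exp (-(2 * Y * step N)) with hσ
  set R : ℝ := Real.exp (2 * Y * step N) with hR
  have hσ0 : 0 < σ := Real.exp_pos _
  have hR0 : 0 < R := Real.exp_pos _
  have hR1 : 1 < R := by
    rw [hR, Real.one_lt_exp_iff]; positivity
  have hRσ : R⁻¹ = σ := by rw [hR, hσ, Real.exp_neg]
  have hσ1 : σ < 1 := by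
    rw [hσ, Real.exp_lt_one_iff]; nlinarith
  refine (hshift N c (-(2 * Y * step N)) (by rw [abs_neg, abs_of_nonneg (by positivity)])).trans ?_
  rw [mul_assoc C₁, mul_left_comm ((C₃ ^ s * C₂ * E ^ s) ^ (r-1)) (step N)]
  refine mul_le_mul_of_nonneg_left (mul_le_mul_of_nonneg_left ?_ hh.le) hC₁.le
  set τ : ℤ → ℝ := fun k => k * step (2*N) with hτ
  set Q : ℤ → ℂ := fun k => trig N c (τ k + (-(2 * Y * step N) : ℝ) * Complex.I) with hQ
  change ∑ k ∈ idx (2*N), ‖Q k‖ ^ r ≤ _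
  choose g hg hgn using fun k => exists_dual (r := r) (by linarith) (Q k)
  have hgs : ∀ k, ‖g k‖ ^ s = ‖Q k‖ ^ r := fun k => by
    rw [hgn, ← rpow_mul (norm_nonneg _), hsdef, mul_div_cancel₀ _ hr1.ne']
  set D : ℤ → ℝ := fun j => ∏ m ∈ (idx N).erase j, chord (x j) (x m) with hD
  have hD0 : ∀ j ∈ idx N, 0 < D j := fun j hj => prod_chord_pos hα2 hx hj
  set w : ℤ → ℂ := fun j => (∏ m ∈ (idx N).erase j, (pt (x j) - pt (x m)))⁻¹ with hw
  have hwn : ∀ j, ‖w j‖ = (D j)⁻¹ := by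
    intro j
    simp only [hw, hD, norm_inv, norm_prod, chord]
  set M : ℂ → ℂ := fun z => ∏ j ∈ idx N, (z - pt (x j)) with hM
  set β : ℤ → ℂ := fun k => g k * ((R * pt (τ k)) ^ (N+1))⁻¹ * M (R * pt (τ k)) with hβ
  have hzball : ∀ t : ℝ, (σ * pt t : ℂ) ∈ Metric.ball (0:ℂ) 1 := by
    intro t; simp [abs_of_pos hσ0, hσ1]
  have hexp : ∀ t : ℝ, Complex.exp (Complex.I * (t + (-(2 * Y * step N) : ℝ) * Complex.I)) =
      R * pt t := by
    intro t
    rw [exp_I_mul_add, neg_neg]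
  have hζ : ∀ k, (R * pt (τ k) : ℂ) ≠ 0 := fun k =>
    mul_ne_zero (by exact_mod_cast hR0.ne') (pt_ne_zero _)
  have hζn : ∀ k, ‖(R * pt (τ k) : ℂ)‖ = R := fun k => by
    rw [norm_mul, norm_pt, mul_one, Complex.norm_real, Real.norm_of_nonneg hR0.le]
  set f : ℤ → ℂ := fun j => ∑ k ∈ idx (2*N), β k * (R * pt (τ k)) / (R * pt (τ k) - pt (x j))
    with hf
  have hQg : ∀ k, Q k * g k = ∑ j ∈ idx N, w j * trig N c (x j) * pt (x j) ^ N *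
      (β k * (R * pt (τ k)) / (R * pt (τ k) - pt (x j))) := by
    intro k
    have hne : ∀ j ∈ idx N,
        Complex.exp (Complex.I * (τ k + (-(2 * Y * step N) : ℝ) * Complex.I)) ≠ pt (x j) := by
      intro j _ h
      rw [hexp] at h
      have := congrArg norm h
      rw [hζn, norm_pt] at this
      linarith
    have h1 := trig_eq_interpolate hα2 hx c _ hne
    rw [hexp] at h1
    have h2 : Q k = ((R * pt (τ k)) ^ N)⁻¹ * (M (R * pt (τ k)) * ∑ j ∈ idx N, w j *
        trig N c (x j) * pt (x j) ^ N * (R * pt (τ k) - pt (x j))⁻¹) := by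
      rw [← h1, mul_comm (trig _ _ _), inv_mul_cancel_left₀ (pow_ne_zero _ (hζ k))]
    rw [h2, mul_sum, mul_sum, sum_mul]
    refine sum_congr rfl fun j _ => ?_
    have hz := hζ k
    simp only [hβ]
    generalize (R * pt (τ k) : ℂ) = z at hz
    rw [div_eq_mul_inv, pow_succ, mul_inv]
    linear_combination (-(w j * trig N c (x j) * pt (x j) ^ N * (z - pt (x j))⁻¹ * g k *
      (z^N)⁻¹ * M z)) * (inv_mul_cancel₀ hz)
  have hS : ∑ k ∈ idx (2*N), ‖Q k‖ ^ r ≤ ∑ j ∈ idx N, ‖trig N c (x j)‖ * (‖w j‖ * ‖f j‖) := by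
    have h1 : ((∑ k ∈ idx (2*N), ‖Q k‖ ^ r : ℝ) : ℂ) =
        ∑ j ∈ idx N, w j * trig N c (x j) * pt (x j) ^ N * f j := by
      rw [Complex.ofReal_sum]
      simp only [← hg, hQg, hf, mul_sum]
      rw [sum_comm]
    have h2 := congrArg norm h1
    rw [Complex.norm_real, Real.norm_of_nonneg (sum_nonneg fun k _ => by positivity)] at h2
    rw [h2]
    refine (norm_sum_le _ _).trans_eq (sum_congr rfl fun j _ => ?_)
    simp only [norm_mul, norm_pow, norm_pt, one_pow]
    ring
  have hwf : ∑ j ∈ idx N, (‖w j‖ * ‖f j‖) ^ s ≤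
      C₃ ^ s * C₂ * E ^ s * ∑ k ∈ idx (2*N), ‖Q k‖ ^ r := by
    have h1 := hcauchy N (fun z => -L z) hL.neg (fun z hz => by
      simpa using him z hz) x (fun j hj => (hx j hj).trans (by nlinarith)) (idx (2*N)) τ (hsum N) β
    calc _ ≤ ∑ j ∈ idx N, (C₃ * step N) ^ s * (‖f j‖ ^ s *
          Real.exp (s * (-L (σ * pt (x j))).re)) := by
          refine sum_le_sum fun j hj => ?_
          have hd := hD0 j hj
          have h2 : Real.exp (L (σ * pt (x j))).re ≤ C₃ * (step N * D j) :=
            (hLP _ (hzball _)).trans_le (hloc N x hx j hj)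
          rw [mul_comm s, Real.exp_mul, ← mul_rpow (by positivity) (by positivity),
            ← mul_rpow (by positivity) (by positivity)]
          refine rpow_le_rpow (by positivity) ?_ hs0.le
          rw [hwn, Complex.neg_re, Real.exp_neg, mul_comm ‖f j‖, ← mul_assoc]
          refine mul_le_mul_of_nonneg_right ?_ (norm_nonneg _)
          rw [← div_eq_mul_inv, le_div_iff₀ (Real.exp_pos _), inv_mul_le_iff₀ hd]
          linarith
      _ ≤ (C₃ * step N) ^ s * (C₂ * (step N ^ (-s) * ∑ k ∈ idx (2*N), ‖β k‖ ^ s *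
          Real.exp (s * (-L (σ * pt (τ k))).re))) := by
          rw [← mul_sum]
          exact mul_le_mul_of_nonneg_left h1 (by positivity)
      _ ≤ (C₃ * step N) ^ s * (C₂ * (step N ^ (-s) * ∑ k ∈ idx (2*N), E ^ s * ‖Q k‖ ^ r)) := by
          refine mul_le_mul_of_nonneg_left (mul_le_mul_of_nonneg_left (mul_le_mul_of_nonneg_left
            (sum_le_sum fun k _ => ?_) (by positivity)) hC₂.le) (by positivity)
          have hβn : ‖β k‖ = ‖g k‖ * R ^ N * Real.exp (L (σ * pt (τ k))).re := by
            simp only [hβ, hM, norm_mul, norm_inv, norm_pow, norm_pt, mul_one, norm_prod_sub_pt,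
              norm_nodePoly_inv N x hR0, hRσ, hLP _ (hzball _), Complex.norm_real,
              Real.norm_of_nonneg hR0.le]
            field_simp
            ring
          have hRN : R ^ N ≤ E := by
            rw [hR, hE, ← Real.exp_nat_mul, Real.exp_le_exp]
            have := step_mul N
            nlinarith [mul_pos (by linarith : 0 < Y) hh, (Nat.cast_nonneg N : (0:ℝ) ≤ N)]
          rw [← hgs, hβn, mul_comm s, Real.exp_mul, ← mul_rpow (by positivity) (by positivity),
            ← mul_rpow (by positivity) (by positivity)]
          refine rpow_le_rpow (by positivity) ?_ hs0.le
          rw [Complex.neg_re, mul_assoc, ← Real.exp_add, add_neg_cancel, Real.exp_zero, mul_one,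
            mul_comm]
          gcongr
      _ = _ := by
          rw [← mul_sum, mul_rpow hC₃.le hh.le, rpow_neg hh.le]
          field_simp
  have hhold := Real.inner_le_Lp_mul_Lq (idx N) (fun j => ‖trig N c (x j)‖)
    (fun j => ‖w j‖ * ‖f j‖) hrs
  simp only [abs_norm, abs_mul] at hhold
  refine le_of_le_rpow_mul_rpow hrs (sum_nonneg fun k _ => by positivity)
    (sum_nonneg fun k _ => by positivity) (by positivity) ((hS.trans hhold).trans ?_)
  exact mul_le_mul_of_nonneg_left (rpow_le_rpow (sum_nonneg fun k _ => by positivity) hwf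
    (by positivity)) (rpow_nonneg (sum_nonneg fun k _ => by positivity) _)

/-- The Marcinkiewicz–Zygmund inequalities hold below the threshold. -/
lemma exists_mzIneq {r α : ℝ} (hr : 1 ≤ r) (hα0 : 0 ≤ α)
    (hα : α < min (1/(2*r)) ((r-1)/(2*r))) :
    ∃ C₁ C₂ : ℝ, 0 < C₁ ∧ 0 < C₂ ∧ ∀ N : ℕ, 0 < N → ∀ x : ℤ → ℝ, PerturbedNodes N α x →
      ∀ q : ℝ → ℂ, IsTrigPoly N q → MZIneq r C₁ C₂ N x q := by
  have hpi := pi_pos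
  obtain ⟨ha, hb⟩ := lt_min_iff.1 hα
  have hr1 : 1 < r := by
    by_contra! h
    have h1 : (r-1)/(2*r) ≤ 0 := div_nonpos_of_nonpos_of_nonneg (by linarith) (by linarith)
    linarith
  have hα1 : α ≤ 1 := by
    have : 1/(2*r) ≤ 1 := by rw [div_le_one (by positivity)]; linarith
    linarith
  obtain ⟨C, hC, hlow⟩ : ∃ C : ℝ, 0 < C ∧ ∀ (N : ℕ) (x : ℤ → ℝ),
      (∀ j ∈ idx N, |x j - j * step N| ≤ α * step N) →
      ∀ c : ℤ → ℂ, ∫ t in (-π)..π, ‖trig N c t‖ ^ r ≤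
        C * (step N * ∑ j ∈ idx N, ‖trig N c (x j)‖ ^ r) := by
    rcases le_or_gt r 2 with h | h
    · exact exists_integral_le_sum_of_le_two hr1 h hα0 hb
    · exact exists_integral_le_sum_of_two_lt h hα0 ha
  obtain ⟨A, hA, hsum⟩ := exists_sum_cell_le (p := 2) (by norm_num)
  obtain ⟨C', hC', hup⟩ := exists_sum_trig_le hr A
  refine ⟨(2*π*C)⁻¹, C'/(2*π), by positivity, by positivity, ?_⟩
  rintro N - x hx q ⟨c, hq⟩
  have hh := step_pos N
  have hx' : ∀ j ∈ idx N, |x j - j * step N| ≤ α * step N := hx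
  have hqc : ∀ t : ℝ, q t = trig N c t := hq
  have e : 1/(2*(N:ℝ)+1) = step N / (2*π) := by
    rw [← step_mul N]; field_simp
  simp only [MZIneq, hqc, e]
  have h1 := hlow N x hx' c
  have h2 := hup N (idx N) x (hsum N x fun j hj => (hx' j hj).trans (by nlinarith)) c
  change _ ≤ step N / (2*π) * ∑ j ∈ idx N, _ ∧ step N / (2*π) * ∑ j ∈ idx N, _ ≤ _
  constructor
  · rw [inv_mul_le_iff₀ (by positivity)]
    refine h1.trans_eq ?_
    field_simp
  · rw [div_mul_eq_mul_div, div_mul_eq_mul_div]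
    gcongr

/-! ### Logarithms of chords -/

/-- The logarithm of the chordal distance of two points that are `v` grid steps apart. -/
noncomputable def lg (N : ℕ) (v : ℝ) : ℝ := Real.log (2 * sin (v * step N / 2))

lemma log_chord (N : ℕ) (a b : ℝ) :
    Real.log (chord (a * step N) (b * step N)) = lg N (a - b) := by
  have e : (a - b) * step N / 2 = (a * step N - b * step N) / 2 := by ring
  rw [chord_eq, lg, e, ← Real.log_abs (2 * sin _), abs_mul, abs_two]

lemma lg_neg (N : ℕ) (v : ℝ) : lg N (-v) = lg N v := by
  rw [lg, lg, neg_mul, neg_div, sin_neg, mul_neg, Real.log_neg_eq_log]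

lemma half_step_mem {N : ℕ} {v : ℝ} (h0 : 0 < v) (h1 : v < 2*N+1) :
    0 < v * step N / 2 ∧ v * step N / 2 < π := by
  have hh := step_pos N
  have := step_mul N
  refine ⟨by positivity, ?_⟩
  nlinarith

lemma sin_half_step_pos {N : ℕ} {v : ℝ} (h0 : 0 < v) (h1 : v < 2*N+1) :
    0 < sin (v * step N / 2) :=
  sin_pos_of_pos_of_lt_pi (half_step_mem h0 h1).1 (half_step_mem h0 h1).2

lemma chord_step_pos {N : ℕ} {a b : ℝ} (h0 : a ≠ b) (h1 : |a - b| < 2*N+1) :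
    0 < chord (a * step N) (b * step N) := by
  have hh := step_pos N
  have h := sin_half_step_pos (abs_pos.2 (sub_ne_zero.2 h0)) h1
  rw [chord_eq]
  have e : |sin ((a * step N - b * step N)/2)| = |sin (|a - b| * step N / 2)| := by
    rcases abs_cases (a - b) with ⟨h, -⟩ | ⟨h, -⟩
    · rw [h]; congr 2; ring
    · rw [h, ← abs_neg, ← sin_neg]; congr 2; ring
  rw [e]
  have := abs_pos.2 h.ne'
  positivity

lemma lg_concave {N : ℕ} {u v l : ℝ} (hu0 : 0 < u) (hu : u < 2*N+1) (hv0 : 0 < v)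
    (hv : v < 2*N+1) (hl0 : 0 ≤ l) (hl1 : l ≤ 1) :
    (1 - l) * lg N u + l * lg N v ≤ lg N ((1 - l) * u + l * v) := by
  have su := sin_half_step_pos hu0 hu
  have sv := sin_half_step_pos hv0 hv
  have mu := half_step_mem hu0 hu
  have mv := half_step_mem hv0 hv
  have h1 := strictConcaveOn_sin_Icc.concaveOn.2 ⟨mu.1.le, mu.2.le⟩ ⟨mv.1.le, mv.2.le⟩
    (sub_nonneg.2 hl1) hl0 (by ring)
  have h2 := strictConcaveOn_log_Ioi.concaveOn.2 (Set.mem_Ioi.2 (mul_pos two_pos su))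
    (Set.mem_Ioi.2 (mul_pos two_pos sv)) (sub_nonneg.2 hl1) hl0 (by ring)
  simp only [smul_eq_mul] at h1 h2
  refine h2.trans (Real.log_le_log ?_ ?_)
  · rcases hl0.eq_or_lt with rfl | hl
    · simpa using su
    · have := mul_nonneg (sub_nonneg.2 hl1) (mul_pos two_pos su).le
      positivity
  · have e : ((1 - l) * u + l * v) * step N / 2 =
        (1 - l) * (u * step N / 2) + l * (v * step N / 2) := by ring
    rw [e]; linarith

lemma lg_le_log {N : ℕ} {v : ℝ} (h0 : 0 < v) (h1 : v < 2*N+1) :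
    lg N v ≤ Real.log (v * step N) := by
  refine Real.log_le_log (mul_pos two_pos (sin_half_step_pos h0 h1)) ?_
  have := sin_le (half_step_mem h0 h1).1.le
  linarith

lemma lg_le_log_two {N : ℕ} {v : ℝ} (h0 : 0 < v) (h1 : v < 2*N+1) : lg N v ≤ Real.log 2 := by
  refine Real.log_le_log (mul_pos two_pos (sin_half_step_pos h0 h1)) ?_
  have := sin_le_one (v * step N / 2)
  linarith

lemma lg_nonneg {N : ℕ} {v : ℝ} (hN : 0 < N) (h0 : N + 1/2 ≤ v) (h1 : v ≤ N + 3/2) :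
    0 ≤ lg N v := by
  have hh := step_pos N
  have hs := step_mul N
  have hN' : (1:ℝ) ≤ N := by exact_mod_cast hN
  have h3 : step N ≤ 2*π/3 := by nlinarith
  have h4 : 1/2 ≤ sin (v * step N / 2) := by
    rw [← sin_pi_sub, ← sin_pi_div_six]
    refine sin_le_sin_of_le_of_le_pi_div_two ?_ ?_ ?_ <;> nlinarith [pi_pos]
  exact Real.log_nonneg (by linarith)

lemma lg_le_add_log_two {N : ℕ} {u v : ℝ} (h0 : 0 < u) (huv : u ≤ v) (hvu : v ≤ 2 * u)
    (h1 : v < 2*N+1) : lg N v ≤ lg N u + Real.log 2 := by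
  have hv0 := h0.trans_le huv
  have sv := sin_half_step_pos hv0 h1
  have su := sin_half_step_pos h0 (huv.trans_lt h1)
  have mv := half_step_mem hv0 h1
  have h := strictConcaveOn_sin_Icc.concaveOn.2 (Set.left_mem_Icc.2 pi_pos.le)
    ⟨mv.1.le, mv.2.le⟩ (sub_nonneg.2 ((div_le_one hv0).2 huv)) (div_pos h0 hv0).le (by ring)
  simp only [smul_eq_mul, sin_zero, mul_zero, zero_add] at h
  have e : u / v * (v * step N / 2) = u * step N / 2 := by field_simp
  rw [e] at h
  have h2 : 1/2 ≤ u / v := by rw [div_le_div_iff₀ (by norm_num) hv0]; linarith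
  rw [lg, lg, ← Real.log_mul (by positivity) (by norm_num)]
  refine Real.log_le_log (by positivity) ?_
  nlinarith

lemma log_le_lg {N : ℕ} {v : ℝ} (h0 : 0 < v) (h1 : v ≤ N + 1/2) :
    Real.log (v * step N) ≤ lg N v + Real.log 2 := by
  have hh := step_pos N
  have hs := step_mul N
  have h1' : v < 2*N+1 := by linarith [(Nat.cast_nonneg N : (0:ℝ) ≤ N)]
  have sv := sin_half_step_pos h0 h1'
  have h := mul_le_sin (half_step_mem h0 h1').1.le (by nlinarith)
  have h2 : 1/2 ≤ 2/π := by
    rw [div_le_div_iff₀ (by norm_num) pi_pos]; linarith [pi_le_four]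
  rw [lg, ← Real.log_mul (by positivity) (by norm_num)]
  refine Real.log_le_log (by positivity) ?_
  nlinarith [mul_pos h0 hh]

lemma sum_lg_succ (N M : ℕ) (a : ℝ) :
    ∑ i ∈ range M, lg N (a + i + 1) = ∑ i ∈ range M, lg N (a + i) + lg N (a + M) - lg N a := by
  have h := sum_range_succ (fun i : ℕ => lg N (a + i)) M
  have h' := sum_range_succ' (fun i : ℕ => lg N (a + i)) M
  simp only [Nat.cast_zero, add_zero, Nat.cast_add, Nat.cast_one, ← add_assoc] at h'
  linarith

lemma sum_lg_le {N M : ℕ} {a l : ℝ} (ha : 0 < a) (haM : a + M < 2*N+1) (hl0 : 0 ≤ l)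
    (hl1 : l ≤ 1) :
    ∑ i ∈ range M, lg N (a + i) + l * (lg N (a + M) - lg N a) ≤
      ∑ i ∈ range M, lg N (a + i + l) := by
  have h : ∀ i ∈ range M, (1 - l) * lg N (a + i) + l * lg N (a + i + 1) ≤ lg N (a + i + l) := by
    intro i hi
    have hi' : (i:ℝ) + 1 ≤ M := by exact_mod_cast mem_range.1 hi
    have hi0 : (0:ℝ) ≤ i := Nat.cast_nonneg i
    have := lg_concave (N := N) (u := a + i) (v := a + i + 1) (by linarith) (by linarith)
      (by linarith) (by linarith) hl0 hl1
    refine this.trans_eq (congrArg _ ?_)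
    ring
  have h2 := sum_le_sum h
  rw [sum_add_distrib, ← mul_sum, ← mul_sum, sum_lg_succ] at h2
  linarith

lemma sum_lg_half_grid (N : ℕ) (k : ℤ) : ∑ m ∈ idx N, lg N (k + 1/2 - m) = Real.log 2 := by
  set t : ℝ := (k + 1/2) * step N with ht
  have hpow : pt t ^ (2*N+1) = -1 := by
    have h : ((2*N+1 : ℕ) : ℂ) * ((t:ℂ) * Complex.I) =
        π * Complex.I + k * (2 * π * Complex.I) := by
      have h1 : ((2*N+1 : ℝ) : ℂ) * (step N : ℂ) = ((2*π : ℝ) : ℂ) := by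
        rw [← Complex.ofReal_mul, step_mul]
      rw [ht]; push_cast at h1 ⊢
      linear_combination ((k:ℂ) + 1/2) * Complex.I * h1
    rw [pt, ← Complex.exp_nat_mul, h, Complex.exp_add, Complex.exp_int_mul_two_pi_mul_I,
      Complex.exp_pi_mul_I, mul_one]
  have h := congrArg norm (prod_one_sub_grid N (pt t))
  rw [hpow, norm_prod] at h
  simp only [norm_one_sub_pt_mul] at h
  norm_num at h
  have hne : ∀ m ∈ idx N, chord t (m * step N) ≠ 0 := by
    intro m hm h0
    rw [prod_eq_zero hm h0] at h
    norm_num at h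
  have e : Real.log 2 = ∑ m ∈ idx N, Real.log (chord t (m * step N)) := by
    rw [← h, Real.log_prod hne]
  rw [e]
  exact sum_congr rfl fun m _ => (log_chord N _ _).symm

lemma sum_lg_grid (N : ℕ) {j : ℤ} (hj : j ∈ idx N) :
    ∑ m ∈ (idx N).erase j, lg N (j - m) = Real.log (2*N+1) := by
  set v : ℤ → ℂ := fun m => pt (m * step N) with hv
  have hinj : Set.InjOn v (idx N) := injOn_pt_nodes (x := fun m => m * step N) (α := 0)
    (by norm_num) (fun j _ => by simp)
  have hroot : ∀ m : ℤ, v m ^ (2*N+1) = 1 := fun m => by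
    have := pt_int_mul_step_pow N (-m)
    simpa [hv] using this
  have hnodal : Lagrange.nodal (idx N) v = Polynomial.X ^ (2*N+1) - 1 := by
    have hmon : (Polynomial.X ^ (2*N+1) - 1 : Polynomial ℂ).Monic :=
      Polynomial.monic_X_pow_sub_C 1 (by omega)
    have hdeg : (Polynomial.X ^ (2*N+1) - 1 : Polynomial ℂ).degree = ((2*N+1 : ℕ) : WithBot ℕ) :=
      Polynomial.degree_X_pow_sub_C (by omega) 1
    refine Polynomial.eq_of_degree_sub_lt_of_eval_index_eq _ hinj ?_ ?_
    · refine (Polynomial.degree_sub_lt_left ?_ (Lagrange.nodal_ne_zero) ?_).trans_eq ?_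
      · rw [Lagrange.degree_nodal, hdeg, card_idx]
      · rw [Lagrange.nodal_monic.leadingCoeff, hmon.leadingCoeff]
      · rw [Lagrange.degree_nodal]
    · intro m hm
      rw [Lagrange.eval_nodal_at_node hm]
      simp [hroot]
  have h := congrArg norm (Lagrange.eval_nodal_derivative_eval_node_eq (v := v) hj)
  rw [hnodal, Lagrange.eval_nodal, norm_prod] at h
  have h' : ∏ m ∈ (idx N).erase j, chord (j * step N) (m * step N) = 2*N+1 := by
    refine h.symm.trans ?_
    have : ‖v j‖ = 1 := norm_pt _
    simp only [Polynomial.derivative_sub, Polynomial.derivative_X_pow, Polynomial.derivative_one,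
      Polynomial.eval_mul, Polynomial.eval_pow, Polynomial.eval_X,
      Polynomial.eval_C, sub_zero, norm_mul, norm_pow, this, one_pow,
      mul_one, Complex.norm_natCast]
    push_cast; ring
  have hne : ∀ m ∈ (idx N).erase j, chord (j * step N) (m * step N) ≠ 0 := by
    intro m hm h0
    rw [prod_eq_zero hm h0] at h'
    have : (0:ℝ) ≤ N := Nat.cast_nonneg N
    linarith
  rw [← h', Real.log_prod hne]
  exact sum_congr rfl fun m _ => (log_chord N _ _).symm

lemma exists_trig_eq {N : ℕ} {α : ℝ} {x : ℤ → ℝ} (hα : α < 1/2)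
    (hx : ∀ j ∈ idx N, |x j - j * step N| ≤ α * step N) (a : ℤ → ℂ) :
    ∃ c : ℤ → ℂ, ∀ j ∈ idx N, trig N c (x j) = a j := by
  have hinj := injOn_pt_nodes hα hx
  set P := Lagrange.interpolate (idx N) (fun j => pt (x j)) (fun j => a j * pt (x j) ^ N) with hP
  have hdeg : P.degree < (2*N+1 : ℕ) := by
    rw [← card_idx N]; exact Lagrange.degree_interpolate_lt _ hinj
  have hnat : P.natDegree < 2*N+1 := by
    rcases eq_or_ne P 0 with h | h
    · rw [h]; simp
    · exact (Polynomial.natDegree_lt_iff_degree_lt h).2 hdeg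
  set c : ℤ → ℂ := fun k => P.coeff (k + N).toNat with hc
  have hPc : trigPoly N c = P := by
    rw [trigPoly, sum_idx]
    conv_rhs => rw [P.as_sum_range' _ hnat]
    refine sum_congr rfl fun k _ => ?_
    have : ((k:ℤ) - N + N).toNat = k := by omega
    simp only [hc, this]
  refine ⟨c, fun j hj => ?_⟩
  have h := eval_trigPoly N c (x j)
  rw [hPc, exp_I_mul, hP, Lagrange.eval_interpolate_at_node _ hinj hj] at h
  exact (mul_right_cancel₀ (pow_ne_zero _ (pt_ne_zero _)) h).symm

/-- Values of trigonometric polynomials in terms of the values at the nodes. -/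
lemma exists_weights {N : ℕ} {α τ : ℝ} {y : ℤ → ℝ} (hα : α < 1/2)
    (hy : ∀ j ∈ idx N, |y j - j| ≤ α) (hτ : ∀ j ∈ idx N, τ ≠ y j)
    (hτ' : ∀ j ∈ idx N, |τ - y j| < 2*N+1) :
    ∃ b : ℤ → ℂ, (∀ c, trig N c (τ * step N : ℝ) * pt (τ * step N) ^ N =
        ∑ j ∈ idx N, trig N c (y j * step N : ℝ) * b j) ∧
      ∀ j ∈ idx N, b j ≠ 0 ∧ Real.log ‖b j‖ = ∑ m ∈ (idx N).erase j, lg N (τ - y m) -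
        ∑ m ∈ (idx N).erase j, lg N (y j - y m) := by
  have hh := step_pos N
  set x : ℤ → ℝ := fun j => y j * step N with hxdef
  set t : ℝ := τ * step N with ht
  have hx : ∀ j ∈ idx N, |x j - j * step N| ≤ α * step N := by
    intro j hj
    rw [hxdef, ← sub_mul, abs_mul, abs_of_pos hh]
    exact mul_le_mul_of_nonneg_right (hy j hj) hh.le
  have hpos : ∀ j ∈ idx N, 0 < chord t (x j) := fun j hj => chord_step_pos (hτ j hj) (hτ' j hj)
  have hD : ∀ j ∈ idx N, ∏ m ∈ (idx N).erase j, chord (x j) (x m) ≠ 0 := fun j hj =>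
    (prod_chord_pos hα hx hj).ne'
  have hne : ∀ j ∈ idx N, Complex.exp (Complex.I * t) ≠ pt (x j) := by
    intro j hj h
    rw [exp_I_mul] at h
    have := hpos j hj
    rw [chord, h, sub_self, norm_zero] at this
    exact lt_irrefl _ this
  set b : ℤ → ℂ := fun j => (∏ m ∈ idx N, (pt t - pt (x m))) *
    ((∏ m ∈ (idx N).erase j, (pt (x j) - pt (x m)))⁻¹ * pt (x j) ^ N * (pt t - pt (x j))⁻¹) with hb
  have hbn : ∀ j ∈ idx N, ‖b j‖ = (∏ m ∈ (idx N).erase j, chord t (x m)) *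
      (∏ m ∈ (idx N).erase j, chord (x j) (x m))⁻¹ := by
    intro j hj
    have h1 := (hpos j hj).ne'
    have h2 := mul_prod_erase (idx N) (fun m => chord t (x m)) hj
    simp only [hb, norm_mul, norm_inv, norm_prod, norm_pow, norm_pt, one_pow, mul_one]
    simp only [← chord.eq_1]
    rw [← h2]
    field_simp
  refine ⟨b, fun c => ?_, fun j hj => ?_⟩
  · have h := trig_eq_interpolate hα hx c t hne
    rw [exp_I_mul] at h
    rw [h, mul_sum]
    refine sum_congr rfl fun j _ => ?_
    simp only [hb]; ring
  · have h1 : ∏ m ∈ (idx N).erase j, chord t (x m) ≠ 0 :=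
      prod_ne_zero_iff.2 fun m hm => (hpos m (mem_of_mem_erase hm)).ne'
    refine ⟨?_, ?_⟩
    · rw [← norm_ne_zero_iff, hbn j hj]
      exact mul_ne_zero h1 (inv_ne_zero (hD j hj))
    · rw [hbn j hj, Real.log_mul h1 (inv_ne_zero (hD j hj)), Real.log_inv, Real.log_prod
        (fun m hm => (hpos m (mem_of_mem_erase hm)).ne'),
        Real.log_prod (prod_ne_zero_iff.1 (hD j hj)), ← sub_eq_add_neg]
      simp only [ht, hxdef, log_chord]

/-! ### Extremal nodes -/

lemma sum_idx_symm (N : ℕ) (f : ℤ → ℝ) :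
    ∑ m ∈ idx N, f m = f 0 + ∑ i ∈ range N, f ((i:ℤ) + 1) + ∑ i ∈ range N, f (-((i:ℤ) + 1)) := by
  induction N with
  | zero => simp [idx]
  | succ N ih =>
    have e : idx (N+1) = insert ((N:ℤ) + 1) (insert (-((N:ℤ) + 1)) (idx N)) := by
      ext m; simp only [mem_Icc, mem_insert]; push_cast; omega
    rw [e, sum_insert, sum_insert, ih, sum_range_succ, sum_range_succ]
    · ring
    · simp only [mem_Icc]; omega
    · simp only [mem_Icc, mem_insert]; omega

/-- The nodes, in units of the grid step, with all perturbations pointing away from the origin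
(`ε > 0`) or towards the origin (`ε < 0`). -/
noncomputable def radial (ε : ℝ) (m : ℤ) : ℝ := m + ε * m.sign

lemma radial_zero (ε : ℝ) : radial ε 0 = 0 := by simp [radial]

lemma radial_succ (ε : ℝ) (i : ℕ) : radial ε ((i:ℤ) + 1) = i + 1 + ε := by
  have : ((i:ℤ) + 1).sign = 1 := Int.sign_eq_one_of_pos (by omega)
  rw [radial, this]; push_cast; ring

lemma radial_neg (ε : ℝ) (m : ℤ) : radial ε (-m) = -radial ε m := by
  simp [radial, Int.sign_neg]; ring

lemma abs_radial_sub_le (ε : ℝ) (m : ℤ) : |radial ε m - m| ≤ |ε| := by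
  have h : |((m.sign : ℤ) : ℝ)| ≤ 1 := by
    rcases lt_trichotomy m 0 with h | rfl | h
    · simp [Int.sign_eq_neg_one_of_neg h]
    · simp
    · simp [Int.sign_eq_one_of_pos h]
  rw [radial, add_sub_cancel_left, abs_mul]
  exact mul_le_of_le_one_right (abs_nonneg _) h

lemma half_ne_radial {ε : ℝ} (hε : |ε| < 1/2) (k m : ℤ) : (k:ℝ) + 1/2 ≠ radial ε m := by
  intro h
  have h1 := abs_lt.1 ((abs_radial_sub_le ε m).trans_lt hε)
  rw [← h] at h1
  have h2 : ((k - m : ℤ) : ℝ) < 0 := by push_cast; linarith [h1.2]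
  have h3 : ((-1 : ℤ) : ℝ) < ((k - m : ℤ) : ℝ) := by push_cast; linarith [h1.1]
  have h4 : k - m < 0 := by exact_mod_cast h2
  have h5 : -1 < k - m := by exact_mod_cast h3
  omega

lemma abs_half_sub_radial_lt {N : ℕ} {ε : ℝ} (hε : |ε| < 1/2) {k : ℕ} (hk : k < N) {m : ℤ}
    (hm : m ∈ idx N) : |(k:ℝ) + 1/2 - radial ε m| < 2*N+1 := by
  have h1 := abs_lt.1 ((abs_radial_sub_le ε m).trans_lt hε)
  have h2 := mem_Icc.1 hm
  have h3 : (-N : ℝ) ≤ m := by exact_mod_cast h2.1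
  have h4 : (m : ℝ) ≤ N := by exact_mod_cast h2.2
  have h5 : (k:ℝ) + 1 ≤ N := by exact_mod_cast hk
  have h6 : (0:ℝ) ≤ k := Nat.cast_nonneg k
  rw [abs_lt]; constructor <;> linarith [h1.1, h1.2]

lemma log_sum_inward {N k : ℕ} {α : ℝ} (hk : k < N) (hα0 : 0 ≤ α) (hα1 : α ≤ 1/4) :
    (2*α - 1) * Real.log (k + 1) - Real.log (4*π) ≤
      ∑ m ∈ (idx N).erase 0, lg N (k + 1/2 - radial (-α) m) -
        ∑ m ∈ (idx N).erase 0, lg N (radial (-α) 0 - radial (-α) m) := by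
  have hh := step_pos N
  have hs := step_mul N
  have hk' : (k:ℝ) + 1 ≤ N := by exact_mod_cast hk
  have hk0 : (0:ℝ) ≤ k := Nat.cast_nonneg k
  have h0 : (0:ℤ) ∈ idx N := by simp [idx]
  obtain ⟨M, rfl⟩ : ∃ M, N = k + (M + 1) := ⟨N - k - 1, by omega⟩
  set N := k + (M + 1) with hN
  have hNc : (N:ℝ) = k + (M + 1) := by rw [hN]; push_cast; ring
  have hM0 : (0:ℝ) ≤ M := Nat.cast_nonneg M
  have hlog2 : 0 < Real.log 2 := Real.log_pos (by norm_num)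
  have split : ∀ f : ℕ → ℝ, ∑ i ∈ range N, f i =
      ∑ i ∈ range k, f (k - 1 - i) + (∑ i ∈ range M, f (k + (i + 1)) + f k) := by
    intro f
    rw [hN, sum_range_add, sum_range_reflect, sum_range_succ', add_zero]
  have e1 : ∀ ε, ∑ i ∈ range N, lg N (k + 1/2 - (i + 1 - ε)) =
      ∑ i ∈ range k, lg N (1/2 + i + ε) + (∑ i ∈ range M, lg N (1/2 + i + (1 - ε)) +
        lg N (1/2 - ε)) := by
    intro ε
    rw [split (fun i => lg N (k + 1/2 - (i + 1 - ε)))]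
    congr 1
    · refine sum_congr rfl fun i hi => congrArg _ ?_
      have hi' := mem_range.1 hi
      rw [Nat.sub_sub, Nat.cast_sub (by omega)]
      push_cast; ring
    · congr 1
      · refine sum_congr rfl fun i hi => ?_
        rw [← lg_neg]; congr 1; push_cast; ring
      · rw [← lg_neg]; congr 1; ring
  have hU : ∀ ε, ∑ m ∈ (idx N).erase 0, lg N (k + 1/2 - radial (-ε) m) =
      (∑ i ∈ range k, lg N (1/2 + i + ε) + (∑ i ∈ range M, lg N (1/2 + i + (1 - ε)) +
        lg N (1/2 - ε))) + ∑ i ∈ range N, lg N (k + 1/2 + i + (1 - ε)) := by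
    intro ε
    rw [← e1]
    have h1 := add_sum_erase (idx N) (fun m => lg N (k + 1/2 - radial (-ε) m)) h0
    rw [sum_idx_symm] at h1
    simp only [radial_neg, radial_succ, radial_zero, ← sub_eq_add_neg, sub_neg_eq_add] at h1
    have h2 : ∀ i : ℕ, (k:ℝ) + 1/2 + (i + 1 - ε) = k + 1/2 + i + (1 - ε) := fun i => by ring
    simp only [h2] at h1
    linarith
  have hgrid : lg N (k + 1/2) + ((∑ i ∈ range k, lg N (1/2 + i) + (∑ i ∈ range M,
      lg N (1/2 + i + 1) + lg N (1/2))) + ∑ i ∈ range N, lg N (k + 1/2 + i + 1)) = Real.log 2 := by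
    have h1 := hU 0
    have h2 := sum_lg_half_grid N k
    rw [← add_sum_erase _ _ h0] at h2
    simp only [radial, neg_zero, zero_mul, add_zero, sub_zero] at h1
    push_cast at h2
    rw [h1, sub_zero] at h2
    exact h2
  have hD : ∑ m ∈ (idx N).erase 0, lg N (radial (-α) 0 - radial (-α) m) =
      2 * ∑ i ∈ range N, lg N (1 - α + i) := by
    have h1 := add_sum_erase (idx N) (fun m => lg N (radial (-α) 0 - radial (-α) m)) h0
    rw [sum_idx_symm] at h1
    simp only [radial_neg, radial_succ, radial_zero, zero_sub, lg_neg, neg_neg, neg_zero] at h1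
    have h2 : ∀ i : ℕ, (i:ℝ) + 1 + -α = 1 - α + i := fun i => by ring
    simp only [h2] at h1
    simp only [radial_zero, zero_sub, lg_neg]
    linarith
  have hgrid0 : 2 * ∑ i ∈ range N, lg N (1 - α + i + α) = Real.log (2*N+1) := by
    rw [← sum_lg_grid N h0]
    have h1 := add_sum_erase (idx N) (fun m : ℤ => lg N ((0:ℤ) - m)) h0
    rw [sum_idx_symm] at h1
    push_cast at h1 ⊢
    simp only [zero_sub, lg_neg, neg_neg, neg_zero] at h1 ⊢
    have h2 : ∀ i : ℕ, 1 - α + i + α = (i:ℝ) + 1 := fun i => by ring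
    simp only [h2]
    linarith
  have b1 := sum_lg_le (N := N) (M := k) (a := 1/2) (l := α) (by norm_num) (by linarith) hα0
    (by linarith)
  have b2 := sum_lg_le (N := N) (M := M) (a := 1/2) (l := 1 - α) (by norm_num) (by linarith)
    (by linarith) (by linarith)
  have b3 := sum_lg_le (N := N) (M := N) (a := k + 1/2) (l := 1 - α) (by linarith) (by linarith)
    (by linarith) (by linarith)
  have b4 := sum_lg_le (N := N) (M := N) (a := 1 - α) (l := α) (by linarith) (by linarith) hα0
    (by linarith)
  have s2 := sum_lg_succ N M (1/2)
  have s3 := sum_lg_succ N N (k + 1/2)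
  have c1 := lg_le_add_log_two (N := N) (u := 1/2 - α) (v := 1/2) (by linarith) (by linarith)
    (by linarith) (by linarith)
  have c2 := lg_le_log_two (N := N) (v := 1/2 + M) (by linarith) (by linarith)
  have c3 := lg_le_log_two (N := N) (v := k + 1/2 + N) (by linarith) (by linarith)
  have c4 := lg_nonneg (N := N) (v := 1 - α + N) (by omega) (by linarith) (by linarith)
  have c5 : lg N (1 - α) ≤ Real.log (step N) := (lg_le_log (by linarith) (by linarith)).trans
    (Real.log_le_log (mul_pos (by linarith) hh) (by nlinarith))
  have c6 : lg N (k + 1/2) ≤ Real.log (k + 1) + Real.log (step N) := by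
    rw [← Real.log_mul (by positivity) hh.ne']
    refine (lg_le_log (by linarith) (by linarith)).trans
      (Real.log_le_log (by positivity) (by nlinarith))
  have c7 : Real.log (2*N+1) + Real.log (step N) = Real.log 2 + Real.log π := by
    rw [← Real.log_mul (by positivity) hh.ne', hs, Real.log_mul (by norm_num) pi_ne_zero]
  have c8 : Real.log (4*π) = 2 * Real.log 2 + Real.log π := by
    rw [Real.log_mul (by norm_num) pi_ne_zero]
    congr 1
    rw [show (4:ℝ) = 2 ^ 2 by norm_num, Real.log_pow]; norm_num
  rw [hU, hD, c8]
  have ec : (1/2 : ℝ) + k = k + 1/2 := by ring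
  rw [ec] at b1
  have d2 := mul_le_mul_of_nonneg_left c2 hα0
  have d3 := mul_le_mul_of_nonneg_left c3 hα0
  have d4 := mul_nonneg hα0 c4
  have d5 := mul_le_mul_of_nonneg_left c5 hα0
  have d6 := mul_le_mul_of_nonneg_left c6 (by linarith : 0 ≤ 1 - 2*α)
  have d7 : α * Real.log 2 ≤ 1/4 * Real.log 2 := mul_le_mul_of_nonneg_right hα1 hlog2.le
  linarith

lemma log_sum_outward {N j : ℕ} {α : ℝ} (hj0 : 0 < j) (hjN : j ≤ N) (hα0 : 0 ≤ α)
    (hα1 : α ≤ 1/4) :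
    (2*α - 1) * Real.log j - Real.log (8*π) ≤
      ∑ m ∈ (idx N).erase j, lg N (0 + 1/2 - radial α m) -
        ∑ m ∈ (idx N).erase j, lg N (radial α j - radial α m) := by
  have hh := step_pos N
  have hs := step_mul N
  have hj0' : (1:ℝ) ≤ j := by exact_mod_cast hj0
  have hjN' : (j:ℝ) ≤ N := by exact_mod_cast hjN
  have hjm : (j:ℤ) ∈ idx N := by simp only [mem_Icc]; omega
  have hlog2 : 0 < Real.log 2 := Real.log_pos (by norm_num)
  obtain ⟨i₀, rfl⟩ : ∃ i, j = i + 1 := ⟨j - 1, by omega⟩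
  have hrj : radial α ((i₀ + 1 : ℕ) : ℤ) = ((i₀ + 1 : ℕ) : ℝ) + α := by
    have := radial_succ α i₀
    push_cast; exact this
  set j := i₀ + 1 with hj
  have hU : ∀ ε, lg N (0 + 1/2 - radial ε j) + ∑ m ∈ (idx N).erase j, lg N (0 + 1/2 - radial ε m) =
      lg N (1/2) + ∑ i ∈ range N, lg N (1/2 + i + ε) + ∑ i ∈ range N, lg N (3/2 + i + ε) := by
    intro ε
    rw [add_sum_erase (idx N) (fun m => lg N (0 + 1/2 - radial ε m)) hjm, sum_idx_symm]
    simp only [radial_neg, radial_succ, radial_zero, sub_zero, zero_add]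
    congr 1
    · congr 1
      refine sum_congr rfl fun i _ => ?_
      rw [← lg_neg]; congr 1; ring
    · refine sum_congr rfl fun i _ => ?_
      congr 1; ring
  have hgrid : lg N (1/2) + ∑ i ∈ range N, lg N (1/2 + i) + ∑ i ∈ range N, lg N (3/2 + i) =
      Real.log 2 := by
    have h1 := hU 0
    have h2 := sum_lg_half_grid N 0
    rw [← add_sum_erase _ _ hjm] at h2
    simp only [radial, zero_mul, add_zero] at h1
    rw [Int.cast_zero, h1] at h2
    exact h2
  have hD : ∑ m ∈ (idx N).erase j, lg N (radial α j - radial α m) -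
      ∑ m ∈ (idx N).erase j, lg N (j - m) = (lg N (j + α) - lg N j) +
      (∑ i ∈ range N, lg N (j + 2*α + i + 1) - ∑ i ∈ range N, lg N (j + 2*α + i + (1 - 2*α))) := by
    set f : ℤ → ℝ := fun m => lg N (radial α j - radial α m) - lg N (j - m) with hf
    have f0 : f 0 = lg N (j + α) - lg N j := by
      simp only [hf, radial_zero, hrj, Int.cast_zero, sub_zero]
    have fpos : ∀ i : ℕ, f ((i:ℤ) + 1) = 0 := fun i => by
      simp only [hf, radial_succ, hrj]
      rw [sub_eq_zero]; congr 1; push_cast; ring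
    have fneg : ∀ i : ℕ, f (-((i:ℤ) + 1)) =
        lg N (j + 2*α + i + 1) - lg N (j + 2*α + i + (1 - 2*α)) := fun i => by
      simp only [hf, radial_neg, radial_succ, hrj]
      congr 2 <;> push_cast <;> ring
    have fj : f j = 0 := by simp [hf]
    have h1 := add_sum_erase (idx N) f hjm
    rw [sum_idx_symm, fj, f0, sum_congr rfl fun i _ => fpos i, sum_congr rfl fun i _ => fneg i,
      sum_const_zero, sum_sub_distrib, sum_sub_distrib] at h1
    linarith
  have b1 := sum_lg_le (N := N) (M := N) (a := 1/2) (l := α) (by norm_num) (by linarith) hα0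
    (by linarith)
  have b2 := sum_lg_le (N := N) (M := N) (a := 3/2) (l := α) (by norm_num) (by linarith)
    (by linarith) (by linarith)
  have b3 := sum_lg_le (N := N) (M := N) (a := j + 2*α) (l := 1 - 2*α) (by linarith) (by linarith)
    (by linarith) (by linarith)
  have s3 := sum_lg_succ N N (j + 2*α)
  have g0 := sum_lg_grid N hjm
  have c1 := lg_nonneg (N := N) (v := 1/2 + N) (by omega) (by linarith) (by linarith)
  have c2 := lg_nonneg (N := N) (v := 3/2 + N) (by omega) (by linarith) (by linarith)
  have c3 : lg N (1/2) ≤ Real.log (step N) := (lg_le_log (by linarith) (by linarith)).trans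
    (Real.log_le_log (mul_pos (by linarith) hh) (by nlinarith))
  have c4 : lg N (3/2) ≤ Real.log 2 + Real.log (step N) := by
    rw [← Real.log_mul (by positivity) hh.ne']
    exact (lg_le_log (by linarith) (by linarith)).trans
      (Real.log_le_log (by positivity) (by nlinarith))
  have c5 : lg N (0 + 1/2 - radial α j) ≤ Real.log j + Real.log (step N) := by
    rw [← Real.log_mul (by positivity) hh.ne', ← lg_neg, hrj]
    exact (lg_le_log (by linarith) (by linarith)).trans
      (Real.log_le_log (mul_pos (by linarith) hh) (by nlinarith))
  have c6 := lg_le_add_log_two (N := N) (u := j) (v := j + α) (by linarith) (by linarith)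
    (by linarith) (by linarith)
  have c7 := lg_le_log_two (N := N) (v := j + 2*α + N) (by linarith) (by linarith)
  have c8 : Real.log j + Real.log (step N) ≤ lg N (j + 2*α) + Real.log 2 := by
    rw [← Real.log_mul (by positivity) hh.ne']
    exact (Real.log_le_log (by positivity) (by nlinarith)).trans
      (log_le_lg (by linarith) (by linarith))
  have c9 : Real.log (2*N+1) + Real.log (step N) = Real.log 2 + Real.log π := by
    rw [← Real.log_mul (by positivity) hh.ne', hs, Real.log_mul (by norm_num) pi_ne_zero]
  have c10 : Real.log (8*π) = 3 * Real.log 2 + Real.log π := by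
    rw [Real.log_mul (by norm_num) pi_ne_zero]
    congr 1
    rw [show (8:ℝ) = 2 ^ 3 by norm_num, Real.log_pow]; norm_num
  have hUα := hU α
  rw [c10]
  push_cast at g0
  have d1 := mul_nonneg hα0 c1
  have d2 := mul_nonneg hα0 c2
  have d3 := mul_le_mul_of_nonneg_left c3 hα0
  have d4 := mul_le_mul_of_nonneg_left c4 hα0
  have d7 := mul_le_mul_of_nonneg_left c7 hα0
  have d8 := mul_le_mul_of_nonneg_left c8 hα0
  have d9 : α * Real.log 2 ≤ 1/4 * Real.log 2 := mul_le_mul_of_nonneg_right hα1 hlog2.le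
  linarith

/-! ### Failure at the threshold -/

lemma exists_lt_harmonic (K : ℝ) : ∃ N : ℕ, 0 < N ∧ K < ∑ k ∈ range N, 1 / ((k:ℝ) + 1) := by
  have h := Real.tendsto_sum_range_one_div_nat_succ_atTop
  obtain ⟨N, h1, h2⟩ := ((h.eventually_gt_atTop K).and (Filter.eventually_gt_atTop 0)).exists
  exact ⟨N, h2, h1⟩

lemma sum_range_le_sum_idx (N : ℕ) (f : ℤ → ℝ) (hf : ∀ m, 0 ≤ f m) :
    ∑ i ∈ range N, f i ≤ ∑ m ∈ idx N, f m := by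
  have h : ∑ i ∈ range N, f i = ∑ m ∈ (range N).map Nat.castEmbedding, f m := by
    rw [sum_map]; rfl
  rw [h]
  refine sum_le_sum_of_subset_of_nonneg (fun m hm => ?_) fun m _ _ => hf m
  obtain ⟨i, hi, rfl⟩ := mem_map.1 hm
  have := mem_range.1 hi
  simp only [Nat.castEmbedding_apply, mem_Icc]
  omega

lemma sum_range_succ_le_sum_idx (N : ℕ) (f : ℤ → ℝ) (hf : ∀ m, 0 ≤ f m) :
    ∑ i ∈ range N, f ((i + 1 : ℕ) : ℤ) ≤ ∑ m ∈ idx N, f m := by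
  rw [sum_idx_symm]
  have h1 := hf 0
  have h2 : 0 ≤ ∑ i ∈ range N, f (-((i:ℤ) + 1)) := sum_nonneg fun i _ => hf _
  push_cast
  linarith

lemma rpow_neg_inv_div_le {p u v B : ℝ} (hp : 0 < p) (hu : 0 < u) (hv : 0 < v) (hB : 0 < B)
    (h : -(1/p) * Real.log u - Real.log B ≤ Real.log v) : B ^ (-p) * (1 / u) ≤ v ^ p := by
  rw [← Real.log_le_log_iff (by positivity) (by positivity), Real.log_mul (by positivity)
    (by positivity), Real.log_rpow hB, Real.log_rpow hv, one_div, Real.log_inv]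
  have := mul_le_mul_of_nonneg_left h hp.le
  have e : p * (-(1/p) * Real.log u - Real.log B) = -p * Real.log B + -Real.log u := by
    field_simp; ring
  linarith

lemma perturbedNodes_radial {N : ℕ} {α ε : ℝ} (hε : |ε| ≤ α) :
    PerturbedNodes N α (fun j => radial ε j * step N) := by
  intro j _
  have hh := step_pos N
  change |radial ε j * step N - j * step N| ≤ α * step N
  rw [← sub_mul, abs_mul, abs_of_pos hh]
  exact mul_le_mul_of_nonneg_right ((abs_radial_sub_le ε j).trans hε) hh.le

lemma exists_lt_integral_inward {r C₁ : ℝ} (hr : 1 ≤ r) (hr2 : r ≤ 2) (hC₁ : 0 < C₁) :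
    ∃ N : ℕ, 0 < N ∧ ∃ c : ℤ → ℂ,
      step N / (2*π) * ∑ j ∈ idx N, ‖trig N c (radial (-((r-1)/(2*r))) j * step N : ℝ)‖ ^ r <
        C₁ * ∫ t in (-π)..π, ‖trig N c t‖ ^ r := by
  have hr0 : 0 < r := by linarith
  have hpi := pi_pos
  set α := (r-1)/(2*r) with hα
  have hα0 : 0 ≤ α := div_nonneg (by linarith) (by linarith)
  have hα1 : α ≤ 1/4 := by rw [hα, div_le_iff₀ (by linarith)]; linarith
  have hexp : 2*α - 1 = -(1/r) := by rw [hα]; field_simp; ring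
  have hε : |-α| < 1/2 := by rw [abs_neg, abs_of_nonneg hα0]; linarith
  obtain ⟨A, -, hsum⟩ := exists_sum_cell_le (p := 2) (by norm_num)
  obtain ⟨C, hC, hup⟩ := exists_sum_trig_le hr A
  obtain ⟨N, hN, hK⟩ := exists_lt_harmonic (C / (2*π*C₁) * (4*π) ^ r)
  have hh := step_pos N
  have hy : ∀ j ∈ idx N, |radial (-α) j - j| ≤ α := fun j _ =>
    (abs_radial_sub_le (-α) j).trans_eq (by rw [abs_neg, abs_of_nonneg hα0])
  have hx : ∀ j ∈ idx N, |radial (-α) j * step N - j * step N| ≤ α * step N :=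
    perturbedNodes_radial (by rw [abs_neg, abs_of_nonneg hα0])
  obtain ⟨c, hc⟩ := exists_trig_eq (by linarith) hx (fun j => if j = 0 then 1 else 0)
  refine ⟨N, hN, c, ?_⟩
  have h0 : (0:ℤ) ∈ idx N := by simp [idx]
  have hS : ∑ j ∈ idx N, ‖trig N c (radial (-α) j * step N : ℝ)‖ ^ r = 1 := by
    rw [sum_eq_single_of_mem 0 h0 fun j hj hj0 => ?_]
    · rw [hc 0 h0]; simp
    · rw [hc j hj, if_neg hj0, norm_zero, Real.zero_rpow hr0.ne']
  have hlow : ∀ k ∈ range N, (4*π) ^ (-r) * (1 / ((k:ℝ) + 1)) ≤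
      ‖trig N c ((((k:ℤ):ℝ) + 1/2) * step N : ℝ)‖ ^ r := by
    intro k hk
    have hk := mem_range.1 hk
    obtain ⟨b, hb, hbn⟩ := exists_weights (τ := (k:ℝ) + 1/2) (by linarith) hy
      (fun j _ => half_ne_radial hε k j) (fun j hj => abs_half_sub_radial_lt hε hk hj)
    have e := hb c
    rw [sum_eq_single_of_mem 0 h0 fun j hj hj0 => by rw [hc j hj, if_neg hj0, zero_mul], hc 0 h0,
      if_pos rfl, one_mul] at e
    have e' : ‖trig N c ((((k:ℤ):ℝ) + 1/2) * step N : ℝ)‖ = ‖b 0‖ := by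
      rw [← e, norm_mul, norm_pow, norm_pt, one_pow, mul_one, Int.cast_natCast]
    have hlog := log_sum_inward hk hα0 hα1
    rw [← (hbn 0 h0).2, hexp] at hlog
    rw [e']
    exact rpow_neg_inv_div_le hr0 (by positivity) (norm_pos_iff.2 (hbn 0 h0).1) (by positivity) hlog
  have hT := hup N (idx N) (fun j => ((j:ℝ) + 1/2) * step N) (hsum N _ fun j _ => by
    rw [← sub_mul, add_sub_cancel_left, abs_of_nonneg (by positivity)]; linarith) c
  have hsub := sum_range_le_sum_idx N (fun j => ‖trig N c (((j:ℝ) + 1/2) * step N : ℝ)‖ ^ r)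
    fun j => by positivity
  have hlow' := (sum_le_sum hlow).trans hsub
  rw [← mul_sum, Real.rpow_neg (by positivity), inv_mul_le_iff₀ (by positivity)] at hlow'
  rw [hS, mul_one]
  by_contra! hcon
  have h1 : step N * ∑ j ∈ idx N, ‖trig N c (((j:ℝ) + 1/2) * step N : ℝ)‖ ^ r ≤
      step N * (C / (2*π*C₁)) := by
    refine hT.trans ?_
    rw [← le_div_iff₀' hC₁] at hcon
    refine (mul_le_mul_of_nonneg_left hcon hC.le).trans_eq ?_
    field_simp
  have h2 := le_of_mul_le_mul_left h1 hh
  have h3 := mul_le_mul_of_nonneg_left h2 (by positivity : 0 ≤ (4*π) ^ r)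
  linarith

lemma exists_lt_integral_outward {r C₁ : ℝ} (hr : 2 ≤ r) (hC₁ : 0 < C₁) :
    ∃ N : ℕ, 0 < N ∧ ∃ c : ℤ → ℂ,
      step N / (2*π) * ∑ j ∈ idx N, ‖trig N c (radial (1/(2*r)) j * step N : ℝ)‖ ^ r <
        C₁ * ∫ t in (-π)..π, ‖trig N c t‖ ^ r := by
  have hr0 : 0 < r := by linarith
  have hpi := pi_pos
  set α := 1/(2*r) with hα
  have hα0 : 0 ≤ α := by positivity
  have hα1 : α ≤ 1/4 := by rw [hα, div_le_iff₀ (by linarith)]; linarith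
  set s := r/(r-1) with hs
  have hr1 : 0 < r - 1 := by linarith
  have hs1 : 1 < s := by rw [hs, one_lt_div hr1]; linarith
  have hs0 : 0 < s := by linarith
  have hexp : 2*α - 1 = -(1/s) := by rw [hα, hs]; field_simp; ring
  have hsr : (s - 1) * r = s := by rw [hs]; field_simp; ring
  have hε : |α| < 1/2 := by rw [abs_of_nonneg hα0]; linarith
  obtain ⟨C, hC, hup⟩ := exists_sum_trig_le (by linarith : 1 ≤ r) 1
  set K := max 1 (C / (2*π*C₁)) with hKdef
  obtain ⟨N, hN, hK⟩ := exists_lt_harmonic ((8*π) ^ s * K)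
  have hh := step_pos N
  have hy : ∀ j ∈ idx N, |radial α j - j| ≤ α := fun j _ =>
    (abs_radial_sub_le α j).trans_eq (abs_of_nonneg hα0)
  have hx : ∀ j ∈ idx N, |radial α j * step N - j * step N| ≤ α * step N :=
    perturbedNodes_radial (abs_of_nonneg hα0).le
  obtain ⟨b, hb, hbn⟩ := exists_weights (τ := 0 + 1/2) (by linarith) hy
    (fun j _ => by simpa using half_ne_radial hε 0 j)
    (fun j hj => by simpa using abs_half_sub_radial_lt hε hN hj)
  choose g hg hgn using fun j => exists_dual hs1 (b j)
  obtain ⟨c, hc⟩ := exists_trig_eq (by linarith) hx g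
  refine ⟨N, hN, c, ?_⟩
  set T := ∑ j ∈ idx N, ‖b j‖ ^ s with hT
  have hS : ∑ j ∈ idx N, ‖trig N c (radial α j * step N : ℝ)‖ ^ r = T :=
    sum_congr rfl fun j hj => by
      rw [hc j hj, hgn, ← Real.rpow_mul (norm_nonneg _), hsr]
  have hval : ‖trig N c ((0 + 1/2) * step N : ℝ)‖ = T := by
    have e : trig N c ((0 + 1/2) * step N : ℝ) * pt ((0 + 1/2) * step N) ^ N = (T : ℝ) := by
      rw [hb c, hT, Complex.ofReal_sum]
      exact sum_congr rfl fun j hj => by rw [hc j hj, mul_comm, hg]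
    have e' := congrArg norm e
    rw [norm_mul, norm_pow, norm_pt, one_pow, mul_one, Complex.norm_real, Real.norm_of_nonneg
      (sum_nonneg fun j _ => by positivity)] at e'
    exact e'
  have hlow : ∀ i ∈ range N, (8*π) ^ (-s) * (1 / ((i:ℝ) + 1)) ≤ ‖b ((i + 1 : ℕ) : ℤ)‖ ^ s := by
    intro i hi
    have hi := mem_range.1 hi
    have hm : ((i + 1 : ℕ) : ℤ) ∈ idx N := by simp only [mem_Icc]; omega
    have hlog := log_sum_outward (N := N) (j := i + 1) (by omega) (by omega) hα0 hα1
    rw [← (hbn _ hm).2, hexp] at hlog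
    have := rpow_neg_inv_div_le hs0 (by positivity) (norm_pos_iff.2 (hbn _ hm).1) (by positivity)
      hlog
    rwa [Nat.cast_add_one] at this
  have hlow' := (sum_le_sum hlow).trans (sum_range_succ_le_sum_idx N (fun j => ‖b j‖ ^ s)
    fun j => by positivity)
  rw [← mul_sum, Real.rpow_neg (by positivity), inv_mul_le_iff₀ (by positivity)] at hlow'
  have hKT : K < T := lt_of_mul_lt_mul_left (hK.trans_le hlow') (by positivity)
  have hT1 : 1 < T := (le_max_left _ _).trans_lt hKT
  have hup' := hup N {0} (fun _ => (0 + 1/2) * step N) (fun t => by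
    rw [sum_singleton]
    exact Real.rpow_le_one_of_one_le_of_nonpos (one_le_cell _ _ _) (by norm_num)) c
  rw [sum_singleton, hval] at hup'
  rw [hS]
  by_contra! hcon
  have h1 : step N * T ^ r ≤ step N * (C / (2*π*C₁) * T) := by
    refine hup'.trans ?_
    rw [← le_div_iff₀' hC₁] at hcon
    refine (mul_le_mul_of_nonneg_left hcon hC.le).trans_eq ?_
    field_simp
  have h2 := le_of_mul_le_mul_left h1 hh
  have h3 : T ^ (2:ℝ) ≤ T ^ r := Real.rpow_le_rpow_of_exponent_le hT1.le hr
  have h4 : C / (2*π*C₁) < T := (le_max_right _ _).trans_lt hKT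
  rw [Real.rpow_two] at h3
  nlinarith

/-- The lower Marcinkiewicz–Zygmund inequality fails from the threshold on. -/
lemma exists_not_mzIneq {r C₁ α : ℝ} (C₂ : ℝ) (hr : 1 ≤ r) (hC₁ : 0 < C₁)
    (hα : min (1/(2*r)) ((r-1)/(2*r)) ≤ α) :
    ∃ N : ℕ, 0 < N ∧ ∃ x : ℤ → ℝ, PerturbedNodes N α x ∧
      ∃ q : ℝ → ℂ, IsTrigPoly N q ∧ ¬ MZIneq r C₁ C₂ N x q := by
  have hr0 : 0 < r := by linarith
  obtain ⟨ε, hε, N, hN, c, h⟩ : ∃ ε : ℝ, |ε| ≤ α ∧ ∃ N : ℕ, 0 < N ∧ ∃ c : ℤ → ℂ,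
      step N / (2*π) * ∑ j ∈ idx N, ‖trig N c (radial ε j * step N : ℝ)‖ ^ r <
        C₁ * ∫ t in (-π)..π, ‖trig N c t‖ ^ r := by
    rcases le_total r 2 with h | h
    · refine ⟨_, ?_, exists_lt_integral_inward hr h hC₁⟩
      rw [min_eq_right (by gcongr; linarith)] at hα
      rwa [abs_neg, abs_of_nonneg (div_nonneg (by linarith) (by linarith))]
    · refine ⟨_, ?_, exists_lt_integral_outward h hC₁⟩
      rw [min_eq_left (by gcongr; linarith)] at hα
      rwa [abs_of_nonneg (by positivity)]
  refine ⟨N, hN, _, perturbedNodes_radial hε, fun t => trig N c t, ⟨c, fun t => rfl⟩, fun hmz => ?_⟩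
  have e : 1/(2*(N:ℝ)+1) = step N / (2*π) := by
    rw [← step_mul N]; have := step_pos N; field_simp
  have h1 := hmz.1
  rw [e] at h1
  exact absurd h (not_lt.2 h1)

end MZ

/-- sharp threshold min{1/(2r), (r−1)/(2r)} for L^r Marcinkiewicz–Zygmund
inequalities at α-perturbed nodes. -/
theorem mz_threshold (r : ℝ) (hr : 1 ≤ r) :
    (∀ C₁ C₂ : ℝ, 0 < C₁ → 0 < C₂ → ∀ α : ℝ,
      min (1/(2*r)) ((r-1)/(2*r)) ≤ α → α < 1/2 →
        ∃ N : ℕ, 0 < N ∧ ∃ x : ℤ → ℝ, PerturbedNodes N α x ∧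
          ∃ q : ℝ → ℂ, IsTrigPoly N q ∧ ¬ MZIneq r C₁ C₂ N x q) ∧
    (∀ α : ℝ, 0 ≤ α → α < min (1/(2*r)) ((r-1)/(2*r)) →
      ∃ C₁ C₂ : ℝ, 0 < C₁ ∧ 0 < C₂ ∧
        ∀ N : ℕ, 0 < N → ∀ x : ℤ → ℝ, PerturbedNodes N α x →
          ∀ q : ℝ → ℂ, IsTrigPoly N q → MZIneq r C₁ C₂ N x q) :=
  ⟨fun _ C₂ hC₁ _ _ hα _ => MZ.exists_not_mzIneq C₂ hr hC₁ hα,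
    fun _ hα0 hα => MZ.exists_mzIneq hr hα0 hα⟩
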